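/- arXiv:1811.09723 — 2 statements merged into one kernel-verified Lean document; each statement's English description precedes it below -/
import Mathlib

section
/- Let 3α + 2β = π, and suppose there is an N-tiling of a triangle ABC by a tile with angles (α, β, γ) that is not similar to ABC. Then α and β are not rational multiples of π, and every integer linear relation among π, α, and β is an integer multiple of the relation 3α + 2β = π; that is, if p, q, r are integers with pα + qβ = rπ, then p = 3r and q = 2r. -/
open EuclideanGeometry Real

noncomputable section

/-- A point of the Euclidean plane. -/
abbrev Pt : Type := EuclideanSpace ℝ (Fin 2)

/-- A triangle, given by its three vertices. -/
abbrev Tri : Type := Fin 3 → Pt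

/-- A genuine (nondegenerate) triangle. -/
def IsTriangle (T : Tri) : Prop := AffineIndependent ℝ T

/-- The closed triangle (convex hull of the vertices). -/
def triSet (T : Tri) : Set Pt := convexHull ℝ (Set.range T)

/-- Two triangles are congruent iff corresponding distances agree
up to a permutation of the vertices. -/
def CongruentTri (T₁ T₂ : Tri) : Prop :=
  ∃ σ : Equiv.Perm (Fin 3), ∀ i j : Fin 3, dist (T₁ i) (T₁ j) = dist (T₂ (σ i)) (T₂ (σ j))

/-- An `N`-tiling of the triangle `ABC` by the tile `T`: a family of `N` triangles,
each congruent to `T`, with pairwise disjoint interiors, whose union is the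
closed triangle `ABC`. -/
structure IsTiling (N : ℕ) (ABC T : Tri) (tiles : Fin N → Tri) : Prop where
  congr : ∀ i, CongruentTri (tiles i) T
  disj : ∀ i j, i ≠ j → interior (triSet (tiles i)) ∩ interior (triSet (tiles j)) = ∅
  cover : (⋃ i, triSet (tiles i)) = triSet ABC

/-- The interior angle of the triangle `T` at its `k`-th vertex. -/
def triAngle (T : Tri) (k : Fin 3) : ℝ := ∠ (T (k + 1)) (T k) (T (k + 2))

/-- The side of `T` opposite to the `k`-th vertex. -/
def sideLen (T : Tri) (k : Fin 3) : ℝ := dist (T (k + 1)) (T (k + 2))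

/-- `T` has angles `α`, `β`, `γ` (at vertices `0`, `1`, `2`, which are opposite
the sides of lengths `a`, `b`, `c` respectively). -/
def HasAngles (T : Tri) (α β γ : ℝ) : Prop :=
  triAngle T 0 = α ∧ triAngle T 1 = β ∧ triAngle T 2 = γ

/-- Two triangles are similar iff corresponding distances agree up to a
permutation of the vertices and a positive scale factor. -/
def SimilarTri (T₁ T₂ : Tri) : Prop :=
  ∃ r : ℝ, 0 < r ∧ ∃ σ : Equiv.Perm (Fin 3),
    ∀ i j : Fin 3, dist (T₁ i) (T₁ j) = r * dist (T₂ (σ i)) (T₂ (σ j))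

section

def crs (z w : ℂ) : ℝ := z.re * w.im - z.im * w.re
def dt (P : Fin 3 → ℂ) : ℝ := crs (P 1 - P 0) (P 2 - P 0)
def sg (P : Fin 3 → ℂ) : ℝ := if 0 < dt P then 1 else -1
def ed (P : Fin 3 → ℂ) (k : Fin 3) : ℂ := (sg P : ℂ) * (P (k + 2) - P (k + 1))
def un (P : Fin 3 → ℂ) (k : Fin 3) : ℂ := ed P k / (‖ed P k‖ : ℂ)
def off (P : Fin 3 → ℂ) (k : Fin 3) : ℝ := crs (un P k) (P (k + 1))
def lam (P : Fin 3 → ℂ) (k : Fin 3) (z : ℂ) : ℝ := crs (ed P k) (z - P (k + 1))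

lemma sg_mul_dt (P : Fin 3 → ℂ) : sg P * dt P = |dt P| := by
  unfold sg; split_ifs with h
  · rw [abs_of_pos h]; ring
  · rw [abs_of_nonpos (not_lt.mp h)]; ring

lemma sg_sq (P : Fin 3 → ℂ) : sg P * sg P = 1 := by
  unfold sg; split_ifs <;> norm_num

lemma lam_eq (P : Fin 3 → ℂ) (k : Fin 3) (z : ℂ) :
    lam P k z = sg P * crs (P (k + 2) - P (k + 1)) (z - P (k + 1)) := by
  simp [lam, ed, crs]; ring

lemma lam_sum (P : Fin 3 → ℂ) (k : Fin 3) (z : ℂ) :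
    lam P k z + lam P (k + 1) z + lam P (k + 2) z = |dt P| := by
  rw [← sg_mul_dt]; simp only [lam_eq, dt, crs]
  fin_cases k <;> simp <;> ring

lemma lam_vert (P : Fin 3 → ℂ) (k j : Fin 3) :
    lam P k (P j) = if k = j then |dt P| else 0 := by
  rw [← sg_mul_dt]; simp only [lam_eq, dt, crs]
  fin_cases k <;> fin_cases j <;>
    simp [-mul_eq_mul_left_iff, -mul_eq_zero, -mul_eq_mul_right_iff] <;> ring

lemma lam_comb (P : Fin 3 → ℂ) (z : ℂ) :
    (|dt P| : ℝ) • z = ∑ k, lam P k z • P k := by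
  rw [← sg_mul_dt, Fin.sum_univ_three]; simp only [lam_eq, dt, crs]
  apply Complex.ext <;> simp <;> ring

lemma convex_lam (P : Fin 3 → ℂ) (k : Fin 3) : Convex ℝ {z | 0 ≤ lam P k z} := by
  intro x hx y hy a b ha hb hab
  simp only [Set.mem_ofPred_eq] at *
  have : lam P k (a • x + b • y) = a * lam P k x + b * lam P k y := by
    obtain rfl : b = 1 - a := by linarith
    simp [lam, crs]; ring
  rw [this]; positivity

lemma mem_hull {P : Fin 3 → ℂ} (h : dt P ≠ 0) (z : ℂ) :
    z ∈ convexHull ℝ (Set.range P) ↔ ∀ k, 0 ≤ lam P k z := by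
  have hp : 0 < |dt P| := abs_pos.mpr h
  constructor
  · intro hz k
    have : convexHull ℝ (Set.range P) ⊆ {z | 0 ≤ lam P k z} := by
      apply convexHull_min _ (convex_lam P k)
      rintro _ ⟨j, rfl⟩
      simp only [Set.mem_ofPred_eq, lam_vert]
      split_ifs <;> positivity
    exact this hz
  · intro hz
    have e : z = ∑ k, (lam P k z / |dt P|) • P k := by
      have := lam_comb P z
      have h2 : ∑ k, (lam P k z / |dt P|) • P k = (|dt P|)⁻¹ • (|dt P| • z) := by
        rw [this, Finset.smul_sum]
        refine Finset.sum_congr rfl fun k _ => ?_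
        rw [smul_smul]; congr 1; field_simp
      rw [h2, smul_smul, inv_mul_cancel₀ hp.ne', one_smul]
    rw [e]
    apply (convex_convexHull ℝ _).sum_mem
    · intro i _; exact div_nonneg (hz i) hp.le
    · rw [Fin.sum_univ_three]
      have := lam_sum P 0 z
      simp only [zero_add] at this
      field_simp; exact this
    · intro i _; exact subset_convexHull ℝ _ ⟨i, rfl⟩

lemma cont_lam (P : Fin 3 → ℂ) (k : Fin 3) : Continuous (lam P k) := by
  unfold lam crs; fun_prop

lemma mem_int {P : Fin 3 → ℂ} (h : dt P ≠ 0) (z : ℂ) (hz : ∀ k, 0 < lam P k z) :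
    z ∈ interior (convexHull ℝ (Set.range P)) := by
  have ho : IsOpen {z | ∀ k, 0 < lam P k z} := by
    simp only [Set.ofPred_forall]
    exact isOpen_iInter_of_finite fun k => isOpen_lt continuous_const (cont_lam P k)
  exact interior_maximal (fun w hw => (mem_hull h w).2 fun k => (hw k).le) ho hz

lemma ed_ne {P : Fin 3 → ℂ} (h : dt P ≠ 0) (k : Fin 3) : ed P k ≠ 0 := by
  intro h0
  have := lam_vert P k k
  simp [lam, h0, crs] at this
  exact h (abs_eq_zero.mp this.symm)

lemma norm_ed_pos {P : Fin 3 → ℂ} (h : dt P ≠ 0) (k : Fin 3) : 0 < ‖ed P k‖ :=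
  norm_pos_iff.mpr (ed_ne h k)

lemma ed_un {P : Fin 3 → ℂ} (h : dt P ≠ 0) (k : Fin 3) : ed P k = (‖ed P k‖ : ℂ) * un P k := by
  have : (‖ed P k‖ : ℂ) ≠ 0 := by exact_mod_cast (norm_ed_pos h k).ne'
  rw [un, mul_div_cancel₀ _ this]

lemma norm_un {P : Fin 3 → ℂ} (h : dt P ≠ 0) (k : Fin 3) : ‖un P k‖ = 1 := by
  have := norm_ed_pos h k
  simp [un, this.ne']

lemma norm_ed (P : Fin 3 → ℂ) (k : Fin 3) : ‖ed P k‖ = dist (P (k + 1)) (P (k + 2)) := by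
  rw [dist_comm, Complex.dist_eq, ed, norm_mul]
  have : ‖(sg P : ℂ)‖ = 1 := by unfold sg; split_ifs <;> simp
  rw [this, one_mul]

lemma crs_ed (P : Fin 3 → ℂ) (k : Fin 3) : crs (ed P k) (ed P (k + 1)) = dt P := by
  have e : crs (ed P k) (ed P (k + 1)) =
     (sg P * sg P) * crs (P (k + 2) - P (k + 1)) (P (k + 1 + 2) - P (k + 1 + 1)) := by
    simp [ed, crs]; ring
  rw [e, sg_sq, one_mul]
  simp only [dt, crs]
  fin_cases k <;> simp <;> ring

/-- the point over the line (v,c) with coordinate x, height t -/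
def pt (v : ℂ) (c x t : ℝ) : ℂ := x * v + (c + t) * (Complex.I * v)

lemma lam_pt {P : Fin 3 → ℂ} (h : dt P ≠ 0) (k : Fin 3) (v : ℂ) (c x t : ℝ) :
    lam P k (pt v c x t) = ‖ed P k‖ * (crs (un P k) v * x + crs (un P k) (Complex.I * v) * (c + t)
      - off P k) := by
  rw [lam, ed_un h k]
  have : ‖(‖ed P k‖ : ℂ) * un P k‖ = ‖ed P k‖ := by rw [← ed_un h k]
  simp [pt, off, crs, norm_un h]; ring

end

section

structure Til {N : ℕ} (P : Fin N → Fin 3 → ℂ) (Q : Fin 3 → ℂ) : Prop where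
  hP : ∀ i, dt (P i) ≠ 0
  hQ : dt Q ≠ 0
  disj : ∀ i j, i ≠ j → ∀ z, (∀ k, 0 < lam (P i) k z) → (∀ k, 0 < lam (P j) k z) → False
  cov : ∀ z, (∀ k, 0 ≤ lam Q k z) ↔ ∃ i, ∀ k, 0 ≤ lam (P i) k z

lemma crs_zero {u v : ℂ} (hu : ‖u‖ = 1) (hv : ‖v‖ = 1) (h : crs u v = 0) : u = v ∨ u = -v := by
  have h1 : u.re ^ 2 + u.im ^ 2 = 1 := by
    have := Complex.sq_norm u; rw [hu, Complex.normSq_apply] at this; linarith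
  have h2 : v.re ^ 2 + v.im ^ 2 = 1 := by
    have := Complex.sq_norm v; rw [hv, Complex.normSq_apply] at this; linarith
  simp only [crs] at h
  have h3 : (u.re * v.re + u.im * v.im - 1) * (u.re * v.re + u.im * v.im + 1) = 0 := by
    linear_combination (v.re ^ 2 + v.im ^ 2) * h1 + h2 - (u.re * v.im - u.im * v.re) * h
  rcases mul_eq_zero.mp h3 with h4 | h4
  · left
    have h5 : (u.re - v.re) ^ 2 + (u.im - v.im) ^ 2 = 0 := by linear_combination h1 + h2 - 2 * h4
    apply Complex.ext <;> nlinarith [sq_nonneg (u.re - v.re), sq_nonneg (u.im - v.im)]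
  · right
    have h5 : (u.re + v.re) ^ 2 + (u.im + v.im) ^ 2 = 0 := by linear_combination h1 + h2 + 2 * h4
    apply Complex.ext <;> simp <;> nlinarith [sq_nonneg (u.re + v.re), sq_nonneg (u.im + v.im)]

def isK (P : Fin 3 → ℂ) (v : ℂ) (c : ℝ) (k : Fin 3) : Prop := un P k = v ∧ off P k = c

def nbad (P : Fin 3 → ℂ) (v : ℂ) (c x : ℝ) : Prop :=
  ∀ k, lam P k (pt v c x 0) ≠ 0 ∨ isK P v c k ∨ isK P (-v) (-c) k

lemma crs_I {v : ℂ} (hv : ‖v‖ = 1) : crs v (Complex.I * v) = 1 := by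
  have := Complex.sq_norm v; rw [hv, Complex.normSq_apply] at this
  simp [crs]; linarith

lemma crs_self (v : ℂ) : crs v v = 0 := by simp [crs]; ring
lemma crs_neg (v w : ℂ) : crs (-v) w = - crs v w := by simp [crs]; ring

lemma lam_isK {P : Fin 3 → ℂ} (h : dt P ≠ 0) {v : ℂ} (hv : ‖v‖ = 1) {c : ℝ} {k : Fin 3}
    (hk : isK P v c k) (x t : ℝ) : lam P k (pt v c x t) = ‖ed P k‖ * t := by
  rw [lam_pt h, hk.1, hk.2, crs_I hv, crs_self]; ring

lemma lam_isK' {P : Fin 3 → ℂ} (h : dt P ≠ 0) {v : ℂ} (hv : ‖v‖ = 1) {c : ℝ} {k : Fin 3}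
    (hk : isK P (-v) (-c) k) (x t : ℝ) : lam P k (pt v c x t) = - (‖ed P k‖ * t) := by
  rw [lam_pt h, hk.1, hk.2, crs_neg, crs_neg, crs_I hv, crs_self]; ring

lemma bad_fin {P : Fin 3 → ℂ} (h : dt P ≠ 0) {v : ℂ} (hv : ‖v‖ = 1) (c : ℝ) :
    {x | ¬ nbad P v c x}.Finite := by
  have : {x | ¬ nbad P v c x} = ⋃ k, {x | ¬ (lam P k (pt v c x 0) ≠ 0 ∨ isK P v c k ∨ isK P (-v) (-c) k)} := by
    ext x; simp [nbad]
  rw [this]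
  refine Set.finite_iUnion fun k => ?_
  have hl := (norm_ed_pos h k).ne'
  by_cases h0 : crs (un P k) v = 0
  · convert Set.finite_empty
    ext x
    simp only [Set.mem_ofPred_eq, Set.mem_empty_iff_false, iff_false, not_not]
    rcases crs_zero (norm_un h k) hv h0 with h1 | h1
    · by_cases h2 : off P k = c
      · exact Or.inr (Or.inl ⟨h1, h2⟩)
      · left; rw [lam_pt h, h1, crs_I hv, crs_self]
        apply mul_ne_zero hl; intro h3; apply h2; linarith
    · by_cases h2 : off P k = -c
      · exact Or.inr (Or.inr ⟨h1, h2⟩)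
      · left; rw [lam_pt h, h1, crs_neg, crs_neg, crs_I hv, crs_self]
        apply mul_ne_zero hl; intro h3; apply h2; linarith
  · apply Set.Subsingleton.finite
    intro x hx y hy
    simp only [Set.mem_ofPred_eq, not_or, not_not] at hx hy
    have h1 := hx.1; have h2 := hy.1
    rw [lam_pt h, mul_eq_zero, or_iff_right hl] at h1 h2
    exact mul_left_cancel₀ h0 (by linarith)

def qq (P : Fin 3 → ℂ) (v : ℂ) (c : ℝ) (τ x : ℝ) (k : Fin 3) : Prop :=
  0 < lam P k (pt v c x 0) ∨ isK P ((τ : ℂ) * v) (τ * c) k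

open Filter Topology in
lemma ev_qq {P : Fin 3 → ℂ} (h : dt P ≠ 0) {v : ℂ} (hv : ‖v‖ = 1) {c x τ : ℝ}
    (hx : nbad P v c x) (hτ : τ = 1 ∨ τ = -1) :
    ∀ᶠ t in 𝓝[>] (0 : ℝ), ∀ k, lam P k (pt v c x (τ * t)) ≠ 0 ∧
      (0 < lam P k (pt v c x (τ * t)) ↔ qq P v c τ x k) := by
  rw [eventually_all]
  intro k
  have hl := norm_ed_pos h k
  have hc : Continuous fun t : ℝ => lam P k (pt v c x (τ * t)) := by
    refine (cont_lam P k).comp ?_; unfold pt; fun_prop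
  have hc0 : Tendsto (fun t : ℝ => lam P k (pt v c x (τ * t))) (𝓝[>] 0) (𝓝 (lam P k (pt v c x 0))) := by
    have := hc.tendsto 0; simp only [mul_zero] at this
    exact this.mono_left nhdsWithin_le_nhds
  by_cases h0 : lam P k (pt v c x 0) = 0
  · have hne : ∀ w : ℂ, w = 1 * v → v ≠ 0 := by
      rintro w - rfl; simp at hv
    have hvv : v ≠ -v := by
      intro hh; exact hne _ rfl (self_eq_neg.mp hh)
    filter_upwards [self_mem_nhdsWithin] with t ht
    have ht : 0 < t := ht
    have hlt : 0 < ‖ed P k‖ * t := mul_pos hl ht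
    rcases (hx k).resolve_left (not_not.mpr h0) with hk | hk
    · rw [lam_isK h hv hk, qq, h0]
      rcases hτ with rfl | rfl
      · simpa [hk, hlt.ne', ht.ne', hl.ne', ed_ne h k] using hlt
      · have : ¬ isK P (-v) (-c) k := fun h' => hvv (hk.1.symm.trans h'.1)
        simp [this, ht.ne', ed_ne h k, hlt.le]
    · rw [lam_isK' h hv hk, qq, h0]
      rcases hτ with rfl | rfl
      · have : ¬ isK P v c k := fun h' => hvv (h'.1.symm.trans hk.1)
        simp [this, ht.ne', ed_ne h k]
        positivity
      · simpa [hk, hlt.ne', ht.ne', hl.ne', ed_ne h k] using hlt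
  · have hK : ¬ isK P ((τ : ℂ) * v) (τ * c) k := by
      intro hk
      rcases hτ with rfl | rfl
      · simp at hk; exact h0 (by rw [lam_isK h hv hk]; simp)
      · simp at hk; exact h0 (by rw [lam_isK' h hv hk]; simp)
    rcases lt_or_gt_of_ne h0 with h1 | h1
    · filter_upwards [hc0.eventually_lt_const h1] with t ht
      exact ⟨ht.ne, by simp [qq, hK, h1.not_gt, ht.not_gt]⟩
    · filter_upwards [hc0.eventually_const_lt h1] with t ht
      exact ⟨ht.ne', by simp [qq, h1, ht]⟩

open Classical in
lemma point_id {N : ℕ} {P : Fin N → Fin 3 → ℂ} {Q : Fin 3 → ℂ} (H : Til P Q) {v : ℂ}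
    (hv : ‖v‖ = 1) {c x τ : ℝ} (hx : ∀ i, nbad (P i) v c x) (hxQ : nbad Q v c x)
    (hτ : τ = 1 ∨ τ = -1) :
    (∑ i, if ∀ k, qq (P i) v c τ x k then (1 : ℝ) else 0) = if ∀ k, qq Q v c τ x k then 1 else 0 := by
  have e1 := Filter.eventually_all.mpr fun i => ev_qq (H.hP i) hv (hx i) hτ
  have e2 := ev_qq H.hQ hv hxQ hτ
  obtain ⟨t, ht, htQ⟩ := (e1.and e2).exists
  set z := pt v c x (τ * t)
  have a1 : ∀ i, (∀ k, qq (P i) v c τ x k) ↔ ∀ k, 0 < lam (P i) k z := fun i =>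
    forall_congr' fun k => ((ht i k).2).symm
  have a2 : (∀ k, qq Q v c τ x k) ↔ ∀ k, 0 < lam Q k z :=
    forall_congr' fun k => ((htQ k).2).symm
  simp only [a1, a2]
  by_cases hq : ∀ k, 0 < lam Q k z
  · rw [if_pos hq]
    obtain ⟨i, hi⟩ := (H.cov z).1 fun k => (hq k).le
    have hi' : ∀ k, 0 < lam (P i) k z := fun k => lt_of_le_of_ne (hi k) (ht i k).1.symm
    rw [Finset.sum_eq_single i, if_pos hi']
    · intro j _ hj
      rw [if_neg fun hj' => H.disj j i hj z hj' hi']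
    · simp
  · rw [if_neg hq]
    refine Finset.sum_eq_zero fun i _ => if_neg fun hi => hq fun k => ?_
    exact lt_of_le_of_ne ((H.cov z).2 ⟨i, fun k => (hi k).le⟩ k) (htQ k).1.symm

open Classical in
def kap (P : Fin 3 → ℂ) (v : ℂ) (c : ℝ) (k : Fin 3) : ℝ :=
  (if isK P v c k then 1 else 0) - (if isK P (-v) (-c) k then 1 else 0)

open Classical in
def seg (P : Fin 3 → ℂ) (v : ℂ) (c : ℝ) (k : Fin 3) (x : ℝ) : ℝ :=
  if 0 < lam P (k + 1) (pt v c x 0) ∧ 0 < lam P (k + 2) (pt v c x 0) then 1 else 0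

lemma un_crs {P : Fin 3 → ℂ} (h : dt P ≠ 0) (k : Fin 3) : crs (un P k) (un P (k + 1)) ≠ 0 := by
  intro h0
  have := crs_ed P k
  rw [ed_un h k, ed_un h (k + 1)] at this
  have e : ∀ (a b : ℝ) (u w : ℂ), crs (a * u) (b * w) = a * b * crs u w := by
    intro a b u w; simp [crs]; ring
  rw [e, h0] at this
  exact h (by linarith)

def par (P : Fin 3 → ℂ) (v : ℂ) (k : Fin 3) : Prop := un P k = v ∨ un P k = -v

lemma par_crs {P : Fin 3 → ℂ} {v : ℂ} {k j : Fin 3} (h1 : par P v k) (h2 : par P v j) :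
    crs (un P k) (un P j) = 0 := by
  rcases h1 with h1 | h1 <;> rcases h2 with h2 | h2 <;> rw [h1, h2] <;> simp [crs] <;> ring

lemma par_uniq {P : Fin 3 → ℂ} (h : dt P ≠ 0) {v : ℂ} {k j : Fin 3} (h1 : par P v k)
    (h2 : par P v j) : k = j := by
  by_contra hne
  have : j = k + 1 ∨ k = j + 1 := by omega
  rcases this with rfl | rfl
  · exact un_crs h _ (par_crs h1 h2)
  · exact un_crs h _ (par_crs h2 h1)

open Classical in
lemma tri_diff {P : Fin 3 → ℂ} (h : dt P ≠ 0) {v : ℂ} (hv : ‖v‖ = 1) (c x : ℝ) :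
    (if ∀ k, qq P v c 1 x k then (1 : ℝ) else 0) - (if ∀ k, qq P v c (-1) x k then 1 else 0) =
      ∑ k, kap P v c k * seg P v c k x := by
  have hv0 : v ≠ 0 := by rintro rfl; simp at hv
  have hvv : v ≠ -v := fun hh => hv0 (self_eq_neg.mp hh)
  have hq1 : ∀ k, qq P v c 1 x k ↔ (0 < lam P k (pt v c x 0) ∨ isK P v c k) := by simp [qq]
  have hq2 : ∀ k, qq P v c (-1) x k ↔ (0 < lam P k (pt v c x 0) ∨ isK P (-v) (-c) k) := by simp [qq]
  simp only [hq1, hq2]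
  have key : ∀ k, isK P v c k ∨ isK P (-v) (-c) k → ∀ j, j ≠ k → ¬ isK P v c j ∧ ¬ isK P (-v) (-c) j := by
    intro k hk j hj
    have hk' : par P v k := hk.imp (fun a => a.1) (fun a => a.1)
    exact ⟨fun a => hj (par_uniq h (Or.inl a.1) hk'), fun a => hj (par_uniq h (Or.inr a.1) hk')⟩
  by_cases hK : ∃ k, isK P v c k ∨ isK P (-v) (-c) k
  · obtain ⟨k, hk⟩ := hK
    have hkk := key k hk
    have hs : ∀ j : Fin 3, j ≠ k → kap P v c j = 0 := fun j hj => by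
      simp [kap, (hkk j hj).1, (hkk j hj).2]
    rw [Finset.sum_eq_single k (fun j _ hj => by rw [hs j hj, zero_mul]) (by simp)]
    have h1 := hkk (k + 1) (by omega)
    have h2 := hkk (k + 2) (by omega)
    have all3 : ∀ p : Fin 3 → Prop, (∀ j, p j) ↔ p k ∧ p (k + 1) ∧ p (k + 2) := by
      intro p
      refine ⟨fun a => ⟨a _, a _, a _⟩, fun a j => ?_⟩
      have : j = k ∨ j = k + 1 ∨ j = k + 2 := by omega
      rcases this with rfl | rfl | rfl
      exacts [a.1, a.2.1, a.2.2]
    simp only [all3 (fun j => 0 < lam P j (pt v c x 0) ∨ isK P v c j),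
      all3 (fun j => 0 < lam P j (pt v c x 0) ∨ isK P (-v) (-c) j)]
    rcases hk with hk | hk
    · have h3 : ¬ isK P (-v) (-c) k := fun h' => hvv (hk.1.symm.trans h'.1)
      have h4 := lam_isK h hv hk x 0
      rw [mul_zero] at h4
      simp [h1, h2, hk, h3, h4, kap, seg]
    · have h3 : ¬ isK P v c k := fun h' => hvv (h'.1.symm.trans hk.1)
      have h4 := lam_isK' h hv hk x 0
      rw [mul_zero, neg_zero] at h4
      simp [h1, h2, hk, h3, h4, kap, seg]
      split_ifs <;> simp
  · push Not at hK
    simp [hK, kap]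

open MeasureTheory in
lemma seg_int_aux (m q D : ℝ) (hm : m ≠ 0) :
    {x : ℝ | 0 < m * x + q ∧ m * x + q < D} = 
      if 0 < m then Set.Ioo (-q / m) ((D - q) / m) else Set.Ioo ((D - q) / m) (-q / m) := by
  split_ifs with h
  · ext x
    simp only [Set.mem_ofPred_eq, Set.mem_Ioo, div_lt_iff₀ h, lt_div_iff₀ h]
    constructor <;> rintro ⟨a, b⟩ <;> constructor <;> nlinarith
  · have h' : m < 0 := lt_of_le_of_ne (not_lt.mp h) hm
    ext x
    simp only [Set.mem_ofPred_eq, Set.mem_Ioo, div_lt_iff_of_neg h', lt_div_iff_of_neg h']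
    constructor <;> rintro ⟨a, b⟩ <;> constructor <;> nlinarith

open MeasureTheory in
lemma seg_int {P : Fin 3 → ℂ} (h : dt P ≠ 0) {v : ℂ} (hv : ‖v‖ = 1) (c : ℝ) (k : Fin 3)
    (hk : isK P v c k ∨ isK P (-v) (-c) k) :
    Integrable (seg P v c k) ∧ ∫ x, seg P v c k x = ‖ed P k‖ := by
  classical
  have hl := norm_ed_pos h k
  have hD : 0 < |dt P| := abs_pos.mpr h
  have h0 : ∀ x, lam P k (pt v c x 0) = 0 := by
    intro x; rcases hk with hk | hk
    · rw [lam_isK h hv hk]; simp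
    · rw [lam_isK' h hv hk]; simp
  set m : ℝ := crs (ed P (k + 1)) v with hm
  set q : ℝ := lam P (k + 1) (pt v c 0 0)
  have h1 : ∀ x, lam P (k + 1) (pt v c x 0) = m * x + q := by
    intro x; simp only [q, hm, lam, pt, crs]; simp; ring
  have h2 : ∀ x, lam P (k + 2) (pt v c x 0) = |dt P| - (m * x + q) := by
    intro x; have := lam_sum P k (pt v c x 0); rw [h0, h1] at this; linarith
  have hmm : |m| * ‖ed P k‖ = |dt P| := by
    have e := crs_ed P k
    rw [ed_un h k] at e
    have e2 : ∀ (a : ℝ) (u w : ℂ), crs (a * u) w = -(a * crs w u) := by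
      intro a u w; simp [crs]; ring
    have e3 : ∀ u w : ℂ, crs u (-w) = - crs u w := by intro u w; simp [crs]; ring
    rw [e2] at e
    rw [← e, abs_neg, abs_mul, abs_norm, mul_comm, hm]
    rcases hk with hk | hk
    · rw [hk.1]
    · rw [hk.1, e3, abs_neg]
  have hm0 : m ≠ 0 := by intro h; rw [h] at hmm; simp at hmm; exact hD.ne hmm
  have es : seg P v c k = Set.indicator {x : ℝ | 0 < m * x + q ∧ m * x + q < |dt P|} (fun _ => (1 : ℝ)) := by
    funext x
    simp only [seg, h1, h2, Set.indicator, Set.mem_ofPred_eq, sub_pos]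
  have hlen : ‖ed P k‖ = |dt P| / |m| := by field_simp; linarith
  have hms : MeasurableSet {x : ℝ | 0 < m * x + q ∧ m * x + q < |dt P|} := by
    rw [seg_int_aux m q _ hm0]; split_ifs <;> exact measurableSet_Ioo
  have hvol : volume {x : ℝ | 0 < m * x + q ∧ m * x + q < |dt P|} = ENNReal.ofReal (‖ed P k‖) := by
    rw [seg_int_aux m q _ hm0, hlen]
    split_ifs with hp
    · rw [Real.volume_Ioo, abs_of_pos hp]; congr 1; ring
    · rw [Real.volume_Ioo, abs_of_neg (lt_of_le_of_ne (not_lt.mp hp) hm0)]; congr 1; field_simp; ring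
  rw [es]
  constructor
  · rw [integrable_indicator_iff hms]
    apply integrableOn_const
    · rw [hvol]; exact ENNReal.ofReal_ne_top
    · simp
  · rw [integral_indicator_const _ hms, Measure.real, hvol, ENNReal.toReal_ofReal hl.le]; simp

open MeasureTheory in
lemma line_lemma {N : ℕ} {P : Fin N → Fin 3 → ℂ} {Q : Fin 3 → ℂ} (H : Til P Q) {v : ℂ}
    (hv : ‖v‖ = 1) (c : ℝ) :
    ∑ i, ∑ k, kap (P i) v c k * ‖ed (P i) k‖ = ∑ k, kap Q v c k * ‖ed Q k‖ := by
  classical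
  have A : ∀ R : Fin 3 → ℂ, dt R ≠ 0 → ∀ k, Integrable (fun x => kap R v c k * seg R v c k x) ∧
      ∫ x, kap R v c k * seg R v c k x = kap R v c k * ‖ed R k‖ := by
    intro R hR k
    by_cases hk : isK R v c k ∨ isK R (-v) (-c) k
    · obtain ⟨i1, i2⟩ := seg_int hR hv c k hk
      exact ⟨i1.const_mul _, by rw [integral_const_mul, i2]⟩
    · push Not at hk
      have : kap R v c k = 0 := by simp [kap, hk]
      simp [this]
  have B : ∀ R : Fin 3 → ℂ, dt R ≠ 0 → ∫ x, ∑ k, kap R v c k * seg R v c k x = ∑ k, kap R v c k * ‖ed R k‖ := by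
    intro R hR
    rw [integral_finsetSum _ fun k _ => (A R hR k).1]
    exact Finset.sum_congr rfl fun k _ => (A R hR k).2
  rw [← B Q H.hQ, Finset.sum_congr rfl fun i _ => (B (P i) (H.hP i)).symm,
    ← integral_finsetSum _ fun i _ => integrable_finsetSum _ fun k _ => (A _ (H.hP i) k).1]
  have fin : (⋃ i, {x | ¬ nbad (P i) v c x}) ∪ {x | ¬ nbad Q v c x} |>.Finite :=
    (Set.finite_iUnion fun i => bad_fin (H.hP i) hv c).union (bad_fin H.hQ hv c)
  apply integral_congr_ae
  filter_upwards [compl_mem_ae_iff.mpr (fin.measure_zero volume)] with x hx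
  simp only [Set.mem_compl_iff, Set.mem_union, Set.mem_iUnion, Set.mem_ofPred_eq, not_or, not_exists, not_not] at hx
  rw [← tri_diff H.hQ hv, ← point_id H hv hx.1 hx.2 (Or.inl rfl), ← point_id H hv hx.1 hx.2 (Or.inr rfl),
    ← Finset.sum_sub_distrib]
  exact Finset.sum_congr rfl fun i _ => (tri_diff (H.hP i) hv c x).symm

end

section

lemma kap_g (P : Fin 3 → ℂ) (v : ℂ) (c : ℝ) (k : Fin 3) (g : ℝ →+ ℝ) (x : ℝ) :
    g (kap P v c k * x) = kap P v c k * g x := by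
  unfold kap; split_ifs <;> simp

lemma line_g {N : ℕ} {P : Fin N → Fin 3 → ℂ} {Q : Fin 3 → ℂ} (H : Til P Q) {v : ℂ}
    (hv : ‖v‖ = 1) (c : ℝ) (g : ℝ →+ ℝ) :
    ∑ i, ∑ k, kap (P i) v c k * g ‖ed (P i) k‖ = ∑ k, kap Q v c k * g ‖ed Q k‖ := by
  have := congrArg g (line_lemma H hv c)
  simpa only [map_sum, kap_g] using this

lemma edge_lemma {N : ℕ} {P : Fin N → Fin 3 → ℂ} {Q : Fin 3 → ℂ} (H : Til P Q)
    (g : ℝ →+ ℝ) (W : ℂ → ℝ → ℝ) (hW : ∀ v c, W (-v) (-c) = - W v c) :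
    ∑ i, ∑ k, g ‖ed (P i) k‖ * W (un (P i) k) (off (P i) k) =
      ∑ k, g ‖ed Q k‖ * W (un Q k) (off Q k) := by
  classical
  let S0 : Finset (ℂ × ℝ) := (Finset.univ.image fun e : Fin N × Fin 3 => (un (P e.1) e.2, off (P e.1) e.2)) ∪
    Finset.univ.image fun k => (un Q k, off Q k)
  let S : Finset (ℂ × ℝ) := S0 ∪ S0.image fun κ => -κ
  have hS0 : ∀ κ ∈ S0, ‖κ.1‖ = 1 := by
    intro κ hκ
    simp only [S0, Finset.mem_union, Finset.mem_image, Finset.mem_univ, true_and] at hκ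
    rcases hκ with ⟨e, rfl⟩ | ⟨k, rfl⟩
    · exact norm_un (H.hP _) _
    · exact norm_un H.hQ _
  have hS : ∀ κ ∈ S, ‖κ.1‖ = 1 := by
    intro κ hκ
    simp only [S, Finset.mem_union, Finset.mem_image] at hκ
    rcases hκ with h | ⟨x, h, rfl⟩
    · exact hS0 _ h
    · simpa using hS0 _ h
  have key : ∀ (R : Fin 3 → ℂ) (k : Fin 3), (un R k, off R k) ∈ S0 →
      ∑ κ ∈ S, W κ.1 κ.2 * kap R κ.1 κ.2 k = 2 * W (un R k) (off R k) := by
    intro R k hm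
    have h1 : ∀ κ : ℂ × ℝ, isK R κ.1 κ.2 k ↔ κ = (un R k, off R k) := fun κ => by
      simp only [isK, Prod.ext_iff]; constructor <;> rintro ⟨a, b⟩ <;> exact ⟨a.symm, b.symm⟩
    have h2 : ∀ κ : ℂ × ℝ, isK R (-κ.1) (-κ.2) k ↔ κ = -(un R k, off R k) := fun κ => by
      rw [← neg_eq_iff_eq_neg, ← h1]; rfl
    have m1 : (un R k, off R k) ∈ S := Finset.mem_union_left _ hm
    have m2 : -(un R k, off R k) ∈ S := Finset.mem_union_right _ (Finset.mem_image_of_mem _ hm)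
    simp only [kap, h1, h2, mul_sub, mul_ite, mul_one, mul_zero, Finset.sum_sub_distrib,
      Finset.sum_ite_eq', m1, m2, if_true]
    have := hW (un R k) (off R k)
    simp only [Prod.fst_neg, Prod.snd_neg, this]; ring
  have main : ∑ κ ∈ S, W κ.1 κ.2 * (∑ i, ∑ k, kap (P i) κ.1 κ.2 k * g ‖ed (P i) k‖) =
      ∑ κ ∈ S, W κ.1 κ.2 * (∑ k, kap Q κ.1 κ.2 k * g ‖ed Q k‖) :=
    Finset.sum_congr rfl fun κ hκ => by rw [line_g H (hS κ hκ)]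
  have sw : ∀ R : Fin 3 → ℂ, (∀ k, (un R k, off R k) ∈ S0) →
      ∑ κ ∈ S, W κ.1 κ.2 * (∑ k, kap R κ.1 κ.2 k * g ‖ed R k‖) =
        2 * ∑ k, g ‖ed R k‖ * W (un R k) (off R k) := by
    intro R hR
    simp only [Finset.mul_sum]
    rw [Finset.sum_comm]
    refine Finset.sum_congr rfl fun k _ => ?_
    rw [← mul_left_comm, ← key R k (hR k), Finset.mul_sum]
    exact Finset.sum_congr rfl fun κ _ => by ring
  have l : ∑ κ ∈ S, W κ.1 κ.2 * (∑ i, ∑ k, kap (P i) κ.1 κ.2 k * g ‖ed (P i) k‖) =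
      2 * ∑ i, ∑ k, g ‖ed (P i) k‖ * W (un (P i) k) (off (P i) k) := by
    rw [Finset.mul_sum]
    rw [← Finset.sum_congr rfl fun i _ => sw (P i) fun k => Finset.mem_union_left _
      (Finset.mem_image.mpr ⟨(i, k), Finset.mem_univ _, rfl⟩)]
    rw [Finset.sum_comm]
    exact Finset.sum_congr rfl fun κ _ => by rw [Finset.mul_sum]
  rw [l, sw Q fun k => Finset.mem_union_right _ (Finset.mem_image_of_mem _ (Finset.mem_univ _))] at main
  linarith

lemma area_lemma {N : ℕ} {P : Fin N → Fin 3 → ℂ} {Q : Fin 3 → ℂ} (H : Til P Q) :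
    ∑ i, |dt (P i)| = |dt Q| := by
  have h := edge_lemma H (AddMonoidHom.id ℝ) (fun _ c => c) (fun _ _ => rfl)
  have e : ∀ R : Fin 3 → ℂ, dt R ≠ 0 → ∑ k, ‖ed R k‖ * off R k = - |dt R| := by
    intro R hR
    rw [← lam_sum R 0 0, Fin.sum_univ_three]
    have : ∀ k, ‖ed R k‖ * off R k = - lam R k 0 := by
      intro k
      rw [lam, ed_un hR k]
      have : ‖(‖ed R k‖ : ℂ) * un R k‖ = ‖ed R k‖ := by rw [← ed_un hR k]
      simp [off, crs, norm_un hR]; ring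
    simp only [this]; simp; ring
  simp only [AddMonoidHom.id_apply] at h
  rw [e Q H.hQ, Finset.sum_congr rfl fun i _ => e _ (H.hP i), Finset.sum_neg_distrib] at h
  linarith

lemma side_lemma {N : ℕ} {P : Fin N → Fin 3 → ℂ} {Q : Fin 3 → ℂ} (H : Til P Q) (k : Fin 3) :
    ∃ n : Fin N → Fin 3 → ℕ, ∀ g : ℝ →+ ℝ, g ‖ed Q k‖ = ∑ i, ∑ j, (n i j : ℝ) * g ‖ed (P i) j‖ := by
  classical
  set v := un Q k with hv
  set c := off Q k with hc
  have nv : ‖v‖ = 1 := norm_un H.hQ k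
  refine ⟨fun i j => if isK (P i) v c j then 1 else 0, fun g => ?_⟩
  have hv0 : v ≠ 0 := by intro h; rw [h] at nv; simp at nv
  have hvv : v ≠ -v := fun hh => hv0 (self_eq_neg.mp hh)
  have r : ∑ j, kap Q v c j * g ‖ed Q j‖ = g ‖ed Q k‖ := by
    rw [Finset.sum_eq_single k]
    · have h1 : isK Q v c k := ⟨rfl, rfl⟩
      have h2 : ¬ isK Q (-v) (-c) k := fun h => hvv h.1
      simp [kap, h1, h2]
    · intro j _ hj
      have h1 : ¬ isK Q v c j := fun h => hj (par_uniq H.hQ (v := v) (Or.inl h.1) (Or.inl rfl))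
      have h2 : ¬ isK Q (-v) (-c) j := fun h => hj (par_uniq H.hQ (v := v) (Or.inr h.1) (Or.inl rfl))
      simp [kap, h1, h2]
    · simp
  rw [← r, ← line_g H nv c g]
  refine Finset.sum_congr rfl fun i _ => Finset.sum_congr rfl fun j _ => ?_
  have h2 : ¬ isK (P i) (-v) (-c) j := by
    intro h
    have a1 := lam_vert (P i) j j
    rw [if_pos rfl] at a1
    have hD : 0 < |dt (P i)| := abs_pos.mpr (H.hP i)
    rw [← a1] at hD
    have a2 := (H.cov (P i j)).2 ⟨i, fun k => by rw [lam_vert]; split_ifs <;> positivity⟩ k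
    have a3 : ∀ (R : Fin 3 → ℂ) (m : Fin 3) (z : ℂ), dt R ≠ 0 →
        lam R m z = ‖ed R m‖ * (crs (un R m) z - off R m) := by
      intro R m z hR
      rw [lam, ed_un hR m]
      have : ‖(‖ed R m‖ : ℂ) * un R m‖ = ‖ed R m‖ := by rw [← ed_un hR m]
      rw [this]
      simp [off, crs, norm_un hR]; ring
    rw [a3 _ _ _ (H.hP i), h.1, h.2, crs_neg] at hD
    rw [a3 _ _ _ H.hQ] at a2
    have b1 := pos_of_mul_pos_right hD (norm_nonneg _)
    have b2 := nonneg_of_mul_nonneg_right a2 (norm_ed_pos H.hQ k)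
    simp only [← hv, ← hc] at b2
    linarith
  simp [kap, h2]
end

section

def ang (P : Fin 3 → ℂ) (k : Fin 3) : ℝ := ∠ (P (k + 1)) (P k) (P (k + 2))

abbrev ex (x : ℝ) : ℂ := Complex.exp (x * Complex.I)

lemma ex_add (x y : ℝ) : ex (x + y) = ex x * ex y := by
  simp [ex, add_mul, Complex.exp_add]

lemma ex_pi : ex π = -1 := Complex.exp_pi_mul_I
lemma ex_mul_neg (x : ℝ) : ex x * ex (-x) = 1 := by rw [← ex_add]; simp [ex]
lemma ex_ne (x : ℝ) : ex x ≠ 0 := Complex.exp_ne_zero _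
lemma ex_im (x : ℝ) : (ex x).im = sin x := Complex.exp_ofReal_mul_I_im x
lemma ex_re (x : ℝ) : (ex x).re = cos x := Complex.exp_ofReal_mul_I_re x

lemma ex_one {x : ℝ} (h : ex x = 1) (h1 : -(2 * π) < x) (h2 : x < 2 * π) : x = 0 := by
  have : cos x = 1 := by rw [← ex_re, h]; simp
  exact (Real.cos_eq_one_iff_of_lt_of_lt h1 h2).1 this

lemma rot_aux {x y : ℂ} (hx : x ≠ 0) (hy : y ≠ 0) {σ : ℝ} (hσ : σ = 1 ∨ σ = -1) (h : 0 < σ * crs x y) :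
    y / ‖y‖ = x / ‖x‖ * ex (σ * InnerProductGeometry.angle x y) := by
  have hxn : (‖x‖ : ℂ) ≠ 0 := by simpa using hx
  have hyn : (‖y‖ : ℂ) ≠ 0 := by simpa using hy
  have him : (y / x).im = crs x y / Complex.normSq x := by
    simp [Complex.div_im, crs]; ring
  have hns : 0 < Complex.normSq x := Complex.normSq_pos.mpr hx
  have harg : (y / x).arg = σ * InnerProductGeometry.angle x y := by
    rw [InnerProductGeometry.angle_comm, Complex.angle_eq_abs_arg hy hx]
    rcases hσ with rfl | rfl
    · have : 0 ≤ (y / x).arg := by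
        rw [Complex.arg_nonneg_iff, him]; apply div_nonneg _ hns.le; linarith
      rw [abs_of_nonneg this, one_mul]
    · have : (y / x).arg < 0 := by
        rw [Complex.arg_neg_iff, him]; apply div_neg_of_neg_of_pos _ hns; linarith
      rw [abs_of_neg this]; ring
  have := Complex.norm_mul_exp_arg_mul_I (y / x)
  rw [harg] at this
  have e : y = x * (‖y‖ / ‖x‖ * ex (σ * InnerProductGeometry.angle x y)) := by
    rw [ex]
    rw [norm_div] at this
    push_cast at this ⊢
    rw [this]; field_simp
  have e' : y * ‖x‖ = ‖y‖ * x * ex (σ * InnerProductGeometry.angle x y) := by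
    generalize ex (σ * InnerProductGeometry.angle x y) = w at e ⊢
    generalize (‖y‖ : ℂ) = b at *
    generalize (‖x‖ : ℂ) = a at *
    rw [e]; field_simp
  rw [div_mul_eq_mul_div, div_eq_div_iff hyn hxn, e']; ring

lemma sg_or (P : Fin 3 → ℂ) : sg P = 1 ∨ sg P = -1 := by unfold sg; split_ifs <;> simp

lemma un_succ {P : Fin 3 → ℂ} (h : dt P ≠ 0) (k : Fin 3) :
    un P k = - (un P (k + 1) * ex (sg P * ang P (k + 2))) := by
  have e1 : ed P k = - (sg P * (P (k + 1) - P (k + 2))) := by simp [ed]; ring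
  have e2 : ed P (k + 1) = sg P * (P k - P (k + 2)) := by
    have a : k + 1 + 2 = k := by omega
    have b : k + 1 + 1 = k + 2 := by omega
    rw [ed, a, b]
  have hs : (sg P : ℂ) ≠ 0 := by rcases sg_or P with h | h <;> simp [h]
  have hns : (‖(sg P : ℂ)‖ : ℂ) = 1 := by rcases sg_or P with h | h <;> simp [h]
  have n1 : P (k + 1) - P (k + 2) ≠ 0 := by
    intro h0; apply ed_ne h k; rw [e1, h0]; simp
  have n2 : P k - P (k + 2) ≠ 0 := by
    intro h0; apply ed_ne h (k + 1); rw [e2, h0]; simp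
  have hc : crs (P k - P (k + 2)) (P (k + 1) - P (k + 2)) = dt P := by
    simp only [dt, crs]; fin_cases k <;> simp <;> ring
  have hp : 0 < sg P * crs (P k - P (k + 2)) (P (k + 1) - P (k + 2)) := by
    rw [hc, sg_mul_dt]; positivity
  have := rot_aux n2 n1 (sg_or P) hp
  have ha : ang P (k + 2) = InnerProductGeometry.angle (P k - P (k + 2)) (P (k + 1) - P (k + 2)) := by
    unfold ang EuclideanGeometry.angle
    congr 2 <;> congr 1 <;> omega
  rw [un, un, e1, e2, ha, norm_neg, norm_mul, norm_mul, Complex.ofReal_mul, Complex.ofReal_mul, hns,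
    one_mul, one_mul, neg_div, mul_div_assoc, mul_div_assoc, this]
  ring

lemma ang_sum {P : Fin 3 → ℂ} (h : dt P ≠ 0) (k : Fin 3) :
    ang P k + ang P (k + 1) + ang P (k + 2) = π := by
  have ne : P 0 ≠ P 1 := by intro h0; apply h; simp [dt, crs, h0]
  have ne2 : P 0 ≠ P 2 := by intro h0; apply h; simp [dt, crs, h0]
  have := angle_add_angle_add_angle_eq_pi (p₁ := P 0) (p₂ := P 1) (P 2) ne.symm
  have e : ang P 0 + ang P 1 + ang P 2 = π := by
    rw [← this]
    have a : ang P 0 = ∠ (P 1) (P 0) (P 2) := rfl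
    have b : ang P 1 = ∠ (P 2) (P 1) (P 0) := rfl
    have c : ang P 2 = ∠ (P 0) (P 2) (P 1) := rfl
    rw [a, b, c, EuclideanGeometry.angle_comm (P 2) (P 1) (P 0), EuclideanGeometry.angle_comm (P 0) (P 2) (P 1),
      EuclideanGeometry.angle_comm (P 1) (P 0) (P 2)]
    first | ring | skip
  fin_cases k <;> simp <;> linarith

lemma dt_sin {P : Fin 3 → ℂ} (h : dt P ≠ 0) (k : Fin 3) :
    |dt P| = ‖ed P (k + 1)‖ * ‖ed P (k + 2)‖ * sin (ang P k) := by
  have e1 := crs_ed P (k + 1)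
  have e2 : k + 1 + 1 = k + 2 := by omega
  have e3 : k + 1 + 2 = k := by omega
  have e := un_succ h (k + 1)
  rw [e2, e3] at e
  rw [e2, ed_un h (k + 1), ed_un h (k + 2), e] at e1
  have n := Complex.sq_norm (un P (k + 2))
  rw [norm_un h, Complex.normSq_apply] at n
  have hs : sin (sg P * ang P k) = sg P * sin (ang P k) := by
    rcases sg_or P with h | h <;> simp [h]
  have e4 : ∀ (a b : ℝ) (u w : ℂ), crs (a * (-(u * w))) (b * u) =
      a * b * (u.re * u.re + u.im * u.im) * w.im := by
    intro a b u w; simp [crs]; ring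
  rw [e4, ← n, ex_im, hs] at e1
  rw [← sg_mul_dt, ← e1]
  linear_combination (‖ed P (k + 1)‖ * ‖ed P (k + 2)‖ * sin (ang P k)) * sg_sq P

lemma ang_nonneg (P : Fin 3 → ℂ) (k : Fin 3) : 0 ≤ ang P k := EuclideanGeometry.angle_nonneg _ _ _

lemma ang_sin_pos {P : Fin 3 → ℂ} (h : dt P ≠ 0) (k : Fin 3) : 0 < sin (ang P k) := by
  have h1 := dt_sin h k
  have h2 : 0 < |dt P| := abs_pos.mpr h
  rw [h1] at h2
  exact pos_of_mul_pos_right h2 (by positivity)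

lemma ang_pos {P : Fin 3 → ℂ} (h : dt P ≠ 0) (k : Fin 3) : 0 < ang P k := by
  have := ang_sin_pos h k
  refine lt_of_le_of_ne (ang_nonneg P k) fun h0 => ?_
  rw [← h0] at this; simp at this

lemma ang_lt {P : Fin 3 → ℂ} (h : dt P ≠ 0) (k : Fin 3) : ang P k < π := by
  have := ang_sum h k
  linarith [ang_pos h (k + 1), ang_pos h (k + 2)]

lemma tele {P : Fin 3 → ℂ} (h : dt P ≠ 0) (H : ℂ → ℝ) :
    ∑ k, (H (un P k * ex (ang P k)) - H (un P k * ex (-ang P k))) = 0 := by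
  have key : ∀ k, un P (k + 1) * ex (-(sg P * ang P (k + 1))) = un P k * ex (sg P * ang P k) := by
    intro k
    rw [un_succ h k]
    have hs := ang_sum h k
    have hpi : ex (sg P * π) = -1 := by
      rcases sg_or P with h | h <;> rw [h]
      · rw [one_mul, ex_pi]
      · have := ex_mul_neg π
        rw [ex_pi] at this; rw [neg_one_mul]; linear_combination -this
    have : ex (sg P * ang P (k + 2)) * ex (sg P * ang P k) = - ex (-(sg P * ang P (k + 1))) := by
      rw [← ex_add]
      have : sg P * ang P (k + 2) + sg P * ang P k = sg P * π + -(sg P * ang P (k + 1)) := by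
        rw [← hs]; ring
      rw [this, ex_add, hpi]; ring
    linear_combination un P (k + 1) * this
  have k0 := key 0
  have k1 := key 1
  have k2 := key 2
  rw [Fin.sum_univ_three]
  simp only [zero_add, show (1 : Fin 3) + 1 = 2 from rfl, show (2 : Fin 3) + 1 = 0 from rfl] at k0 k1 k2
  rcases sg_or P with hs | hs <;> simp only [hs, one_mul, neg_one_mul, neg_neg] at k0 k1 k2
  · rw [k0, k1, k2]; ring
  · rw [k0, k1, k2]; ring

/-- standing data -/
structure Dat {N : ℕ} (P : Fin N → Fin 3 → ℂ) (Q : Fin 3 → ℂ) (l th : Fin 3 → ℝ)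
    (g : Fin 3 → ℝ →+ ℝ) : Prop where
  til : Til P Q
  len : ∀ i k, ‖ed (P i) k‖ = l k
  an : ∀ i k, ang (P i) k = th k
  thp : ∀ k, 0 < th k
  thl : ∀ k, th k < π
  g01 : ∀ t k, g t (l k) = 0 ∨ g t (l k) = 1
  gf : ∀ k (f : ℝ → ℝ), ∑ t, g t (l k) * f (th t) = f (th k)

variable {N : ℕ} {P : Fin N → Fin 3 → ℂ} {Q : Fin 3 → ℂ} {l th : Fin 3 → ℝ} {g : Fin 3 → ℝ →+ ℝ}

lemma ident (D : Dat P Q l th g) (H : ℂ → ℝ) (hH : ∀ z, H (-z) = - H z) :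
    ∑ k, ∑ t, g t ‖ed Q k‖ * (H (un Q k * ex (th t)) + H (un Q k * ex (π - th t))) = 0 := by
  have hh : ∀ (u : ℂ) (x : ℝ), H (u * ex (π - x)) = - H (u * ex (-x)) := by
    intro u x
    rw [sub_eq_add_neg, ex_add, ex_pi, ← hH]; congr 1; ring
  simp only [hh, ← sub_eq_add_neg]
  rw [Finset.sum_comm]
  have e := fun t => edge_lemma D.til (g t) (fun v _ => H (v * ex (th t)) - H (v * ex (-th t)))
    (fun v _ => by simp only [neg_mul, hH]; ring)
  rw [← Finset.sum_congr rfl fun t _ => e t, Finset.sum_comm]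
  refine Finset.sum_eq_zero fun i _ => ?_
  rw [Finset.sum_comm]
  simp only [D.len]
  rw [← tele (D.til.hP i) H]
  refine Finset.sum_congr rfl fun k _ => ?_
  rw [D.an, D.gf k fun x => H (un (P i) k * ex x) - H (un (P i) k * ex (-x))]

lemma nu_nat (D : Dat P Q l th g) (k : Fin 3) : ∃ n : Fin 3 → ℕ, (∀ t, g t ‖ed Q k‖ = n t) ∧
    ∀ f : ℝ → ℝ, (∀ j, l j = f (th j)) → ‖ed Q k‖ = ∑ t, (n t : ℝ) * l t := by
  obtain ⟨n, hn⟩ := side_lemma D.til k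
  have : ∀ t j, ∃ m : ℕ, g t (l j) = m := fun t j => by
    rcases D.g01 t j with h | h
    · exact ⟨0, by simp [h]⟩
    · exact ⟨1, by simp [h]⟩
  choose m hm using this
  have h1 : ∀ t, g t ‖ed Q k‖ = ((∑ i, ∑ j, n i j * m t j : ℕ) : ℝ) := by
    intro t; rw [hn (g t)]; push_cast
    simp only [D.len, hm]
  refine ⟨fun t => ∑ i, ∑ j, n i j * m t j, h1, fun f hf => ?_⟩
  have h2 := hn (AddMonoidHom.id ℝ)
  simp only [AddMonoidHom.id_apply, D.len] at h2
  rw [h2]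
  have h3 : ∀ j, l j = ∑ t, (m t j : ℝ) * l t := by
    intro j
    have h := D.gf j f
    rw [← hf] at h
    rw [← h]
    exact Finset.sum_congr rfl fun t _ => by rw [hm, hf]
  push_cast
  simp only [Finset.sum_mul]
  symm
  rw [Finset.sum_comm]
  refine Finset.sum_congr rfl fun i _ => ?_
  rw [Finset.sum_comm]
  symm
  refine Finset.sum_congr rfl fun j _ => ?_
  conv_lhs => rw [h3 j, Finset.mul_sum]
  exact Finset.sum_congr rfl fun t _ => by ring

def Mem (Q : Fin 3 → ℂ) (th : Fin 3 → ℝ) (g : Fin 3 → ℝ →+ ℝ) (k : Fin 3) (x : ℝ) : Prop :=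
  ∃ t, 0 < g t ‖ed Q k‖ ∧ (x = th t ∨ x = π - th t)

lemma Mem.symm {k : Fin 3} {x : ℝ} (h : Mem Q th g k x) : Mem Q th g k (π - x) := by
  obtain ⟨t, ht, h | h⟩ := h
  · exact ⟨t, ht, Or.inr (by rw [h])⟩
  · exact ⟨t, ht, Or.inl (by rw [h]; ring)⟩

lemma Mem.pos (D : Dat P Q l th g) {k : Fin 3} {x : ℝ} (h : Mem Q th g k x) : 0 < x ∧ x < π := by
  obtain ⟨t, ht, h | h⟩ := h <;> subst h <;> constructor <;> linarith [D.thp t, D.thl t]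

lemma rule_aux (D : Dat P Q l th g) {k : Fin 3} {x : ℝ} (hx : Mem Q th g k x) :
    Mem Q th g (k + 1) (x + sg Q * ang Q (k + 2)) ∨ Mem Q th g (k + 2) (x - sg Q * ang Q (k + 1)) := by
  classical
  have hd := D.til.hQ
  set w := un Q k * ex x with hw
  have hu : ∀ j, un Q j ≠ 0 := fun j h0 => by have := norm_un hd j; rw [h0] at this; simp at this
  have hw0 : w ≠ 0 := mul_ne_zero (hu k) (ex_ne x)
  have hww : w ≠ -w := fun hh => hw0 (self_eq_neg.mp hh)
  let H : ℂ → ℝ := fun z => if z = w then 1 else if z = -w then -1 else 0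
  have hH : ∀ z, H (-z) = - H z := by
    intro z
    simp only [H, neg_eq_iff_eq_neg, neg_inj, neg_neg]
    by_cases h1 : z = w
    · subst h1; simp [hww]
    · by_cases h2 : z = -w
      · subst h2; simp [hww.symm]
      · simp [h1, h2]
  have Hneg : ∀ z, H z < 0 → z = -w := by
    intro z hz; simp only [H] at hz; split_ifs at hz with h1 h2
    · linarith
    · exact h2
    · linarith
  have nn : ∀ j t, 0 ≤ g t ‖ed Q j‖ := fun j t => by
    obtain ⟨n, hn, _⟩ := nu_nat D j; rw [hn]; positivity
  have negF : ∀ j, (∃ t, g t ‖ed Q j‖ * (H (un Q j * ex (th t)) + H (un Q j * ex (π - th t))) < 0) →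
      ∃ y, Mem Q th g j y ∧ un Q j * ex y = -w := by
    rintro j ⟨t, ht⟩
    have h1 : 0 < g t ‖ed Q j‖ := lt_of_le_of_ne (nn j t) fun h0 => by rw [← h0] at ht; simp at ht
    have h2 : H (un Q j * ex (th t)) + H (un Q j * ex (π - th t)) < 0 := by
      by_contra h3; push Not at h3; nlinarith
    by_cases h3 : H (un Q j * ex (th t)) < 0
    · exact ⟨th t, ⟨t, h1, Or.inl rfl⟩, Hneg _ h3⟩
    · exact ⟨π - th t, ⟨t, h1, Or.inr rfl⟩, Hneg _ (by linarith)⟩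
  have hxp := hx.pos D
  have hk : ¬ ∃ y, Mem Q th g k y ∧ un Q k * ex y = -w := by
    rintro ⟨y, hy, h⟩
    have hyp := hy.pos D
    have h1 : ex y = - ex x := mul_left_cancel₀ (hu k) (by rw [h, hw]; ring)
    have h2 := congrArg Complex.im h1
    rw [Complex.neg_im, ex_im, ex_im] at h2
    linarith [sin_pos_of_pos_of_lt_pi hxp.1 hxp.2, sin_pos_of_pos_of_lt_pi hyp.1 hyp.2]
  have Fk : 0 < ∑ t, g t ‖ed Q k‖ * (H (un Q k * ex (th t)) + H (un Q k * ex (π - th t))) := by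
    apply Finset.sum_pos'
    · intro t _; by_contra h0; exact hk (negF k ⟨t, not_le.mp h0⟩)
    · obtain ⟨t, ht, h⟩ := id hx
      refine ⟨t, Finset.mem_univ _, mul_pos ht ?_⟩
      have a1 : 0 ≤ H (un Q k * ex (th t)) := by
        by_contra h0; exact hk ⟨_, ⟨t, ht, Or.inl rfl⟩, Hneg _ (not_le.mp h0)⟩
      have a2 : 0 ≤ H (un Q k * ex (π - th t)) := by
        by_contra h0; exact hk ⟨_, ⟨t, ht, Or.inr rfl⟩, Hneg _ (not_le.mp h0)⟩
      have a3 : H (un Q k * ex x) = 1 := by simp [H, hw]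
      rcases h with h | h <;> rw [h] at a3 <;> linarith
  have tot := ident D H hH
  have all3 : ∀ f : Fin 3 → ℝ, ∑ j, f j = f k + f (k + 1) + f (k + 2) := by
    intro f; rw [Fin.sum_univ_three]; fin_cases k <;> simp <;> ring
  rw [all3] at tot
  have ex_neg : ∀ j, (∑ t, g t ‖ed Q j‖ * (H (un Q j * ex (th t)) + H (un Q j * ex (π - th t)))) < 0 →
      ∃ y, Mem Q th g j y ∧ un Q j * ex y = -w := by
    intro j hj
    apply negF; by_contra h0; push Not at h0
    exact absurd (Finset.sum_nonneg fun t _ => h0 t) (not_le.mpr hj)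
  have hs : ∀ j, -π < sg Q * ang Q j ∧ sg Q * ang Q j < π := by
    intro j; have h1 := ang_pos hd j; have h2 := ang_lt hd j
    rcases sg_or Q with h | h <;> rw [h] <;> constructor <;> linarith
  by_cases h1 : (∑ t, g t ‖ed Q (k+1)‖ * (H (un Q (k+1) * ex (th t)) + H (un Q (k+1) * ex (π - th t)))) < 0
  · left
    obtain ⟨y, hy, h⟩ := ex_neg _ h1
    have hyp := hy.pos D
    rw [hw, un_succ hd k] at h
    have h2 : ex y = ex (sg Q * ang Q (k + 2)) * ex x :=
      mul_left_cancel₀ (hu (k + 1)) (by rw [h]; ring)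
    have h3 : ex (y + -(x + sg Q * ang Q (k + 2))) = 1 := by
      rw [ex_add, h2, ← ex_add, add_comm (sg Q * _) x]; exact ex_mul_neg _
    have := ex_one h3 (by linarith [hs (k + 2)]) (by linarith [hs (k + 2)])
    have e : y = x + sg Q * ang Q (k + 2) := by linarith
    rwa [← e]
  · right
    obtain ⟨y, hy, h⟩ := ex_neg (k + 2) (by linarith)
    have hyp := hy.pos D
    have e := un_succ hd (k + 2)
    have e2 : k + 2 + 1 = k := by omega
    have e3 : k + 2 + 2 = k + 1 := by omega
    rw [e2, e3] at e
    rw [hw, e] at h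
    have h2 : ex (sg Q * ang Q (k + 1)) * ex y = ex x :=
      mul_left_cancel₀ (hu k) (by linear_combination -h)
    have h3 : ex ((sg Q * ang Q (k + 1) + y) + -x) = 1 := by
      rw [ex_add, ex_add, h2]; exact ex_mul_neg _
    have := ex_one h3 (by linarith [hs (k + 1)]) (by linarith [hs (k + 1)])
    have e : y = x - sg Q * ang Q (k + 1) := by linarith
    rwa [← e]

lemma rule (D : Dat P Q l th g) {k : Fin 3} {x : ℝ} (hx : Mem Q th g k x) :
    Mem Q th g (k + 1) (x + ang Q (k + 2)) ∨ Mem Q th g (k + 2) (x - ang Q (k + 1)) := by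
  rcases sg_or Q with h | h
  · have := rule_aux D hx
    rwa [h, one_mul, one_mul] at this
  · have := rule_aux D hx.symm
    rw [h] at this
    refine this.imp (fun a => ?_) (fun a => ?_) <;> convert a.symm using 1 <;> ring

end

section

def force {α : Type} (n : ℕ) (f : ℕ → α) : α := Nat.rec (f 0) (fun m _ => f (m + 1)) n

lemma force_eq {α : Type} (n : ℕ) (f : ℕ → α) : force n f = f n := by
  cases n <;> rfl

def keepB (n x S r : ℕ) : ℕ :=
  cond (Nat.testBit S x && Nat.testBit S (n - x)) (r ||| ((1 <<< x) ||| (1 <<< (n - x)))) r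

def normB (n a b c S : ℕ) : ℕ := keepB n a S (keepB n b S (keepB n c S 0))

def fullB (n a b c : ℕ) : ℕ := (1 <<< a) ||| (1 <<< (n - a)) ||| ((1 <<< b) ||| (1 <<< (n - b))) |||
  ((1 <<< c) ||| (1 <<< (n - c)))

def runB (n a b c A0 A1 A2 : ℕ) (fin : ℕ → ℕ → ℕ → Bool) : ℕ → ℕ → ℕ → ℕ → Bool := fun f =>
  Nat.rec fin (fun _ ih S0 S1 S2 =>
    force (normB n a b c (S0 &&& ((S1 >>> A2) ||| (S2 <<< A1)))) fun T0 =>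
    cond (Nat.beq T0 0) true (
    force (normB n a b c (S1 &&& ((S2 >>> A0) ||| (T0 <<< A2)))) fun T1 =>
    cond (Nat.beq T1 0) true (
    force (normB n a b c (S2 &&& ((T0 >>> A1) ||| (T1 <<< A0)))) fun T2 =>
    cond (Nat.beq T2 0) true (ih T0 T1 T2)))) f

def lstD (a b : ℕ) : List ℕ := a :: (2 * a) :: (3 * a) :: b :: (a + b) :: (2 * a + b) :: (a + 2 * b) ::
  cond (Nat.blt a b) [b - a] (cond (Nat.blt b a) [a - b] [])

def memB (x : ℕ) (l : List ℕ) : Bool := l.any (Nat.beq x)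

/-- pair equality -/
def eqB (a b x y : ℕ) : Bool := Nat.beq a x && Nat.beq b y

def lackB (S x : ℕ) : Bool := !(Nat.testBit S x)

/-- kinds of surviving isosceles configurations; index 0 is the apex -/
def kindB (a b A0 A1 A2 S0 S1 : ℕ) : Bool :=
  Nat.beq A1 A2 && (
  (eqB A0 A1 (a + 2 * b) a && lackB S0 a && lackB S1 a && lackB S1 b) ||
  (eqB A0 A1 a (a + b) && lackB S1 a && lackB S1 b) ||
  (eqB a b 1 1 && eqB A0 A1 1 2) ||
  (eqB a b 2 1 && ((eqB A0 A1 6 1 && lackB S1 5) || (eqB A0 A1 4 2 && lackB S1 2))) ||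
  (eqB a b 1 2 && (eqB A0 A1 5 1 || eqB A0 A1 1 3 || eqB A0 A1 3 2)) ||
  (eqB a b 1 3 && ((eqB A0 A1 5 2 && lackB S1 5) || eqB A0 A1 3 3)) ||
  (eqB a b 2 3 && eqB A0 A1 4 4 && lackB S1 2) ||
  (eqB a b 1 4 && ((eqB A0 A1 5 3 && lackB S1 1 && lackB S1 6) ||
    (eqB A0 A1 3 4 && lackB S0 1 && lackB S0 4 && lackB S1 6))) ||
  (eqB a b 1 6 && eqB A0 A1 5 5 && lackB S1 8))

def simB (a b A0 A1 : ℕ) : Bool :=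
  eqB A0 A1 a b || eqB A0 A1 b a || eqB A0 A1 a (2 * a + b) || eqB A0 A1 (2 * a + b) a ||
  eqB A0 A1 b (2 * a + b) || eqB A0 A1 (2 * a + b) b

def finB (a b A0 A1 A2 S0 S1 S2 : ℕ) : Bool :=
  simB a b A0 A1 || kindB a b A0 A1 A2 S0 S1 || kindB a b A1 A2 A0 S1 S2 ||
    kindB a b A2 A0 A1 S2 S0

def chk1 (a b : ℕ) : Bool := (lstD a b).all fun A0 => (lstD a b).all fun A1 =>
  force (3 * a + 2 * b - A0 - A1) fun A2 => cond (memB A2 (lstD a b))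
   (runB (3 * a + 2 * b) a b (2 * a + b) A0 A1 A2 (finB a b A0 A1 A2) 5 (fullB (3 * a + 2 * b) a b (2 * a + b))
     (fullB (3 * a + 2 * b) a b (2 * a + b)) (fullB (3 * a + 2 * b) a b (2 * a + b))) true

def chk2 (a b : ℕ) : Bool := (lstD a b).all fun A1 => (lstD a b).all fun A2 =>
   runB (3 * a + 2 * b) a b (2 * a + b) 200 A1 A2
    (fun _ _ _ => memB (3 * a + 2 * b - A1 - A2) (lstD a b)) 5
    (fullB (3 * a + 2 * b) a b (2 * a + b))
     (fullB (3 * a + 2 * b) a b (2 * a + b)) (fullB (3 * a + 2 * b) a b (2 * a + b))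

def prs : List (ℕ × ℕ) := (1,40) :: (40,1) ::
  [(1,1),(1,2),(1,3),(1,4),(1,5),(1,6),(2,1),(2,3),(2,5),(3,1),(3,2),(3,4),(3,5),(4,1),(4,3),(4,5),
   (5,1),(5,2),(5,3),(5,4),(5,6),(6,1),(6,5)]

lemma chk1_ok : (prs.all fun x => chk1 x.1 x.2) = true := by decide +kernel
lemma chk2_ok : (prs.all fun x => chk2 x.1 x.2) = true := by decide +kernel
end

section

lemma keepB_mono {n x S r y : ℕ} (h : Nat.testBit r y = true) : Nat.testBit (keepB n x S r) y = true := by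
  unfold keepB; cases (Nat.testBit S x && Nat.testBit S (n - x)) <;> simp [h]

lemma keepB_hit {n x S r y : ℕ} (h1 : Nat.testBit S x = true) (h2 : Nat.testBit S (n - x) = true)
    (hy : y = x ∨ y = n - x) : Nat.testBit (keepB n x S r) y = true := by
  unfold keepB; rw [h1, h2]
  rcases hy with rfl | rfl <;> simp [Nat.testBit_shiftLeft]

lemma normB_hit {n a b c S y : ℕ} {M : ℕ → Prop} (hs : ∀ x, M x → M (n - x))
    (hS : ∀ x, M x → Nat.testBit S x = true) (hy : M y)
    (ht : ∃ x, (x = a ∨ x = b ∨ x = c) ∧ M x ∧ (y = x ∨ y = n - x)) :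
    Nat.testBit (normB n a b c S) y = true := by
  obtain ⟨x, hx, hm, hyx⟩ := ht
  unfold normB
  rcases hx with rfl | rfl | rfl
  · exact keepB_hit (hS _ hm) (hS _ (hs _ hm)) hyx
  · exact keepB_mono (keepB_hit (hS _ hm) (hS _ (hs _ hm)) hyx)
  · exact keepB_mono (keepB_mono (keepB_hit (hS _ hm) (hS _ (hs _ hm)) hyx))

lemma cond_z {T : ℕ} {r : Bool} (hT : T ≠ 0) : cond (Nat.beq T 0) true r = r := by
  have : Nat.beq T 0 = false := by
    rw [Bool.eq_false_iff]; intro h; exact hT (Nat.eq_of_beq_eq_true h)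
  rw [this]; rfl

lemma ne_z {T x : ℕ} (h : Nat.testBit T x = true) : T ≠ 0 := by rintro rfl; simp at h

lemma link_hit {S1 S2 S A1 A2 x : ℕ} {M1 M2 : ℕ → Prop} (h1 : ∀ x, M1 x → Nat.testBit S1 x = true)
    (h2 : ∀ x, M2 x → Nat.testBit S2 x = true) (hS : Nat.testBit S x = true)
    (h : M1 (x + A2) ∨ ∃ y, M2 y ∧ x = y + A1) :
    Nat.testBit (S &&& ((S1 >>> A2) ||| (S2 <<< A1))) x = true := by
  rw [Nat.testBit_and, Nat.testBit_or, hS, Nat.testBit_shiftRight, Nat.testBit_shiftLeft]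
  rcases h with h | ⟨y, hy, rfl⟩
  · rw [add_comm A2, h1 _ h]; simp
  · simp [h2 _ hy]

lemma runB_sound {n a b c A0 A1 A2 : ℕ} {fin : ℕ → ℕ → ℕ → Bool} {M : Fin 3 → ℕ → Prop}
    (hs : ∀ k x, M k x → M k (n - x))
    (ht : ∀ k y, M k y → ∃ x, (x = a ∨ x = b ∨ x = c) ∧ M k x ∧ (y = x ∨ y = n - x))
    (hn : ∀ k, ∃ x, M k x)
    (h0 : ∀ x, M 0 x → M 1 (x + A2) ∨ ∃ y, M 2 y ∧ x = y + A1)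
    (h1 : ∀ x, M 1 x → M 2 (x + A0) ∨ ∃ y, M 0 y ∧ x = y + A2)
    (h2 : ∀ x, M 2 x → M 0 (x + A1) ∨ ∃ y, M 1 y ∧ x = y + A0) (f : ℕ) :
    ∀ S0 S1 S2, (∀ x, M 0 x → Nat.testBit S0 x = true) → (∀ x, M 1 x → Nat.testBit S1 x = true) →
      (∀ x, M 2 x → Nat.testBit S2 x = true) → runB n a b c A0 A1 A2 fin f S0 S1 S2 = true →
    ∃ S0 S1 S2, (∀ x, M 0 x → Nat.testBit S0 x = true) ∧ (∀ x, M 1 x → Nat.testBit S1 x = true) ∧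
      (∀ x, M 2 x → Nat.testBit S2 x = true) ∧ fin S0 S1 S2 = true := by
  induction f with
  | zero => intro S0 S1 S2 a1 a2 a3 h; exact ⟨S0, S1, S2, a1, a2, a3, h⟩
  | succ f ih =>
    intro S0 S1 S2 a0 a1 a2 h
    have e : runB n a b c A0 A1 A2 fin (f + 1) S0 S1 S2 = 
      force (normB n a b c (S0 &&& ((S1 >>> A2) ||| (S2 <<< A1)))) fun T0 =>
    cond (Nat.beq T0 0) true (
    force (normB n a b c (S1 &&& ((S2 >>> A0) ||| (T0 <<< A2)))) fun T1 =>
    cond (Nat.beq T1 0) true (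
    force (normB n a b c (S2 &&& ((T0 >>> A1) ||| (T1 <<< A0)))) fun T2 =>
    cond (Nat.beq T2 0) true (runB n a b c A0 A1 A2 fin f T0 T1 T2))) := rfl
    rw [e, force_eq] at h
    set T0 := normB n a b c (S0 &&& ((S1 >>> A2) ||| (S2 <<< A1))) with hT0
    have b0 : ∀ x, M 0 x → Nat.testBit T0 x = true := fun x hx =>
      normB_hit (hs 0) (fun y hy => link_hit a1 a2 (a0 y hy) (h0 y hy)) hx (ht 0 x hx)
    rw [cond_z (ne_z (b0 _ (hn 0).choose_spec)), force_eq] at h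
    set T1 := normB n a b c (S1 &&& ((S2 >>> A0) ||| (T0 <<< A2))) with hT1
    have b1 : ∀ x, M 1 x → Nat.testBit T1 x = true := fun x hx =>
      normB_hit (hs 1) (fun y hy => link_hit a2 b0 (a1 y hy) (h1 y hy)) hx (ht 1 x hx)
    rw [cond_z (ne_z (b1 _ (hn 1).choose_spec)), force_eq] at h
    set T2 := normB n a b c (S2 &&& ((T0 >>> A1) ||| (T1 <<< A0))) with hT2
    have b2 : ∀ x, M 2 x → Nat.testBit T2 x = true := fun x hx =>
      normB_hit (hs 2) (fun y hy => link_hit b0 b1 (a2 y hy) (h2 y hy)) hx (ht 2 x hx)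
    rw [cond_z (ne_z (b2 _ (hn 2).choose_spec))] at h
    exact ih T0 T1 T2 b0 b1 b2 h

lemma full_hit {n a b c x : ℕ} (h : ∃ y, (y = a ∨ y = b ∨ y = c) ∧ (x = y ∨ x = n - y)) :
    Nat.testBit (fullB n a b c) x = true := by
  obtain ⟨y, hy, hx⟩ := h
  unfold fullB
  rcases hy with rfl | rfl | rfl <;> rcases hx with rfl | rfl <;> simp [Nat.testBit_shiftLeft]
end

section

structure Cod (α β : ℝ) (a b : ℕ) : Prop where
  mem : (a, b) ∈ prs
  fw : ∀ i j : ℤ, |i| ≤ 6 → |j| ≤ 6 → (i : ℝ) * α + j * β = 0 → i * a + j * b = 0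
  bw : ∀ i j : ℤ, |i| ≤ 20 → |j| ≤ 20 → i * (a : ℤ) + j * b = 0 → (i : ℝ) * α + j * β = 0
  lt1 : α < β → a < b
  lt2 : β < α → b < a

lemma prs_gcd : ∀ u v : Fin 7, 0 < u.1 → 0 < v.1 → (u.1 / Nat.gcd u.1 v.1, v.1 / Nat.gcd u.1 v.1) ∈ prs := by
  decide +kernel

lemma codes {α β : ℝ} (ha : 0 < α) (hb : 0 < β) : ∃ a b, Cod α β a b := by
  by_cases h : ∃ i j : ℤ, |i| ≤ 6 ∧ |j| ≤ 6 ∧ (i : ℝ) * α + j * β = 0 ∧ ¬ (i = 0 ∧ j = 0)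
  · have : ∃ u v : ℕ, 0 < u ∧ 0 < v ∧ u ≤ 6 ∧ v ≤ 6 ∧ (v : ℝ) * α = u * β := by
      obtain ⟨i, j, hi, hj, h, h0⟩ := h
      rw [abs_le] at hi hj
      rcases lt_trichotomy i 0 with h1 | h1 | h1
      · have h2 : 0 < j := by
          by_contra h3; push Not at h3
          have a1 : (i : ℝ) < 0 := by exact_mod_cast h1
          have a2 : (j : ℝ) ≤ 0 := by exact_mod_cast h3
          nlinarith
        refine ⟨j.toNat, (-i).toNat, by omega, by omega, by omega, by omega, ?_⟩
        have e1 : ((j.toNat : ℤ)) = j := by omega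
        have e2 : (((-i).toNat : ℤ)) = -i := by omega
        have e1' : ((j.toNat : ℝ)) = j := by exact_mod_cast e1
        have e2' : (((-i).toNat : ℝ)) = -i := by exact_mod_cast e2
        rw [e1', e2']; linarith
      · subst h1
        have : (j : ℝ) = 0 := by
          simp at h; rcases h with h | h
          · exact_mod_cast h
          · linarith
        exact absurd ⟨rfl, by exact_mod_cast this⟩ h0
      · have h2 : j < 0 := by
          by_contra h3; push Not at h3
          have a1 : (0 : ℝ) < i := by exact_mod_cast h1
          have a2 : (0 : ℝ) ≤ j := by exact_mod_cast h3
          nlinarith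
        refine ⟨(-j).toNat, i.toNat, by omega, by omega, by omega, by omega, ?_⟩
        have e1 : (((-j).toNat : ℤ)) = -j := by omega
        have e2 : ((i.toNat : ℤ)) = i := by omega
        have e1' : (((-j).toNat : ℝ)) = -j := by exact_mod_cast e1
        have e2' : ((i.toNat : ℝ)) = i := by exact_mod_cast e2
        rw [e1', e2']; linarith
    obtain ⟨u, v, hu, hv, hu6, hv6, e⟩ := this
    have hm := prs_gcd ⟨u, by omega⟩ ⟨v, by omega⟩ hu hv
    simp only at hm
    have g0 : 0 < Nat.gcd u v := Nat.gcd_pos_of_pos_left _ hu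
    obtain ⟨a, hua⟩ := Nat.gcd_dvd_left u v
    obtain ⟨b, hvb⟩ := Nat.gcd_dvd_right u v
    set d := Nat.gcd u v
    have e1 : u / d = a := by conv_lhs => rw [hua]; exact Nat.mul_div_cancel_left a g0
    have e2 : v / d = b := by conv_lhs => rw [hvb]; exact Nat.mul_div_cancel_left b g0
    rw [e1, e2] at hm
    have ha0 : 0 < a := Nat.pos_of_ne_zero (by rintro rfl; omega)
    have hb0 : 0 < b := Nat.pos_of_ne_zero (by rintro rfl; omega)
    have hd : (0 : ℝ) < d := by exact_mod_cast g0
    have hr : (b : ℝ) * α = a * β := by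
      rw [hua, hvb] at e; push_cast at e
      apply mul_left_cancel₀ hd.ne'; linarith
    have har : (0 : ℝ) < a := by exact_mod_cast ha0
    have hbr : (0 : ℝ) < b := by exact_mod_cast hb0
    refine ⟨a, b, hm, ?_, ?_, ?_, ?_⟩
    · intro i j _ _ h
      have : ((i : ℝ) * a + j * b) * α = 0 := by linear_combination (a : ℝ) * h + j * hr
      have := (mul_eq_zero.mp this).resolve_right ha.ne'
      exact_mod_cast this
    · intro i j _ _ h
      have h' : (i : ℝ) * a + j * b = 0 := by exact_mod_cast h
      have : (a : ℝ) * (i * α + j * β) = 0 := by linear_combination α * h' - j * hr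
      exact (mul_eq_zero.mp this).resolve_left har.ne'
    · intro h
      have : (a : ℝ) < b := by by_contra h1; push Not at h1; nlinarith
      exact_mod_cast this
    · intro h
      have : (b : ℝ) < a := by by_contra h1; push Not at h1; nlinarith
      exact_mod_cast this
  · push Not at h
    have hne : α ≠ β := by
      intro h1
      have := h 1 (-1) (by norm_num) (by norm_num) (by rw [h1]; push_cast; ring)
      simp at this
    have key : ∀ i j : ℤ, (i = 0 ∧ j = 0) → (i : ℝ) * α + j * β = 0 := by
      rintro i j ⟨rfl, rfl⟩; simp
    rcases lt_or_gt_of_ne hne with h1 | h1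
    · refine ⟨1, 40, by decide, ?_, ?_, fun _ => by norm_num, fun h2 => by linarith⟩
      · intro i j hi hj hh
        obtain ⟨rfl, rfl⟩ := h i j hi hj hh
        simp
      · intro i j hi hj hh
        rw [abs_le] at hi hj
        apply key; push_cast at hh; omega
    · refine ⟨40, 1, by decide, ?_, ?_, fun h2 => by linarith, fun _ => by norm_num⟩
      · intro i j hi hj hh
        obtain ⟨rfl, rfl⟩ := h i j hi hj hh
        simp
      · intro i j hi hj hh
        rw [abs_le] at hi hj
        apply key; push_cast at hh; omega

def Lk (α β : ℝ) (a b : ℕ) (Θ : ℝ) (A : ℕ) : Prop := A ∈ lstD a b ∧ ∃ f1 f2 : ℤ, -1 ≤ f1 ∧ f1 ≤ 3 ∧ -1 ≤ f2 ∧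
  f2 ≤ 2 ∧ Θ = f1 * α + f2 * β ∧ (A : ℤ) = f1 * a + f2 * b

lemma lstD_form {a b A : ℕ} (h : A ∈ lstD a b) : ∃ f1 f2 : ℤ, -1 ≤ f1 ∧ f1 ≤ 3 ∧ -1 ≤ f2 ∧
    f2 ≤ 2 ∧ (A : ℤ) = f1 * a + f2 * b := by
  unfold lstD at h
  simp only [List.mem_cons] at h
  rcases h with h | h | h | h | h | h | h | h
  · exact ⟨1, 0, by norm_num, by norm_num, by norm_num, by norm_num, by subst h; push_cast; ring⟩
  · exact ⟨2, 0, by norm_num, by norm_num, by norm_num, by norm_num, by subst h; push_cast; ring⟩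
  · exact ⟨3, 0, by norm_num, by norm_num, by norm_num, by norm_num, by subst h; push_cast; ring⟩
  · exact ⟨0, 1, by norm_num, by norm_num, by norm_num, by norm_num, by subst h; push_cast; ring⟩
  · exact ⟨1, 1, by norm_num, by norm_num, by norm_num, by norm_num, by subst h; push_cast; ring⟩
  · exact ⟨2, 1, by norm_num, by norm_num, by norm_num, by norm_num, by subst h; push_cast; ring⟩
  · exact ⟨1, 2, by norm_num, by norm_num, by norm_num, by norm_num, by subst h; push_cast; ring⟩
  · rcases lt_trichotomy a b with h1 | h1 | h1
    · have e : Nat.blt a b = true := by simpa [Nat.blt_eq] using h1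
      rw [e] at h; simp at h
      exact ⟨-1, 1, by norm_num, by norm_num, by norm_num, by norm_num, by omega⟩
    · subst h1
      have e : Nat.blt a a = false := by
        rw [Bool.eq_false_iff]; intro hh; rw [Nat.blt_eq] at hh; omega
      rw [e] at h; simp at h
    · have e : Nat.blt b a = true := by simpa [Nat.blt_eq] using h1
      have e' : Nat.blt a b = false := by
        rw [Bool.eq_false_iff]; intro hh; rw [Nat.blt_eq] at hh; omega
      rw [e, e'] at h; simp at h
      exact ⟨1, -1, by norm_num, by norm_num, by norm_num, by norm_num, by omega⟩

lemma lk_mk {α β : ℝ} {a b : ℕ} (C : Cod α β a b) {Θ : ℝ} (hΘ : 0 < Θ)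
    (h : Θ = α ∨ Θ = 2 * α ∨ Θ = 3 * α ∨ Θ = β ∨ Θ = α + β ∨ Θ = 2 * α + β ∨ Θ = α + 2 * β ∨
      Θ = β - α ∨ Θ = α - β) : ∃ A, Lk α β a b Θ A := by
  rcases h with h | h | h | h | h | h | h | h | h
  · exact ⟨a, by simp [lstD], 1, 0, by norm_num, by norm_num, by norm_num, by norm_num, by push_cast; linarith, by push_cast; ring⟩
  · exact ⟨2 * a, by simp [lstD], 2, 0, by norm_num, by norm_num, by norm_num, by norm_num, by push_cast; linarith, by push_cast; ring⟩
  · exact ⟨3 * a, by simp [lstD], 3, 0, by norm_num, by norm_num, by norm_num, by norm_num, by push_cast; linarith, by push_cast; ring⟩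
  · exact ⟨b, by simp [lstD], 0, 1, by norm_num, by norm_num, by norm_num, by norm_num, by push_cast; linarith, by push_cast; ring⟩
  · exact ⟨a + b, by simp [lstD], 1, 1, by norm_num, by norm_num, by norm_num, by norm_num, by push_cast; linarith, by push_cast; ring⟩
  · exact ⟨2 * a + b, by simp [lstD], 2, 1, by norm_num, by norm_num, by norm_num, by norm_num, by push_cast; linarith, by push_cast; ring⟩
  · exact ⟨a + 2 * b, by simp [lstD], 1, 2, by norm_num, by norm_num, by norm_num, by norm_num, by push_cast; linarith, by push_cast; ring⟩
  · have h1 := C.lt1 (by linarith)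
    have e : Nat.blt a b = true := by simpa [Nat.blt_eq] using h1
    exact ⟨b - a, by simp [lstD, e], -1, 1, by norm_num, by norm_num, by norm_num, by norm_num, by push_cast; linarith, by push_cast; omega⟩
  · have h1 := C.lt2 (by linarith)
    have e : Nat.blt b a = true := by simpa [Nat.blt_eq] using h1
    have e' : Nat.blt a b = false := by
      rw [Bool.eq_false_iff]; intro hh; rw [Nat.blt_eq] at hh; omega
    exact ⟨a - b, by simp [lstD, e, e'], 1, -1, by norm_num, by norm_num, by norm_num, by norm_num, by push_cast; linarith, by push_cast; omega⟩

section
variable {N : ℕ} {P : Fin N → Fin 3 → ℂ} {Q : Fin 3 → ℂ} {l th : Fin 3 → ℝ} {g : Fin 3 → ℝ →+ ℝ}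

structure Ths (α β : ℝ) (th : Fin 3 → ℝ) : Prop where
  h0 : th 0 = α
  h1 : th 1 = β
  h2 : th 2 = 2 * α + β
  hpi : π = 3 * α + 2 * β
  ap : 0 < α
  bp : 0 < β

/-- forms of elements -/
def efm (i j : ℕ) : Prop := (i = 1 ∧ j = 0) ∨ (i = 0 ∧ j = 1) ∨ (i = 2 ∧ j = 1) ∨ (i = 2 ∧ j = 2) ∨
  (i = 3 ∧ j = 1) ∨ (i = 1 ∧ j = 1)

lemma efm_le {i j : ℕ} (h : efm i j) : i ≤ 3 ∧ j ≤ 2 := by unfold efm at h; omega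

lemma mem_efm {α β : ℝ} (T : Ths α β th) {k : Fin 3} {x : ℝ} (h : Mem Q th g k x) :
    ∃ i j : ℕ, efm i j ∧ x = i * α + j * β := by
  obtain ⟨t, ht, h⟩ := h
  have := T.h0; have := T.h1; have := T.h2; have := T.hpi
  fin_cases t <;> rcases h with h | h <;> simp at h
  · exact ⟨1, 0, by simp [efm], by push_cast; linarith⟩
  · exact ⟨2, 2, by simp [efm], by push_cast; linarith⟩
  · exact ⟨0, 1, by simp [efm], by push_cast; linarith⟩
  · exact ⟨3, 1, by simp [efm], by push_cast; linarith⟩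
  · exact ⟨2, 1, by simp [efm], by push_cast; linarith⟩
  · exact ⟨1, 1, by simp [efm], by push_cast; linarith⟩

lemma diff_lk {α β : ℝ} {a b : ℕ} (C : Cod α β a b) (ha : 0 < α) (hb : 0 < β) {i j i' j' : ℕ}
    (h : efm i j) (h' : efm i' j') {Θ : ℝ} (hΘ : 0 < Θ)
    (e : (i' : ℝ) * α + j' * β = i * α + j * β + Θ) : ∃ A, Lk α β a b Θ A := by
  apply lk_mk C hΘ
  unfold efm at h h'
  rcases h with ⟨rfl, rfl⟩ | ⟨rfl, rfl⟩ | ⟨rfl, rfl⟩ | ⟨rfl, rfl⟩ | ⟨rfl, rfl⟩ | ⟨rfl, rfl⟩ <;>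
  rcases h' with ⟨rfl, rfl⟩ | ⟨rfl, rfl⟩ | ⟨rfl, rfl⟩ | ⟨rfl, rfl⟩ | ⟨rfl, rfl⟩ | ⟨rfl, rfl⟩ <;>
  push_cast at e <;>
  first
  | (exfalso; linarith)
  | (left; linarith)
  | (right; left; linarith)
  | (right; right; left; linarith)
  | (right; right; right; left; linarith)
  | (right; right; right; right; left; linarith)
  | (right; right; right; right; right; left; linarith)
  | (right; right; right; right; right; right; left; linarith)
  | (right; right; right; right; right; right; right; left; linarith)
  | (right; right; right; right; right; right; right; right; linarith)

def Mc (Q : Fin 3 → ℂ) (th : Fin 3 → ℝ) (g : Fin 3 → ℝ →+ ℝ) (α β : ℝ) (a b : ℕ) (k : Fin 3) (x : ℕ) : Prop :=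
  ∃ i j : ℕ, efm i j ∧ Mem Q th g k (i * α + j * β) ∧ x = i * a + j * b

lemma mc_of {α β : ℝ} {a b : ℕ} (C : Cod α β a b) (T : Ths α β th) {k : Fin 3} {i j : ℕ} (hi : i ≤ 3) (hj : j ≤ 2)
    (h : Mem Q th g k (i * α + j * β)) : Mc Q th g α β a b k (i * a + j * b) := by
  obtain ⟨i', j', h', e⟩ := mem_efm T h
  refine ⟨i', j', h', by rwa [← e], ?_⟩
  have := efm_le h'
  have := C.fw (i - i') (j - j') (by rw [abs_le]; omega) (by rw [abs_le]; omega)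
    (by push_cast; linarith)
  have e2 : (i : ℤ) * a + j * b = i' * a + j' * b := by linarith
  exact_mod_cast e2

lemma mc_symm {α β : ℝ} {a b : ℕ} (C : Cod α β a b) (T : Ths α β th) {k : Fin 3} {x : ℕ}
    (h : Mc Q th g α β a b k x) : Mc Q th g α β a b k (3 * a + 2 * b - x) := by
  obtain ⟨i, j, hij, hm, rfl⟩ := h
  have := efm_le hij
  have e : 3 * a + 2 * b - (i * a + j * b) = (3 - i) * a + (2 - j) * b := by
    obtain ⟨u, hu⟩ : ∃ u, 3 = i + u := ⟨3 - i, by omega⟩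
    obtain ⟨v, hv⟩ : ∃ v, 2 = j + v := ⟨2 - j, by omega⟩
    rw [hu, hv, Nat.add_sub_cancel_left, Nat.add_sub_cancel_left]
    apply Nat.sub_eq_of_eq_add; ring
  rw [e]
  apply mc_of C T (by omega) (by omega)
  have := hm.symm
  rw [T.hpi] at this
  convert this using 1
  rw [Nat.cast_sub (by omega), Nat.cast_sub (by omega)]; push_cast; ring

def thc (a b : ℕ) (t : Fin 3) : ℕ := match t with
  | 0 => a
  | 1 => b
  | 2 => 2 * a + b

lemma mc_thc {α β : ℝ} {a b : ℕ} (C : Cod α β a b) (T : Ths α β th) {k t : Fin 3}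
    (h : Mem Q th g k (th t)) : Mc Q th g α β a b k (thc a b t) := by
  have e0 := T.h0; have e1 := T.h1; have e2 := T.h2
  fin_cases t
  · have := mc_of (a := a) (b := b) C T (k := k) (i := 1) (j := 0) (Q := Q) (g := g) (by omega) (by omega)
      (by convert h using 1; simp [e0])
    simpa [thc] using this
  · have := mc_of (a := a) (b := b) C T (k := k) (i := 0) (j := 1) (Q := Q) (g := g) (by omega) (by omega)
      (by convert h using 1; simp [e1])
    simpa [thc] using this
  · have := mc_of (a := a) (b := b) C T (k := k) (i := 2) (j := 1) (Q := Q) (g := g) (by omega) (by omega)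
      (by convert h using 1; simp [e2])
    simpa [thc] using this

lemma mc_type {α β : ℝ} {a b : ℕ} (C : Cod α β a b) (T : Ths α β th) {k : Fin 3} {y : ℕ}
    (h : Mc Q th g α β a b k y) : ∃ x, (x = a ∨ x = b ∨ x = 2 * a + b) ∧ Mc Q th g α β a b k x ∧
      (y = x ∨ y = 3 * a + 2 * b - x) := by
  obtain ⟨i, j, hij, hm, rfl⟩ := id h
  have hs := mc_symm C T h
  unfold efm at hij
  rcases hij with ⟨rfl, rfl⟩ | ⟨rfl, rfl⟩ | ⟨rfl, rfl⟩ | ⟨rfl, rfl⟩ | ⟨rfl, rfl⟩ | ⟨rfl, rfl⟩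
  · exact ⟨_, Or.inl (by omega), h, Or.inl rfl⟩
  · exact ⟨_, Or.inr (Or.inl (by omega)), h, Or.inl rfl⟩
  · exact ⟨_, Or.inr (Or.inr (by omega)), h, Or.inl rfl⟩
  · exact ⟨_, Or.inl (by omega), hs, Or.inr (by omega)⟩
  · exact ⟨_, Or.inr (Or.inl (by omega)), hs, Or.inr (by omega)⟩
  · exact ⟨_, Or.inr (Or.inr (by omega)), hs, Or.inr (by omega)⟩
end
end

section
section
variable {N : ℕ} {P : Fin N → Fin 3 → ℂ} {Q : Fin 3 → ℂ} {l th : Fin 3 → ℝ} {g : Fin 3 → ℝ →+ ℝ}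

lemma memB_iff {x : ℕ} {l : List ℕ} : memB x l = true ↔ x ∈ l := by
  unfold memB; simp

lemma lk_pos {α β : ℝ} {a b : ℕ} (C : Cod α β a b) (T : Ths α β th) (D : Dat P Q l th g) {k k' : Fin 3} {i j : ℕ}
    (hij : efm i j) {Θ : ℝ} (hΘ : 0 < Θ) (h' : Mem Q th g k' (i * α + j * β + Θ)) :
    ∃ A, Lk α β a b Θ A := by
  obtain ⟨i', j', h1, e⟩ := mem_efm T h'
  exact diff_lk C T.ap T.bp hij h1 hΘ e.symm

lemma lk_neg {α β : ℝ} {a b : ℕ} (C : Cod α β a b) (T : Ths α β th) (D : Dat P Q l th g) {k k' : Fin 3} {i j : ℕ}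
    (hij : efm i j) {Θ : ℝ} (hΘ : 0 < Θ) (h' : Mem Q th g k' (i * α + j * β - Θ)) :
    ∃ A, Lk α β a b Θ A := by
  obtain ⟨i', j', h1, e⟩ := mem_efm T h'
  exact diff_lk C T.ap T.bp h1 hij hΘ (by linarith)

lemma step_pos {α β : ℝ} {a b : ℕ} (C : Cod α β a b) (T : Ths α β th) {k' : Fin 3} {i j : ℕ}
    (hij : efm i j) {Θ : ℝ} {A : ℕ} (hA : Lk α β a b Θ A) (h' : Mem Q th g k' (i * α + j * β + Θ)) :
    Mc Q th g α β a b k' (i * a + j * b + A) := by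
  obtain ⟨i', j', h1, e⟩ := mem_efm T h'
  obtain ⟨_, f1, f2, b1, b2, b3, b4, e1, e2⟩ := hA
  refine ⟨i', j', h1, by rwa [← e], ?_⟩
  have := efm_le hij; have := efm_le h1
  have := C.fw (i + f1 - i') (j + f2 - j') (by rw [abs_le]; omega) (by rw [abs_le]; omega)
    (by push_cast; linarith)
  have e3 : (i : ℤ) * a + j * b + A = i' * a + j' * b := by linarith
  exact_mod_cast e3

lemma step_neg {α β : ℝ} {a b : ℕ} (C : Cod α β a b) (T : Ths α β th) {k' : Fin 3} {i j : ℕ}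
    (hij : efm i j) {Θ : ℝ} {A : ℕ} (hA : Lk α β a b Θ A) (h' : Mem Q th g k' (i * α + j * β - Θ)) :
    ∃ y, Mc Q th g α β a b k' y ∧ i * a + j * b = y + A := by
  obtain ⟨i', j', h1, e⟩ := mem_efm T h'
  obtain ⟨_, f1, f2, b1, b2, b3, b4, e1, e2⟩ := hA
  refine ⟨_, ⟨i', j', h1, by rwa [← e], rfl⟩, ?_⟩
  have := efm_le hij; have := efm_le h1
  have := C.fw (i - f1 - i') (j - f2 - j') (by rw [abs_le]; omega) (by rw [abs_le]; omega)
    (by push_cast; linarith)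
  have e3 : (i : ℤ) * a + j * b = i' * a + j' * b + A := by linarith
  exact_mod_cast e3

lemma side_mem (D : Dat P Q l th g) {f : ℝ → ℝ} (hf : ∀ j, l j = f (th j)) (k : Fin 3) :
    ∃ t, 0 < g t ‖ed Q k‖ := by
  obtain ⟨n, h1, h2⟩ := nu_nat D k
  have h := h2 f hf
  have hp := norm_ed_pos D.til.hQ k
  by_contra h0; push Not at h0
  have : ∀ t, (n t : ℝ) = 0 := fun t => by
    have := h0 t; rw [h1] at this
    exact le_antisymm this (Nat.cast_nonneg _)
  simp only [this] at h
  simp at h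
  rw [h] at hp; simp at hp

lemma lstD_pos : ∀ x ∈ prs, ∀ y ∈ lstD x.1 x.2, 0 < y := by decide +kernel

/-- combinatorial outcome -/
structure Oc (Q : Fin 3 → ℂ) (th : Fin 3 → ℝ) (g : Fin 3 → ℝ →+ ℝ) (α β : ℝ) (a b : ℕ) (A S : Fin 3 → ℕ) : Prop where
  cod : Cod α β a b
  lk : ∀ j, Lk α β a b (ang Q j) (A j)
  sup : ∀ k t, 0 < g t ‖ed Q k‖ → Nat.testBit (S k) (thc a b t) = true
  fin : finB a b (A 0) (A 1) (A 2) (S 0) (S 1) (S 2) = true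

lemma outcome {α β : ℝ} (T : Ths α β th) (D : Dat P Q l th g) {f : ℝ → ℝ} (hf : ∀ j, l j = f (th j)) :
    ∃ a b A S, Oc Q th g α β a b A S := by
  classical
  obtain ⟨a, b, C⟩ := codes T.ap T.bp
  have hd := D.til.hQ
  have hap := fun j => ang_pos hd j
  have hex : ∀ k, ∃ i j : ℕ, efm i j ∧ Mem Q th g k (i * α + j * β) := by
    intro k
    obtain ⟨t, ht⟩ := side_mem D hf k
    have hm : Mem Q th g k (th t) := ⟨t, ht, Or.inl rfl⟩
    obtain ⟨i, j, h, e⟩ := mem_efm T hm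
    exact ⟨i, j, h, by rwa [← e]⟩
  have hs : ∀ k x, Mc Q th g α β a b k x → Mc Q th g α β a b k (3 * a + 2 * b - x) := fun k x h => mc_symm C T h
  have ht : ∀ k y, Mc Q th g α β a b k y → ∃ x, (x = a ∨ x = b ∨ x = 2 * a + b) ∧ Mc Q th g α β a b k x ∧
      (y = x ∨ y = 3 * a + 2 * b - x) := fun k y h => mc_type C T h
  have hn : ∀ k, ∃ x, Mc Q th g α β a b k x := fun k => by
    obtain ⟨i, j, h, hm⟩ := hex k
    exact ⟨_, i, j, h, hm, rfl⟩
  have hfull : ∀ k x, Mc Q th g α β a b k x → Nat.testBit (fullB (3 * a + 2 * b) a b (2 * a + b)) x = true := by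
    intro k x hx
    obtain ⟨y, h1, _, h2⟩ := ht k x hx
    exact full_hit ⟨y, h1, h2⟩
  let A : Fin 3 → ℕ := fun j => if h : ∃ A, Lk α β a b (ang Q j) A then h.choose else 200
  have hA : ∀ j, (∃ A, Lk α β a b (ang Q j) A) → Lk α β a b (ang Q j) (A j) := fun j h => by
    have : A j = h.choose := dif_pos h
    rw [this]; exact h.choose_spec
  have clo : ∀ k x, Mc Q th g α β a b k x → Mc Q th g α β a b (k + 1) (x + A (k + 2)) ∨
      ∃ y, Mc Q th g α β a b (k + 2) y ∧ x = y + A (k + 1) := by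
    rintro k x ⟨i, j, hij, hm, rfl⟩
    rcases rule D hm with h | h
    · left; exact step_pos C T hij (hA _ (lk_pos (k := k) C T D hij (hap _) h)) h
    · right; exact step_neg C T hij (hA _ (lk_neg (k := k) C T D hij (hap _) h)) h
  have hsum : ang Q 0 + ang Q 1 + ang Q 2 = π := ang_sum hd 0
  have all : ∀ j, Lk α β a b (ang Q j) (A j) := by
    intro j
    apply hA
    by_contra hno
    have l2 : ∃ A, Lk α β a b (ang Q (j + 2)) A := by
      obtain ⟨i', j', hij, hm⟩ := hex (j + 1)
      have r := rule D hm
      rw [show j + 1 + 2 = j by omega, show j + 1 + 1 = j + 2 by omega] at r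
      rcases r with h | h
      · exact absurd (lk_pos (k := j) C T D hij (hap _) h) hno
      · exact lk_neg (k := j) C T D hij (hap _) h
    have l1 : ∃ A, Lk α β a b (ang Q (j + 1)) A := by
      obtain ⟨i', j', hij, hm⟩ := hex (j + 2)
      have r := rule D hm
      rw [show j + 2 + 2 = j + 1 by omega, show j + 2 + 1 = j by omega] at r
      rcases r with h | h
      · exact lk_pos (k := j) C T D hij (hap _) h
      · exact absurd (lk_neg (k := j) C T D hij (hap _) h) hno
    have L1 := hA _ l1
    have L2 := hA _ l2
    have A0 : A j = 200 := dif_neg hno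
    have ck := List.all_eq_true.mp chk2_ok _ C.mem
    simp only [chk2, List.all_eq_true] at ck
    have ck := ck _ L1.1 _ L2.1
    obtain ⟨S0, S1, S2, _, _, _, hfin⟩ := runB_sound (M := fun k => Mc Q th g α β a b (j + k))
      (fun k => hs _) (fun k => ht _) (fun k => hn _)
      (by
        intro x hx
        have := clo _ x hx
        simpa using this)
      (by
        intro x hx
        have := clo _ x hx
        rw [A0.symm]
        rw [show j + 1 + 1 = j + 2 by omega, show j + 1 + 2 = j by omega] at this
        simpa using this)
      (by
        intro x hx
        have := clo _ x hx
        rw [A0.symm]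
        rw [show j + 2 + 1 = j by omega, show j + 2 + 2 = j + 1 by omega] at this
        simpa using this) 5 _ _ _ (hfull _) (hfull _) (hfull _) ck
    rw [memB_iff] at hfin
    apply hno
    refine ⟨_, hfin, ?_⟩
    obtain ⟨f1, f2, b1, b2, b3, b4, e⟩ := lstD_form hfin
    refine ⟨f1, f2, b1, b2, b3, b4, ?_, e⟩
    obtain ⟨_, p1, p2, c1, c2, c3, c4, e1, e2⟩ := L1
    obtain ⟨_, q1, q2, d1, d2, d3, d4, e3, e4⟩ := L2
    have hpos : 0 < 3 * a + 2 * b - A (j + 1) - A (j + 2) := by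
      exact lstD_pos _ C.mem _ hfin
    have e5 : ((3 * a + 2 * b - A (j + 1) - A (j + 2) : ℕ) : ℤ) = 3 * a + 2 * b - A (j + 1) - A (j + 2) := by omega
    rw [e5, e2, e4] at e
    have := C.bw (3 - p1 - q1 - f1) (2 - p2 - q2 - f2) (by rw [abs_le]; omega) (by rw [abs_le]; omega)
      (by linarith)
    have s := ang_sum hd j
    rw [e1, e3, T.hpi] at s
    push_cast at this
    linarith
  have ck := List.all_eq_true.mp chk1_ok _ C.mem
  simp only [chk1, List.all_eq_true] at ck
  have ck := ck _ (all 0).1 _ (all 1).1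
  rw [force_eq] at ck
  have e2 : 3 * a + 2 * b - A 0 - A 1 = A 2 := by
    obtain ⟨_, p1, p2, c1, c2, c3, c4, e1, e2⟩ := all 0
    obtain ⟨_, q1, q2, d1, d2, d3, d4, e3, e4⟩ := all 1
    obtain ⟨_, r1, r2, g1, g2, g3, g4, e5, e6⟩ := all 2
    have := C.fw (p1 + q1 + r1 - 3) (p2 + q2 + r2 - 2) (by rw [abs_le]; omega) (by rw [abs_le]; omega)
      (by push_cast; rw [e1, e3, e5, T.hpi] at hsum; linarith)
    have : (A 0 : ℤ) + A 1 + A 2 = 3 * a + 2 * b := by rw [e2, e4, e6]; linarith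
    omega
  rw [e2, memB_iff.mpr (all 2).1] at ck
  obtain ⟨S0, S1, S2, b0, b1, b2, hfin⟩ := runB_sound (M := fun k => Mc Q th g α β a b k)
      (fun k => hs _) (fun k => ht _) (fun k => hn _) (clo 0) (clo 1) (clo 2)
       5 _ _ _ (hfull _) (hfull _) (hfull _) ck
  refine ⟨a, b, A, ![S0, S1, S2], C, all, ?_, hfin⟩
  intro k t h
  have hm := mc_thc (a := a) (b := b) C T (Q := Q) (g := g) (k := k) (t := t) ⟨t, h, Or.inl rfl⟩
  fin_cases k
  · exact b0 _ hm
  · exact b1 _ hm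
  · exact b2 _ hm
end
end

section

lemma irr_of {x : ℝ} (h : IsIntegral ℤ x) (h0 : 0 < x) (h1 : x < 1) (q : ℚ) : x ≠ q := by
  intro e
  obtain ⟨k, hk⟩ := h.exists_int_iff_exists_rat.mp ⟨q, e⟩
  rw [hk] at h0 h1
  have a : (0 : ℤ) < k := by exact_mod_cast h0
  have b : k < (1 : ℤ) := by exact_mod_cast h1
  omega

lemma lin_irr {x : ℝ} (h : ∀ q : ℚ, x ≠ q) {u v : ℚ} (e : (u : ℝ) + v * x = 0) : u = 0 ∧ v = 0 := by
  have hv : v = 0 := by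
    by_contra hv
    have : (v : ℝ) ≠ 0 := by exact_mod_cast hv
    apply h (-u / v)
    push_cast
    field_simp
    linarith
  subst hv
  simp at e
  exact ⟨e, rfl⟩

lemma quad_int {s : ℝ} (h : IsIntegral ℤ s) (hirr : ∀ q : ℚ, s ≠ q) {x y z : ℚ}
    (hz : z ≠ 0) (e : (x : ℝ) + y * s + z * s ^ 2 = 0) : ∃ m n : ℤ, s ^ 2 = m * s - n := by
  have hz' : (z : ℝ) ≠ 0 := by exact_mod_cast hz
  have hmono := minpoly.monic h
  have hdeg : (minpoly ℤ s).natDegree ≤ 2 := by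
    have e1 : minpoly ℚ s = (minpoly ℤ s).map (algebraMap ℤ ℚ) :=
      minpoly.isIntegrallyClosed_eq_field_fractions' ℚ h
    have e2 : (minpoly ℚ s).natDegree = (minpoly ℤ s).natDegree := by
      rw [e1]; exact hmono.natDegree_map _
    rw [← e2]
    have hq : (Polynomial.C z * Polynomial.X ^ 2 + Polynomial.C y * Polynomial.X + Polynomial.C x) ≠ 0 := by
      intro h0
      have := congrArg Polynomial.natDegree h0
      rw [Polynomial.natDegree_quadratic hz] at this
      simp at this
    have h3 : Polynomial.aeval s (Polynomial.C z * Polynomial.X ^ 2 + Polynomial.C y * Polynomial.X + Polynomial.C x) = 0 := by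
      simp
      linarith
    have h4 := Polynomial.natDegree_le_of_dvd (minpoly.dvd ℚ s h3) hq
    rwa [Polynomial.natDegree_quadratic hz] at h4
  have ha := minpoly.aeval ℤ s
  rw [Polynomial.aeval_eq_sum_range' (n := 3) (by omega)] at ha
  simp [Finset.sum_range_succ] at ha
  have hc : (minpoly ℤ s).coeff 2 = 1 := by
    by_cases h2 : (minpoly ℤ s).natDegree = 2
    · have := hmono.coeff_natDegree
      rwa [h2] at this
    · exfalso
      have c2 : (minpoly ℤ s).coeff 2 = 0 := Polynomial.coeff_eq_zero_of_natDegree_lt (by omega)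
      rw [c2] at ha
      obtain ⟨u, v⟩ := lin_irr hirr (u := (minpoly ℤ s).coeff 0) (v := (minpoly ℤ s).coeff 1)
        (by push_cast; push_cast at ha; linarith)
      have := hmono.ne_zero
      apply this
      ext i
      rcases lt_or_ge i 2 with hi | hi
      · interval_cases i
        · simpa using u
        · simpa using v
      · rw [Polynomial.coeff_eq_zero_of_natDegree_lt (by omega)]
        simp
  rw [hc] at ha
  refine ⟨-(minpoly ℤ s).coeff 1, (minpoly ℤ s).coeff 0, ?_⟩
  push_cast at ha ⊢
  linarith

lemma conj_bound {s t : ℝ} (hirr : ∀ q : ℚ, s ≠ q) {m n : ℤ} (hs : s ^ 2 = m * s - n) (ht : t ^ 2 = m * t - n)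
   {q : ℚ} (hq : s = 2 * cos (q * π)) : |t| ≤ 2 := by
  have key : ∀ k : ℕ, (∃ x y : ℤ, (Polynomial.Chebyshev.C ℝ k).eval s = x + y * s ∧
      (Polynomial.Chebyshev.C ℝ k).eval t = x + y * t) ∧ (∃ x y : ℤ,
      (Polynomial.Chebyshev.C ℝ (k + 1)).eval s = x + y * s ∧
      (Polynomial.Chebyshev.C ℝ (k + 1)).eval t = x + y * t) := by
    intro k
    induction k with
    | zero => exact ⟨⟨2, 0, by simp, by simp⟩, ⟨0, 1, by simp, by simp⟩⟩
    | succ k ih =>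
      refine ⟨by simpa using ih.2, ?_⟩
      obtain ⟨⟨x, y, e1, e2⟩, x', y', e3, e4⟩ := ih
      refine ⟨- y' * n - x, x' + y' * m - y, ?_, ?_⟩
      · rw [show ((k + 1 : ℕ) : ℤ) + 1 = k + 2 by push_cast; ring, Polynomial.Chebyshev.C_add_two]
        simp only [Polynomial.eval_sub, Polynomial.eval_mul, Polynomial.eval_X, e1, e3]
        push_cast
        linear_combination y' * hs
      · rw [show ((k + 1 : ℕ) : ℤ) + 1 = k + 2 by push_cast; ring, Polynomial.Chebyshev.C_add_two]
        simp only [Polynomial.eval_sub, Polynomial.eval_mul, Polynomial.eval_X, e2, e4]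
        push_cast
        linear_combination y' * ht
  obtain ⟨⟨x, y, e1, e2⟩, -⟩ := key (2 * q.den)
  have e3 : (Polynomial.Chebyshev.C ℝ ((2 * q.den : ℕ) : ℤ)).eval s = 2 := by
    rw [hq, Polynomial.Chebyshev.C_two_mul_real_cos]
    have : (((2 * q.den : ℕ) : ℤ) : ℝ) * (q * π) = (q.num : ℝ) * (2 * π) := by
      have : (q : ℝ) = q.num / q.den := by exact_mod_cast (Rat.num_div_den q).symm
      rw [this]
      have : (q.den : ℝ) ≠ 0 := by exact_mod_cast q.den_nz
      push_cast
      field_simp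
    rw [this, Real.cos_int_mul_two_pi]
    norm_num
  obtain ⟨hx, hy⟩ := lin_irr hirr (u := x - 2) (v := y) (by push_cast; linarith)
  have hy : (y : ℝ) = 0 := by exact_mod_cast hy
  have hx : (x : ℝ) = 2 := by
    have : ((x : ℚ) : ℝ) = ((2 : ℚ) : ℝ) := by congr 1; linarith
    exact_mod_cast this
  rw [hx, hy] at e2
  by_contra hc
  push Not at hc
  have := Polynomial.Chebyshev.one_lt_abs_eval_T_real (n := ((2 * q.den : ℕ) : ℤ))
    (by have := q.den_nz; omega) (x := t / 2) (by rw [abs_div, abs_two]; linarith)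
  have h2 := congrArg (Polynomial.eval (t / 2)) (Polynomial.Chebyshev.C_comp_two_mul_X ℝ ((2 * q.den : ℕ) : ℤ))
  simp only [Polynomial.eval_comp, Polynomial.eval_mul, Polynomial.eval_X, Polynomial.eval_ofNat] at h2
  rw [show 2 * (t / 2) = t by ring, e2] at h2
  rw [show Polynomial.eval (t / 2) (Polynomial.Chebyshev.T ℝ ((2 * q.den : ℕ) : ℤ)) = 1 by linarith] at this
  simp at this

lemma golden {s : ℝ} (h0 : 0 < s) (h1 : s < 1) {q : ℚ} (hq : s = 2 * cos (q * π)) {x y z : ℚ}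
    (e : (x : ℝ) + y * s + z * s ^ 2 = 0) : (x = 0 ∧ y = 0 ∧ z = 0) ∨ s ^ 2 = 1 - s := by
  have hi : IsIntegral ℤ s := hq ▸ Real.isIntegral_two_mul_cos_rat_mul_pi q
  have hirr := irr_of hi h0 h1
  by_cases hz : z = 0
  · subst hz
    have := lin_irr hirr (u := x) (v := y) (by simpa using e)
    exact Or.inl ⟨this.1, this.2, rfl⟩
  right
  obtain ⟨m, n, hm⟩ := quad_int hi hirr hz e
  have hb := conj_bound hirr hm (t := m - s) (by linear_combination hm) hq
  rw [abs_le] at hb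
  have hn1 : n < 2 := by
    have : (n : ℝ) < 2 := by nlinarith
    exact_mod_cast this
  have hn2 : -2 < n := by
    have : (-2 : ℝ) < n := by nlinarith
    exact_mod_cast this
  have hm1 : m < 3 := by
    have : (m : ℝ) < 3 := by linarith
    exact_mod_cast this
  have hm2 : -2 < m := by
    have : (-2 : ℝ) < m := by linarith
    exact_mod_cast this
  interval_cases n <;> interval_cases m <;> norm_num at hm <;> first | (rcases hm with hm | hm <;> linarith) | linarith | (exfalso; nlinarith)
end

section

/-- trigonometric data of the tile -/
structure Tr (α β s F : ℝ) : Prop where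
  ap : 0 < α
  bp : 0 < β
  hpi : π = 3 * α + 2 * β
  hs : s = 2 * cos (α + β)
  hF : F = sin (α + β)
  rat : ∃ q : ℚ, α = q * π

section
variable {α β s F : ℝ}

lemma Tr.F0 (T : Tr α β s F) : 0 < F := by
  rw [T.hF]; exact sin_pos_of_pos_of_lt_pi (by linarith [T.ap, T.bp]) (by linarith [T.ap, T.bp, T.hpi])

lemma Tr.FF (T : Tr α β s F) : F ^ 2 = 1 - s ^ 2 / 4 := by
  rw [T.hF, T.hs]; nlinarith [sin_sq_add_cos_sq (α + β)]

lemma Tr.sa (T : Tr α β s F) : sin α = s * F := by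
  rw [show α = π - 2 * (α + β) by linarith [T.hpi], sin_pi_sub, sin_two_mul, T.hs, T.hF]
  ring

lemma Tr.sb (T : Tr α β s F) : sin β = (1 - s ^ 2) * F := by
  have : β = 3 * (α + β) - π := by linarith [T.hpi]
  have h2 := T.FF
  have e : sin β = - sin (3 * (α + β)) := by
    conv_lhs => rw [this]
    rw [sin_sub_pi]
  rw [e, sin_three_mul, ← T.hF]
  linear_combination 4 * F * h2

lemma Tr.ca (T : Tr α β s F) : cos α = 1 - s ^ 2 / 2 := by
  rw [show α = π - 2 * (α + β) by linarith [T.hpi], cos_pi_sub, cos_two_mul, T.hs]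
  ring

lemma Tr.cb (T : Tr α β s F) : cos β = (3 * s - s ^ 3) / 2 := by
  have : β = 3 * (α + β) - π := by linarith [T.hpi]
  have e : cos β = - cos (3 * (α + β)) := by
    conv_lhs => rw [this]
    rw [cos_sub_pi]
  rw [e, cos_three_mul, T.hs]
  ring

lemma Tr.sc (T : Tr α β s F) : sin (2 * α + β) = F := by
  rw [show 2 * α + β = π - (α + β) by linarith [T.hpi], sin_pi_sub, T.hF]

lemma Tr.s0 (T : Tr α β s F) : 0 < s := by
  have := T.sa
  have h : 0 < sin α := sin_pos_of_pos_of_lt_pi T.ap (by linarith [T.ap, T.bp, T.hpi])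
  rw [this] at h
  exact pos_of_mul_pos_left h T.F0.le

lemma Tr.ss (T : Tr α β s F) : 0 < 1 - s ^ 2 := by
  have := T.sb
  have h : 0 < sin β := sin_pos_of_pos_of_lt_pi T.bp (by linarith [T.ap, T.bp, T.hpi])
  rw [this] at h
  exact pos_of_mul_pos_left h T.F0.le

lemma Tr.s1 (T : Tr α β s F) : s < 1 := by nlinarith [T.ss, T.s0]

lemma Tr.s2a (T : Tr α β s F) : sin (2 * α) = s * (2 - s ^ 2) * F := by
  rw [sin_two_mul, T.sa, T.ca]; ring

lemma Tr.q (T : Tr α β s F) : ∃ q : ℚ, s = 2 * cos (q * π) := by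
  obtain ⟨q, hq⟩ := T.rat
  refine ⟨(1 - q) / 2, ?_⟩
  rw [T.hs]
  congr 2
  push_cast
  linarith [T.hpi]

lemma Tr.int (T : Tr α β s F) : IsIntegral ℤ s := by
  obtain ⟨q, hq⟩ := T.q
  exact hq ▸ Real.isIntegral_two_mul_cos_rat_mul_pi q

lemma Tr.irr (T : Tr α β s F) {x y : ℤ} (h : (x : ℝ) + y * s = 0) : x = 0 ∧ y = 0 := by
  have := lin_irr (irr_of T.int T.s0 T.s1) (u := x) (v := y) (by exact_mod_cast h)
  exact_mod_cast this

lemma Tr.irr2 (T : Tr α β s F) {x y : ℤ} (h : (x : ℝ) + y * s ^ 2 = 0) : x = 0 ∧ y = 0 := by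
  have := lin_irr (irr_of (T.int.pow 2) (by have := T.s0; positivity) (by linarith [T.ss])) (u := x) (v := y)
    (by exact_mod_cast h)
  exact_mod_cast this

lemma Tr.ne (T : Tr α β s F) (h : α ≠ β) : s ^ 2 ≠ 1 - s := by
  intro e
  apply h
  have h1 : sin α = sin β := by rw [T.sa, T.sb, e]; ring
  exact Real.injOn_sin (by constructor <;> linarith [T.ap, T.bp, T.hpi])
    (by constructor <;> linarith [T.ap, T.bp, T.hpi]) h1

lemma Tr.indq (T : Tr α β s F) (h : α ≠ β) {x y z : ℚ} (e : (x : ℝ) + y * s + z * s ^ 2 = 0) :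
    x = 0 ∧ y = 0 ∧ z = 0 := by
  obtain ⟨q, hq⟩ := T.q
  exact (golden T.s0 T.s1 hq e).resolve_right (T.ne h)

lemma Tr.ind (T : Tr α β s F) (h : α ≠ β) {x y z : ℤ} (e : (x : ℝ) + y * s + z * s ^ 2 = 0) :
    x = 0 ∧ y = 0 ∧ z = 0 := by
  have := T.indq h (x := x) (y := y) (z := z) (by exact_mod_cast e)
  exact_mod_cast this

lemma nosq {d : ℕ} (hd : ¬ IsSquare d) {k q : ℤ} (h : k ^ 2 = d * q ^ 2) : q = 0 := by
  by_contra hq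
  apply hd
  rw [← Rat.isSquare_natCast_iff]
  refine ⟨(k : ℚ) / q, ?_⟩
  have : (q : ℚ) ≠ 0 := by exact_mod_cast hq
  field_simp
  have : ((k ^ 2 : ℤ) : ℚ) = ((d * q ^ 2 : ℤ) : ℚ) := by rw [h]
  push_cast at this
  linarith

lemma sq3 {p q r : ℤ} (h : p ^ 2 + q ^ 2 + r ^ 2 = 0) : p = 0 ∧ q = 0 ∧ r = 0 := by
  refine ⟨?_, ?_, ?_⟩ <;> apply pow_eq_zero_iff (two_ne_zero) |>.mp <;> nlinarith [sq_nonneg p, sq_nonneg q, sq_nonneg r]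

/-- leg length -/
def Ylen (s : ℝ) (p q r : ℕ) : ℝ := p * s + q * (1 - s ^ 2) + r

lemma no_fam2 (T : Tr α β s F) {r M : ℕ} (h : Ylen s 0 0 r ^ 2 * sin α = M * (s * (1 - s ^ 2) * F))
    (hr : 0 < Ylen s 0 0 r) : False := by
  rw [T.sa] at h
  have h1 : Ylen s 0 0 r ^ 2 = M * (1 - s ^ 2) := by
    apply mul_right_cancel₀ (mul_pos T.s0 T.F0).ne'
    linear_combination h
  simp only [Ylen] at h1 hr
  obtain ⟨a, b⟩ := T.irr2 (x := r ^ 2 - M) (y := M) (by push_cast; push_cast at h1; linear_combination h1)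
  have : r = 0 := by
    have : (r : ℤ) ^ 2 = 0 := by linarith
    exact_mod_cast pow_eq_zero_iff two_ne_zero |>.mp this
  subst this
  simp at hr

lemma no_2a (T : Tr α β s F) {p q r M : ℕ} (h : Ylen s p q r ^ 2 * sin (2 * α) = M * (s * (1 - s ^ 2) * F)) :
    Ylen s p q r ^ 2 * (2 - s ^ 2) = M * (1 - s ^ 2) := by
  rw [T.s2a] at h
  apply mul_right_cancel₀ (mul_pos T.s0 T.F0).ne'
  linear_combination h

lemma no_a (T : Tr α β s F) {p q r M : ℕ} (h : Ylen s p q r ^ 2 * sin α = M * (s * (1 - s ^ 2) * F)) :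
    Ylen s p q r ^ 2 = M * (1 - s ^ 2) := by
  rw [T.sa] at h
  apply mul_right_cancel₀ (mul_pos T.s0 T.F0).ne'
  linear_combination h

lemma no_b (T : Tr α β s F) {p q r M : ℕ} (h : Ylen s p q r ^ 2 * sin β = M * (s * (1 - s ^ 2) * F)) :
    Ylen s p q r ^ 2 = M * s := by
  rw [T.sb] at h
  apply mul_right_cancel₀ (mul_pos T.ss T.F0).ne'
  linear_combination h

lemma no_c (T : Tr α β s F) {p q r M : ℕ} (h : Ylen s p q r ^ 2 * F = M * (s * (1 - s ^ 2) * F)) :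
    Ylen s p q r ^ 2 = M * (s * (1 - s ^ 2)) := by
  apply mul_right_cancel₀ (T.F0).ne'
  linear_combination h

lemma no_fam3 (T : Tr α β s F) {r M : ℕ} (h : Ylen s 0 0 r ^ 2 * sin (2 * α) = M * (s * (1 - s ^ 2) * F))
    (hr : 0 < Ylen s 0 0 r) : False := by
  have h1 := no_2a T h
  simp only [Ylen] at h1 hr
  obtain ⟨a, b⟩ := T.irr2 (x := 2 * r ^ 2 - M) (y := M - r ^ 2) (by push_cast; push_cast at h1; linear_combination h1)
  have : r = 0 := by
    have : (r : ℤ) ^ 2 = 0 := by linarith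
    exact_mod_cast pow_eq_zero_iff two_ne_zero |>.mp this
  subst this
  simp at hr

lemma y0 {p q r : ℕ} (hr : 0 < Ylen s p q r) (hp : (p : ℤ) = 0) (hq : (q : ℤ) = 0) (h : (r : ℤ) = 0) : False := by
  have hp : p = 0 := by exact_mod_cast hp
  have hq : q = 0 := by exact_mod_cast hq
  have h : r = 0 := by exact_mod_cast h
  subst hp hq h
  simp [Ylen] at hr

lemma no_11 (T : Tr α β s F) {p q r M : ℕ} (h : Ylen s p q r ^ 2 * sin α = M * (s * (1 - s ^ 2) * F))
    (hr : 0 < Ylen s p q r) (hab : α = β) : False := by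
  have h1 := no_a T h
  have hs : s ^ 2 = 1 - s := by
    have := T.sa
    rw [hab, T.sb] at this
    have := mul_right_cancel₀ T.F0.ne' this
    linarith
  simp only [Ylen] at h1
  obtain ⟨a, b⟩ := T.irr (x := (p + q) ^ 2 + r ^ 2) (y := 2 * (p + q) * r - (p + q) ^ 2 - M)
    (by
      push_cast
      rw [show 1 - s ^ 2 = s by linarith] at h1
      linear_combination h1 - (p + q) ^ 2 * hs)
  have h0 := sq3 (p := p + q) (q := r) (r := 0) (by linarith)
  exact y0 hr (by omega) (by omega) h0.2.1

lemma no_12 (T : Tr α β s F) {p q r M : ℕ} (x : ℝ) (h : Ylen s p q r ^ 2 * sin x = M * (s * (1 - s ^ 2) * F))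
    (hx : x = α ∨ x = α + 2 * β ∨ x = α + β)
    (hr : 0 < Ylen s p q r) (hab : β = 2 * α) : False := by
  have hne : α ≠ β := by linarith [T.ap]
  have s3 : s ^ 3 = s ^ 2 + 2 * s - 1 := by
    have := T.sb
    rw [hab, T.s2a] at this
    have := mul_right_cancel₀ T.F0.ne' this
    linarith
  have s4 : s ^ 4 = 3 * s ^ 2 + s - 1 := by linear_combination (s + 1) * s3
  have key : ∀ u v w : ℤ, Ylen s p q r ^ 2 = u + v * s + w * s ^ 2 → u + w = 0 → False := by
    intro u v w e e0
    simp only [Ylen] at e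
    obtain ⟨a, b, c⟩ := T.ind hne (x := r ^ 2 + 2 * q * r + 2 * p * q - u)
      (y := 2 * p * r - 2 * p * q + q ^ 2 - v) (z := p ^ 2 + q ^ 2 - 2 * q * r - 2 * p * q - w)
      (by push_cast; linear_combination e + 2 * p * q * s3 - q ^ 2 * s4)
    obtain ⟨x, y, z⟩ := sq3 (p := p) (q := q) (r := r) (by linarith)
    exact y0 hr x y z
  rcases hx with rfl | rfl | rfl
  · have h1 := no_a T h
    exact key M 0 (-M) (by rw [h1]; push_cast; ring) (by ring)
  · rw [show α + 2 * β = π - β by linarith [T.hpi], sin_pi_sub] at h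
    have h1 := no_b T h
    exact key 0 M 0 (by rw [h1]; push_cast; ring) (by ring)
  · rw [← T.hF] at h
    have h1 := no_c T h
    exact key M (-M) (-M) (by rw [h1]; push_cast; linear_combination (-(M : ℝ)) * s3) (by ring)

lemma s3_13 (T : Tr α β s F) (hab : β = 3 * α) : s ^ 3 = 3 * s - 1 := by
  have h1 := T.sb
  have e : β = 2 * α + α := by linarith
  rw [e, sin_add, T.s2a, T.sa, T.ca, cos_two_mul, T.ca] at h1
  apply mul_right_cancel₀ (mul_pos T.ss T.F0).ne'
  linear_combination -h1

lemma no_13a (T : Tr α β s F) {p q M : ℕ} (h : Ylen s p q 0 ^ 2 * F = M * (s * (1 - s ^ 2) * F))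
    (hr : 0 < Ylen s p q 0) (hab : β = 3 * α) : False := by
  have hne : α ≠ β := by linarith [T.ap]
  have s3 := s3_13 T hab
  have s4 : s ^ 4 = 3 * s ^ 2 - s := by linear_combination s * s3
  have h1 := no_c T h
  simp only [Ylen] at h1
  obtain ⟨a, b, c⟩ := T.ind hne (x := q ^ 2 + 2 * p * q - M) (y := 2 * p * q - 6 * p * q - q ^ 2 + 2 * M)
    (z := p ^ 2 + q ^ 2) (by push_cast; push_cast at h1; linear_combination h1 + (2 * p * q - M) * s3 - q ^ 2 * s4)
  obtain ⟨x, y, z⟩ := sq3 (p := p) (q := q) (r := 0) (by linarith)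
  exact y0 hr x y (by simp)

lemma no_13b (T : Tr α β s F) {p q r M : ℕ} (h : Ylen s p q r ^ 2 * sin β = M * (s * (1 - s ^ 2) * F))
    (hr : 0 < Ylen s p q r) (hab : β = 3 * α) : False := by
  have hne : α ≠ β := by linarith [T.ap]
  have s3 := s3_13 T hab
  have s4 : s ^ 4 = 3 * s ^ 2 - s := by linear_combination s * s3
  have h1 := no_b T h
  simp only [Ylen] at h1
  obtain ⟨a, b, c⟩ := T.ind hne (x := (q + r) ^ 2 + 2 * p * q) (y := 2 * p * (q + r) - 6 * p * q - q ^ 2 - M)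
    (z := p ^ 2 - 2 * q * (q + r) + 3 * q ^ 2) (by push_cast; linear_combination h1 + 2 * p * q * s3 - q ^ 2 * s4)
  have hk : ((q + r : ℕ) : ℤ) ^ 2 = 0 := by
    have : (0 : ℤ) ≤ 2 * p * q := by positivity
    push_cast
    nlinarith [sq_nonneg ((q : ℤ) + r)]
  have hk := pow_eq_zero_iff two_ne_zero |>.mp hk
  have hq : q = 0 := by omega
  have hr' : r = 0 := by omega
  subst hq hr'
  have : (p : ℤ) ^ 2 = 0 := by simpa using c
  exact y0 hr (pow_eq_zero_iff two_ne_zero |>.mp this) (by simp) (by simp)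

lemma s4_21 (T : Tr α β s F) (hab : α = 2 * β) : s ^ 4 = 4 * s ^ 2 - 2 := by
  have h1 := T.sa
  rw [hab, sin_two_mul, T.sb, T.cb] at h1
  apply mul_right_cancel₀ (mul_pos T.s0 T.F0).ne'
  linear_combination h1

lemma no_21a (T : Tr α β s F) {p q M : ℕ} (h : Ylen s p q 0 ^ 2 * sin α = M * (s * (1 - s ^ 2) * F))
    (hr : 0 < Ylen s p q 0) (hab : α = 2 * β) : False := by
  have hne : α ≠ β := by linarith [T.bp]
  have s4 := s4_21 T hab
  have h1 := no_a T h
  have h2 : Ylen s p q 0 ^ 2 * (3 - s ^ 2) = M := by linear_combination (3 - s ^ 2) * h1 + M * s4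
  simp only [Ylen] at h2
  obtain ⟨a, b, c⟩ := T.ind hne (x := 2 * p ^ 2 + q ^ 2 - M) (y := 2 * p * q) (z := - p ^ 2 - q ^ 2)
    (by push_cast; push_cast at h2; linear_combination h2 + (p ^ 2 - q ^ 2 * (1 - s ^ 2) - 2 * p * q * s) * s4)
  obtain ⟨x, y, z⟩ := sq3 (p := p) (q := q) (r := 0) (by linarith)
  exact y0 hr x y (by simp)

lemma no_21b (T : Tr α β s F) {q r M : ℕ} (h : Ylen s 0 q r ^ 2 * sin (2 * α) = M * (s * (1 - s ^ 2) * F))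
    (hr : 0 < Ylen s 0 q r) (hab : α = 2 * β) : False := by
  have s4 := s4_21 T hab
  have h1 := no_2a T h
  have s6 : s ^ 6 = 14 * s ^ 2 - 8 := by linear_combination (s ^ 2 + 4) * s4
  simp only [Ylen] at h1
  obtain ⟨a, b⟩ := T.irr2 (x := 2 * (q + r) ^ 2 + 4 * q ^ 2 - 4 * q * (q + r) - M)
    (y := -6 * q ^ 2 + 4 * q * (q + r) - (q + r) ^ 2 + M)
    (by
      push_cast
      push_cast at h1
      linear_combination h1 + q ^ 2 * s6 - (2 * q ^ 2 + 2 * q * (q + r)) * s4)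
  have hq := nosq (d := 2) (by decide +kernel) (k := q + r) (q := q) (by push_cast; linarith)
  rw [hq] at a b
  have h0 := sq3 (p := r) (q := 0) (r := 0) (by linarith)
  exact y0 hr (by simp) hq h0.1

lemma no_23 (T : Tr α β s F) {q r M : ℕ} (h : Ylen s 0 q r ^ 2 * sin (2 * α) = M * (s * (1 - s ^ 2) * F))
    (hr : 0 < Ylen s 0 q r) (hab : 3 * α = 2 * β) : False := by
  have s4 : s ^ 4 = 4 * s ^ 2 - 1 := by
    have h1 := T.ca
    rw [show α = π / 6 by linarith [T.hpi], cos_pi_div_six] at h1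
    have : √3 ^ 2 = 3 := Real.sq_sqrt (by norm_num)
    have h2 : √3 = 2 - s ^ 2 := by linarith
    rw [h2] at this
    linarith
  have h1 := no_2a T h
  have s6 : s ^ 6 = 15 * s ^ 2 - 4 := by linear_combination (s ^ 2 + 4) * s4
  simp only [Ylen] at h1
  obtain ⟨a, b⟩ := T.irr2 (x := 2 * ((q + r) ^ 2 - q ^ 2) + (4 * q ^ 2 - 2 * q * (q + r)) - M)
    (y := -((q + r) ^ 2 - q ^ 2) - 2 * (4 * q ^ 2 - 2 * q * (q + r)) + M)
    (by
      push_cast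
      push_cast at h1
      linear_combination h1 + q ^ 2 * s6 - (2 * q ^ 2 + 2 * q * (q + r)) * s4)
  have hq := nosq (d := 6) (by decide +kernel) (k := q + r + q) (q := q) (by push_cast; linarith)
  rw [hq] at a b
  have h0 := sq3 (p := r) (q := 0) (r := 0) (by linarith)
  exact y0 hr (by simp) hq h0.1

lemma no_14a (T : Tr α β s F) {q M : ℕ} (h : Ylen s 0 q 0 ^ 2 * F = M * (s * (1 - s ^ 2) * F))
    (hr : 0 < Ylen s 0 q 0) (hab : β = 4 * α) : False := by
  have hne : α ≠ β := by linarith [T.ap]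
  have h1 := no_c T h
  simp only [Ylen] at h1
  have h2 : (q : ℝ) ^ 2 * (1 - s ^ 2) = M * s := by
    apply mul_right_cancel₀ T.ss.ne'
    push_cast at h1
    linear_combination h1
  obtain ⟨a, b, c⟩ := T.ind hne (x := q ^ 2) (y := - M) (z := - q ^ 2) (by push_cast; linear_combination h2)
  exact y0 hr (by simp) (pow_eq_zero_iff two_ne_zero |>.mp a) (by simp)

lemma no_14b (T : Tr α β s F) {p q r M : ℕ}
    (h : Ylen s 0 0 r * Ylen s p q 0 * sin β = M * (s * (1 - s ^ 2) * F))
    (hr : 0 < Ylen s 0 0 r) (hab : β = 4 * α) : q = 0 := by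
  have hne : α ≠ β := by linarith [T.ap]
  rw [T.sb] at h
  have h1 : Ylen s 0 0 r * Ylen s p q 0 = M * s := by
    apply mul_right_cancel₀ (mul_pos T.ss T.F0).ne'
    linear_combination h
  simp only [Ylen] at h1 hr
  obtain ⟨a, b, c⟩ := T.ind hne (x := r * q) (y := r * p - M) (z := - (r * q))
    (by push_cast; push_cast at h1; linear_combination h1)
  have : r ≠ 0 := by rintro rfl; simp at hr
  have : r * q = 0 := by exact_mod_cast a
  rcases Nat.mul_eq_zero.mp this with h | h
  · contradiction
  · exact h

lemma s4_16 (T : Tr α β s F) (hab : β = 6 * α) : s ^ 4 = - s ^ 3 + 4 * s ^ 2 + 4 * s - 1 := by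
  have h1 : cos (β - α) = 1 / 2 := by rw [show β - α = π / 3 by linarith [T.hpi], cos_pi_div_three]
  rw [cos_sub, T.ca, T.cb, T.sa, T.sb] at h1
  have := T.FF
  apply mul_right_cancel₀ (show s - 1 ≠ 0 by linarith [T.s1])
  linear_combination 2 * h1 - 2 * s * (1 - s ^ 2) * this

lemma no_rat4 (w : ℚ) (h : w ^ 4 - w ^ 3 - 4 * w ^ 2 + 4 * w + 1 = 0) : False := by
  have hi : IsIntegral ℤ w := by
    refine ⟨Polynomial.X ^ 4 - Polynomial.X ^ 3 - 4 * Polynomial.X ^ 2 + 4 * Polynomial.X + 1, ?_, ?_⟩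
    · monicity!
    · simpa using h
  obtain ⟨k, rfl⟩ := IsIntegrallyClosed.algebraMap_eq_of_integral hi
  simp only [eq_intCast] at h
  have h : k ^ 4 - k ^ 3 - 4 * k ^ 2 + 4 * k + 1 = 0 := by exact_mod_cast h
  have hd : k ∣ 1 := ⟨-(k ^ 3 - k ^ 2 - 4 * k + 4), by linarith⟩
  rcases Int.isUnit_iff.mp (isUnit_of_dvd_one hd) with rfl | rfl <;> norm_num at h

lemma ind4 (T : Tr α β s F) (hab : β = 6 * α) {x y z w : ℤ}
    (e : (x : ℝ) + y * s + z * s ^ 2 + w * s ^ 3 = 0) : x = 0 ∧ y = 0 ∧ z = 0 ∧ w = 0 := by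
  have hne : α ≠ β := by linarith [T.ap]
  have s4 := s4_16 T hab
  by_cases hw : w = 0
  · subst hw
    obtain ⟨a, b, c⟩ := T.ind hne (x := x) (y := y) (z := z) (by simpa using e)
    exact ⟨a, b, c, rfl⟩
  exfalso
  have hw' : (w : ℝ) ≠ 0 := by exact_mod_cast hw
  obtain ⟨X, hX⟩ : ∃ X : ℚ, X = - x / w := ⟨_, rfl⟩
  obtain ⟨Y, hY⟩ : ∃ X : ℚ, X = - y / w := ⟨_, rfl⟩
  obtain ⟨Z, hZ⟩ : ∃ X : ℚ, X = - z / w := ⟨_, rfl⟩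
  have s3 : s ^ 3 = X + Y * s + Z * s ^ 2 := by
    rw [hX, hY, hZ]
    push_cast
    field_simp
    linarith
  obtain ⟨a, b, c⟩ := T.indq hne (x := Z * X + X + 1) (y := X + Y * Z + Y - 4) (z := Y + Z ^ 2 + Z - 4)
    (by push_cast; linear_combination s4 - (s + Z + 1) * s3)
  apply no_rat4 (Z + 1)
  linear_combination -(Z + 1) * b + a + (Z + 1) ^ 2 * c

lemma no_16 (T : Tr α β s F) {p q M : ℕ} (h : Ylen s p q 0 ^ 2 * sin (β - α) = M * (s * (1 - s ^ 2) * F))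
    (hr : 0 < Ylen s p q 0) (hab : β = 6 * α) : False := by
  have s4 := s4_16 T hab
  have h1 : Ylen s p q 0 ^ 2 * (4 + s - s ^ 2) = M * (1 - s ^ 2) := by
    rw [sin_sub, T.ca, T.cb, T.sa, T.sb] at h
    apply mul_right_cancel₀ (mul_pos T.s0 T.F0).ne'
    linear_combination h - F * Ylen s p q 0 ^ 2 * s4
  obtain ⟨X0, e0⟩ : ∃ X0 : ℤ, X0 = 2 * p * q + 4 * q ^ 2 := ⟨_, rfl⟩
  obtain ⟨X1, e1⟩ : ∃ X0 : ℤ, X0 = p ^ 2 + 2 * q ^ 2 := ⟨_, rfl⟩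
  obtain ⟨X2, e2⟩ : ∃ X0 : ℤ, X0 = - 2 * p * q - q ^ 2 := ⟨_, rfl⟩
  have hY : Ylen s p q 0 ^ 2 = s * (X0 + X1 * s + X2 * s ^ 2) := by
    rw [e0, e1, e2]
    simp only [Ylen]
    push_cast
    linear_combination q ^ 2 * s4
  have s5 : s ^ 5 = - s ^ 4 + 4 * s ^ 3 + 4 * s ^ 2 - s := by linear_combination s * s4
  rw [hY] at h1
  obtain ⟨a, b, c, d⟩ := ind4 T hab (x := X1 - 2 * X2 - M) (y := 4 * X0 + 9 * X2 - 4 * X1) (z := X0 + 4 * X2 + M)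
    (w := 2 * X1 - X0 - 2 * X2)
    (by push_cast; linear_combination h1 + X2 * s5 - (2 * X2 - X1) * s4)
  have : ((p : ℤ) - q) ^ 2 + q ^ 2 + q ^ 2 + q ^ 2 = 0 := by linarith
  have hq := sq3 (p := p - q) (q := q) (r := 0) (by nlinarith [sq_nonneg (q : ℤ), sq_nonneg ((p : ℤ) - q)])
  exact y0 hr (by omega) (by omega) (by simp)
end
end

section

lemma dual_exists {n : ℕ} (e : Fin n → ℝ) (h : LinearIndependent ℚ e) :
    ∃ d : Fin n → ℝ →+ ℝ, ∀ t k, d t (e k) = if t = k then 1 else 0 := by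
  have : ∀ t, ∃ d : ℝ →+ ℝ, ∀ k, d (e k) = if t = k then 1 else 0 := by
    intro t
    obtain ⟨f, hf⟩ := LinearMap.exists_extend ((Module.Basis.span h).constr ℚ (fun k => if t = k then (1 : ℝ) else 0))
    refine ⟨f.toAddMonoidHom, fun k => ?_⟩
    have := LinearMap.congr_fun hf (Module.Basis.span h k)
    rw [Module.Basis.constr_basis] at this
    simp only [LinearMap.comp_apply, Submodule.subtype_apply, Module.Basis.span_apply] at this
    exact this
  choose d hd using this
  exact ⟨d, hd⟩

section
variable {N : ℕ} {P : Fin N → Fin 3 → ℂ} {Q : Fin 3 → ℂ} {l th : Fin 3 → ℝ} {α β s F : ℝ}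

lemma Tr.ths (T : Tr α β s F) (h0 : th 0 = α) (h1 : th 1 = β) (h2 : th 2 = 2 * α + β) : Ths α β th :=
  ⟨h0, h1, h2, T.hpi, T.ap, T.bp⟩

lemma exists_dat (H : Til P Q) (len : ∀ i k, ‖ed (P i) k‖ = l k) (an : ∀ i k, ang (P i) k = th k)
    (T : Tr α β s F) (h0 : th 0 = α) (h1 : th 1 = β) (h2 : th 2 = 2 * α + β) {ρ : ℝ} (hρ : 0 < ρ)
    (l0 : l 0 = ρ * s) (l1 : l 1 = ρ * (1 - s ^ 2)) (l2 : l 2 = ρ) : ∃ g, Dat P Q l th g := by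
  have thp : ∀ k, 0 < th k := by
    intro k; have := T.ap; have := T.bp
    fin_cases k <;> simp [h0, h1, h2] <;> linarith
  have thl : ∀ k, th k < π := by
    intro k; have := T.ap; have := T.bp; have := T.hpi
    fin_cases k <;> simp [h0, h1, h2] <;> linarith
  by_cases hab : α = β
  · have hs : s ^ 2 = 1 - s := by
      have := T.sa
      rw [hab, T.sb] at this
      have := mul_right_cancel₀ T.F0.ne' this
      linarith
    have hl : LinearIndependent ℚ ![ρ * s, ρ] := by
      rw [Fintype.linearIndependent_iff]
      intro c hc
      simp [Fin.sum_univ_succ, Rat.smul_def] at hc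
      have : (c 1 : ℝ) + c 0 * s = 0 := by
        apply mul_right_cancel₀ hρ.ne'
        linarith
      obtain ⟨x, y⟩ := lin_irr (irr_of T.int T.s0 T.s1) this
      intro i
      fin_cases i <;> assumption
    obtain ⟨d, hd⟩ := dual_exists _ hl
    have l1' : l 1 = ρ * s := by rw [l1, hs]; ring
    have d00 : d 0 (ρ * s) = 1 := by simpa using hd 0 0
    have d01 : d 0 ρ = 0 := by simpa using hd 0 1
    have d10 : d 1 (ρ * s) = 0 := by simpa using hd 1 0
    have d11 : d 1 ρ = 1 := by simpa using hd 1 1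
    refine ⟨![d 0, 0, d 1], H, len, an, thp, thl, ?_, ?_⟩
    · intro t k
      fin_cases t <;> fin_cases k <;> simp [l0, l1', l2, d00, d01, d10, d11]
    · intro k f
      fin_cases k <;> simp [Fin.sum_univ_succ, l0, l1', l2, d00, d01, d10, d11, h0, h1, hab]
  · have hl : LinearIndependent ℚ ![ρ * s, ρ * (1 - s ^ 2), ρ] := by
      rw [Fintype.linearIndependent_iff]
      intro c hc
      simp [Fin.sum_univ_succ, Rat.smul_def] at hc
      have : ((c 1 + c 2 : ℚ) : ℝ) + c 0 * s + (- c 1 : ℚ) * s ^ 2 = 0 := by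
        apply mul_right_cancel₀ hρ.ne'
        push_cast
        linarith
      obtain ⟨x, y, z⟩ := T.indq hab this
      intro i
      fin_cases i
      · exact y
      · show c 1 = 0
        linarith
      · show c 2 = 0
        linarith
    obtain ⟨d, hd⟩ := dual_exists _ hl
    have hd' : ∀ t k, d t (l k) = if t = k then 1 else 0 := by
      intro t k
      rw [← hd]
      congr 1
      fin_cases k <;> simp [l0, l1, l2]
    refine ⟨d, H, len, an, thp, thl, ?_, ?_⟩
    · intro t k
      rw [hd']; split_ifs <;> simp
    · intro k f
      simp [hd']

end
end

section

lemma dec {α β Θ : ℝ} {a b A : ℕ} (C : Cod α β a b) (L : Lk α β a b Θ A) (i k : ℤ) (hi : |i| ≤ 10) (hk : |k| ≤ 10)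
    (e : (A : ℤ) = i * a + k * b) : Θ = i * α + k * β := by
  obtain ⟨_, p1, p2, c1, c2, c3, c4, e1, e2⟩ := L
  rw [abs_le] at hi hk
  have := C.bw (p1 - i) (p2 - k) (by rw [abs_le]; omega) (by rw [abs_le]; omega) (by linarith)
  push_cast at this
  rw [e1]
  linarith

section
variable {N : ℕ} {P : Fin N → Fin 3 → ℂ} {Q : Fin 3 → ℂ} {l th : Fin 3 → ℝ} {α β s F : ℝ} {g : Fin 3 → ℝ →+ ℝ}

lemma kill (D : Dat P Q l th g) (T : Tr α β s F) (h0 : th 0 = α) (h1 : th 1 = β) (h2 : th 2 = 2 * α + β)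
    {ρ : ℝ} (hρ : 0 < ρ) (l0 : l 0 = ρ * s) (l1 : l 1 = ρ * (1 - s ^ 2)) (l2 : l 2 = ρ)
    {f : ℝ → ℝ} (hf : ∀ j, l j = f (th j)) {a b : ℕ} {A S : Fin 3 → ℕ} (O : Oc Q th g α β a b A S)
    (j : Fin 3) (hk : kindB a b (A j) (A (j + 1)) (A (j + 2)) (S j) (S (j + 1)) = true) : False := by
  have C := O.cod
  have hd := D.til.hQ
  have j21 : j + 2 + 1 = j := by omega
  have j22 : j + 2 + 2 = j + 1 := by omega
  have j11 : j + 1 + 1 = j + 2 := by omega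
  have j12 : j + 1 + 2 = j := by omega
  have hA : A (j + 1) = A (j + 2) := by
    simp only [kindB, Bool.and_eq_true] at hk
    exact Nat.eq_of_beq_eq_true hk.1
  have hΘ : ang Q (j + 1) = ang Q (j + 2) := by
    obtain ⟨_, p1, p2, c1, c2, c3, c4, e1, e2⟩ := O.lk (j + 2)
    rw [e1]
    exact dec C (O.lk (j + 1)) p1 p2 (by rw [abs_le]; omega) (by rw [abs_le]; omega) (by rw [hA, e2])
  have a0 := dt_sin hd j
  have a1 := dt_sin hd (j + 1)
  have a2 := dt_sin hd (j + 2)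
  rw [j11, j12] at a1
  rw [j21, j22] at a2
  have hleg : ‖ed Q (j + 1)‖ = ‖ed Q (j + 2)‖ := by
    rw [a1, hΘ] at a2
    have := mul_right_cancel₀ (ang_sin_pos hd (j + 2)).ne' a2
    rw [mul_comm] at this
    exact (mul_left_cancel₀ (norm_ed_pos hd j).ne' this).symm
  have area : |dt Q| = N * (ρ ^ 2 * (s * (1 - s ^ 2) * F)) := by
    rw [← area_lemma D.til, Finset.sum_congr rfl (g := fun _ => ρ ^ 2 * (s * (1 - s ^ 2) * F))]
    · simp
    · intro i _
      rw [dt_sin (D.til.hP i) 2, D.len, D.len, D.an, h2, T.sc]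
      rw [show (2 : Fin 3) + 1 = 0 from rfl, show (2 : Fin 3) + 2 = 1 from rfl, l0, l1]
      ring
  obtain ⟨n, gn, sn⟩ := nu_nat D j
  obtain ⟨m, gm, sm⟩ := nu_nat D (j + 1)
  have sn := sn f hf
  have sm := sm f hf
  have sn : ‖ed Q j‖ = ρ * Ylen s (n 0) (n 1) (n 2) := by
    rw [sn, Fin.sum_univ_three, l0, l1, l2, Ylen]; ring
  have sm : ‖ed Q (j + 1)‖ = ρ * Ylen s (m 0) (m 1) (m 2) := by
    rw [sm, Fin.sum_univ_three, l0, l1, l2, Ylen]; ring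
  have hY : 0 < Ylen s (m 0) (m 1) (m 2) := by
    have := norm_ed_pos hd (j + 1)
    rw [sm] at this
    exact pos_of_mul_pos_right this hρ.le
  have hB : 0 < Ylen s (n 0) (n 1) (n 2) := by
    have := norm_ed_pos hd j
    rw [sn] at this
    exact pos_of_mul_pos_right this hρ.le
  have E1 : Ylen s (m 0) (m 1) (m 2) ^ 2 * sin (ang Q j) = N * (s * (1 - s ^ 2) * F) := by
    rw [← hleg, sm, area] at a0
    apply mul_right_cancel₀ (pow_pos hρ 2).ne'
    linear_combination -a0
  have E2 : Ylen s (n 0) (n 1) (n 2) * Ylen s (m 0) (m 1) (m 2) * sin (ang Q (j + 1)) = N * (s * (1 - s ^ 2) * F) := by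
    rw [← hleg, sm, sn, area] at a1
    apply mul_right_cancel₀ (pow_pos hρ 2).ne'
    linear_combination -a1
  have lk0 : ∀ t, (S j).testBit (thc a b t) = false → n t = 0 := by
    intro t ht
    by_contra hc
    have := O.sup j t (by rw [gn]; exact_mod_cast Nat.pos_of_ne_zero hc)
    rw [ht] at this
    simp at this
  have lk1 : ∀ t, (S (j + 1)).testBit (thc a b t) = false → m t = 0 := by
    intro t ht
    by_contra hc
    have := O.sup (j + 1) t (by rw [gm]; exact_mod_cast Nat.pos_of_ne_zero hc)
    rw [ht] at this
    simp at this
  have dj := fun i k hi hk e => dec C (O.lk j) i k hi hk e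
  have dj1 := fun i k hi hk e => dec C (O.lk (j + 1)) i k hi hk e
  have bw := C.bw
  have beq : ∀ x y : ℕ, Nat.beq x y = true ↔ x = y := fun x y => by rw [Nat.beq_eq]
  simp only [kindB, Bool.and_eq_true, Bool.or_eq_true, eqB, lackB, Bool.not_eq_true', beq] at hk
  obtain ⟨-, hk⟩ := hk
  rcases hk with (((((((h | h) | h) | h) | h) | h) | h) | h) | h
  · obtain ⟨⟨⟨⟨e0, e1⟩, -⟩, f1⟩, f2⟩ := h
    have r0 := lk1 0 f1
    have r1 := lk1 1 f2
    rw [r0, r1] at E1 hY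
    have := dj 1 2 (by norm_num) (by norm_num) (by rw [e0]; push_cast; ring)
    rw [this, show ((1 : ℤ) : ℝ) * α + (2 : ℤ) * β = π - 2 * α by push_cast; linarith [T.hpi], sin_pi_sub] at E1
    exact no_fam3 T E1 hY
  · obtain ⟨⟨⟨e0, e1⟩, f1⟩, f2⟩ := h
    have r0 := lk1 0 f1
    have r1 := lk1 1 f2
    rw [r0, r1] at E1 hY
    have := dj 1 0 (by norm_num) (by norm_num) (by rw [e0]; push_cast; ring)
    rw [this, show ((1 : ℤ) : ℝ) * α + (0 : ℤ) * β = α by push_cast; ring] at E1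
    exact no_fam2 T E1 hY
  · obtain ⟨⟨ea, eb⟩, e0, e1⟩ := h
    subst ea eb
    have hab := bw 1 (-1) (by norm_num) (by norm_num) (by norm_num)
    have := dj 1 0 (by norm_num) (by norm_num) (by rw [e0]; norm_num)
    rw [this, show ((1 : ℤ) : ℝ) * α + (0 : ℤ) * β = α by push_cast; ring] at E1
    exact no_11 T E1 hY (by push_cast at hab; linarith)
  · obtain ⟨⟨ea, eb⟩, h⟩ := h
    subst ea eb
    have hab := bw 1 (-2) (by norm_num) (by norm_num) (by norm_num)
    have hab : α = 2 * β := by push_cast at hab; linarith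
    rcases h with ⟨⟨e0, e1⟩, f1⟩ | ⟨⟨e0, e1⟩, f1⟩
    · rw [lk1 2 f1] at E1 hY
      have := dj 2 2 (by norm_num) (by norm_num) (by rw [e0]; norm_num)
      rw [this, show ((2 : ℤ) : ℝ) * α + (2 : ℤ) * β = π - α by push_cast; linarith [T.hpi], sin_pi_sub] at E1
      exact no_21a T E1 hY hab
    · rw [lk1 0 f1] at E1 hY
      have := dj 2 0 (by norm_num) (by norm_num) (by rw [e0]; norm_num)
      rw [this, show ((2 : ℤ) : ℝ) * α + (0 : ℤ) * β = 2 * α by push_cast; ring] at E1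
      exact no_21b T E1 hY hab
  · obtain ⟨⟨ea, eb⟩, h⟩ := h
    subst ea eb
    have hab := bw 2 (-1) (by norm_num) (by norm_num) (by norm_num)
    have hab : β = 2 * α := by push_cast at hab; linarith
    refine no_12 T _ E1 ?_ hY hab
    rcases h with (⟨e0, e1⟩ | ⟨e0, e1⟩) | ⟨e0, e1⟩
    · have := dj 1 2 (by norm_num) (by norm_num) (by rw [e0]; norm_num)
      right; left; rw [this]; push_cast; ring
    · have := dj 1 0 (by norm_num) (by norm_num) (by rw [e0]; norm_num)
      left; rw [this]; push_cast; ring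
    · have := dj 1 1 (by norm_num) (by norm_num) (by rw [e0]; norm_num)
      right; right; rw [this]; push_cast; ring
  · obtain ⟨⟨ea, eb⟩, h⟩ := h
    subst ea eb
    have hab := bw 3 (-1) (by norm_num) (by norm_num) (by norm_num)
    have hab : β = 3 * α := by push_cast at hab; linarith
    rcases h with ⟨⟨e0, e1⟩, f1⟩ | ⟨e0, e1⟩
    · rw [lk1 2 f1] at E1 hY
      have := dj 2 1 (by norm_num) (by norm_num) (by rw [e0]; norm_num)
      rw [this, show ((2 : ℤ) : ℝ) * α + (1 : ℤ) * β = 2 * α + β by push_cast; ring, T.sc] at E1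
      exact no_13a T E1 hY hab
    · have := dj 0 1 (by norm_num) (by norm_num) (by rw [e0]; norm_num)
      rw [this, show ((0 : ℤ) : ℝ) * α + (1 : ℤ) * β = β by push_cast; ring] at E1
      exact no_13b T E1 hY hab
  · obtain ⟨⟨⟨ea, eb⟩, e0, e1⟩, f1⟩ := h
    subst ea eb
    have hab := bw 3 (-2) (by norm_num) (by norm_num) (by norm_num)
    have hab : 3 * α = 2 * β := by push_cast at hab; linarith
    rw [lk1 0 f1] at E1 hY
    have := dj 2 0 (by norm_num) (by norm_num) (by rw [e0]; norm_num)
    rw [this, show ((2 : ℤ) : ℝ) * α + (0 : ℤ) * β = 2 * α by push_cast; ring] at E1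
    exact no_23 T E1 hY hab
  · obtain ⟨⟨ea, eb⟩, h⟩ := h
    subst ea eb
    have hab := bw 4 (-1) (by norm_num) (by norm_num) (by norm_num)
    have hab : β = 4 * α := by push_cast at hab; linarith
    rcases h with ⟨⟨⟨e0, e1⟩, f1⟩, f2⟩ | ⟨⟨⟨⟨e0, e1⟩, f1⟩, f2⟩, f3⟩
    · rw [lk1 0 f1, lk1 2 f2] at E1 hY
      have := dj 1 1 (by norm_num) (by norm_num) (by rw [e0]; norm_num)
      rw [this, show ((1 : ℤ) : ℝ) * α + (1 : ℤ) * β = α + β by push_cast; ring, ← T.hF] at E1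
      exact no_14a T E1 hY hab
    · have m2 := lk1 2 f3
      rw [lk0 0 f1, lk0 1 f2, m2] at E2
      rw [lk0 0 f1, lk0 1 f2] at hB
      have tb := dj1 0 1 (by norm_num) (by norm_num) (by rw [e1]; norm_num)
      have t3 := dj 3 0 (by norm_num) (by norm_num) (by rw [e0]; norm_num)
      push_cast at tb t3
      rw [zero_mul, zero_add, one_mul] at tb
      rw [tb] at E2
      have m1 := no_14b T E2 hB hab
      have mp : 0 < m 0 := by
        rcases Nat.eq_zero_or_pos (m 0) with h | h
        · rw [h, m1, m2] at hY; simp [Ylen] at hY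
        · exact h
      have ma : Mem Q th g (j + 1) α := ⟨0, by rw [gm]; exact_mod_cast mp, Or.inl h0.symm⟩
      have ha := T.ap
      have hpi := T.hpi
      rcases rule D ma with h | h
      · rw [j11, j12] at h
        obtain ⟨t, ht, hx⟩ := h
        rw [← hleg, gm] at ht
        rw [t3] at hx
        fin_cases t
        · rcases hx with hx | hx <;> simp [h0] at hx <;> linarith
        · simp [m1] at ht
        · simp [m2] at ht
      · have := (Mem.pos D h).1
        rw [j11, ← hΘ, tb] at this
        linarith
  · obtain ⟨⟨⟨ea, eb⟩, e0, e1⟩, f1⟩ := h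
    subst ea eb
    have hab := bw 6 (-1) (by norm_num) (by norm_num) (by norm_num)
    have hab : β = 6 * α := by push_cast at hab; linarith
    rw [lk1 2 f1] at E1 hY
    have := dj (-1) 1 (by norm_num) (by norm_num) (by rw [e0]; norm_num)
    rw [this, show ((-1 : ℤ) : ℝ) * α + (1 : ℤ) * β = β - α by push_cast; ring] at E1
    exact no_16 T E1 hY hab

/-- angles of Q are those of the tile -/
def SimR (α β x y : ℝ) : Prop := (x = α ∧ y = β) ∨ (x = β ∧ y = α) ∨ (x = α ∧ y = 2 * α + β) ∨
  (x = 2 * α + β ∧ y = α) ∨ (x = β ∧ y = 2 * α + β) ∨ (x = 2 * α + β ∧ y = β)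

lemma core (H : Til P Q) (len : ∀ i k, ‖ed (P i) k‖ = l k) (an : ∀ i k, ang (P i) k = th k)
    (T : Tr α β s F) (h0 : th 0 = α) (h1 : th 1 = β) (h2 : th 2 = 2 * α + β) :
    SimR α β (ang Q 0) (ang Q 1) := by
  obtain ⟨i, -⟩ := (H.cov (Q 0)).mp (fun k => by
    rw [lam_vert]; split_ifs <;> simp)
  have hi := H.hP i
  have hp := norm_ed_pos hi
  have d0 := dt_sin hi 0
  have d1 := dt_sin hi 1
  have d2 := dt_sin hi 2
  rw [show (0 : Fin 3) + 1 = 1 from rfl, show (0 : Fin 3) + 2 = 2 from rfl, len, len, an, h0, T.sa] at d0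
  rw [show (1 : Fin 3) + 1 = 2 from rfl, show (1 : Fin 3) + 2 = 0 from rfl, len, len, an, h1, T.sb] at d1
  rw [show (2 : Fin 3) + 1 = 0 from rfl, show (2 : Fin 3) + 2 = 1 from rfl, len, len, an, h2, T.sc] at d2
  have p0 := hp 0
  have p1 := hp 1
  have p2 := hp 2
  rw [len] at p0 p1 p2
  have l0 : l 0 = l 2 * s := by
    apply mul_right_cancel₀ (mul_pos p1 T.F0).ne'
    linarith
  have l1 : l 1 = l 2 * (1 - s ^ 2) := by
    apply mul_right_cancel₀ (mul_pos p0 T.F0).ne'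
    linarith
  obtain ⟨g, D⟩ := exists_dat H len an T h0 h1 h2 p2 l0 l1 rfl
  have hf : ∀ j, l j = (fun x => l 2 * (sin x / F)) (th j) := by
    have := T.F0.ne'
    intro j
    fin_cases j
    · show l 0 = l 2 * (sin (th 0) / F)
      rw [h0, T.sa, l0]; field_simp
    · show l 1 = l 2 * (sin (th 1) / F)
      rw [h1, T.sb, l1]; field_simp
    · show l 2 = l 2 * (sin (th 2) / F)
      rw [h2, T.sc]; field_simp
  obtain ⟨a, b, A, S, O⟩ := outcome (T.ths h0 h1 h2) D (f := fun x => l 2 * (sin x / F)) hf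
  have K := kill D T h0 h1 h2 p2 l0 l1 rfl (f := fun x => l 2 * (sin x / F)) hf O
  have hfin := O.fin
  simp only [finB, Bool.or_eq_true] at hfin
  rcases hfin with ((h | h) | h) | h
  · have dj := fun j i k hi hk e => dec O.cod (O.lk j) i k hi hk e
    have beq : ∀ x y : ℕ, Nat.beq x y = true ↔ x = y := fun x y => by rw [Nat.beq_eq]
    simp only [simB, Bool.and_eq_true, Bool.or_eq_true, eqB, beq] at h
    have da : ∀ j, A j = a → ang Q j = α := fun j e => by
      have := dj j 1 0 (by norm_num) (by norm_num) (by rw [e]; push_cast; ring)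
      rw [this]; push_cast; ring
    have db : ∀ j, A j = b → ang Q j = β := fun j e => by
      have := dj j 0 1 (by norm_num) (by norm_num) (by rw [e]; push_cast; ring)
      rw [this]; push_cast; ring
    have dc : ∀ j, A j = 2 * a + b → ang Q j = 2 * α + β := fun j e => by
      have := dj j 2 1 (by norm_num) (by norm_num) (by rw [e]; push_cast; ring)
      rw [this]; push_cast; ring
    rcases h with ((((h | h) | h) | h) | h) | h
    · exact Or.inl ⟨da _ h.1, db _ h.2⟩
    · exact Or.inr (Or.inl ⟨db _ h.1, da _ h.2⟩)
    · exact Or.inr (Or.inr (Or.inl ⟨da _ h.1, dc _ h.2⟩))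
    · exact Or.inr (Or.inr (Or.inr (Or.inl ⟨dc _ h.1, da _ h.2⟩)))
    · exact Or.inr (Or.inr (Or.inr (Or.inr (Or.inl ⟨db _ h.1, dc _ h.2⟩))))
    · exact Or.inr (Or.inr (Or.inr (Or.inr (Or.inr ⟨dc _ h.1, db _ h.2⟩))))
  · exact (K 0 h).elim
  · exact (K 1 h).elim
  · exact (K 2 h).elim
end
end

lemma inner_dist {V X : Type*} [NormedAddCommGroup V] [InnerProductSpace ℝ V] [MetricSpace X] [NormedAddTorsor V X]
    (a b c : X) : inner ℝ (a -ᵥ b) (c -ᵥ b) = (dist a b * dist a b + dist c b * dist c b - dist a c * dist a c) / 2 := by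
  rw [real_inner_eq_norm_mul_self_add_norm_mul_self_sub_norm_sub_mul_self_div_two, vsub_sub_vsub_cancel_right,
    dist_eq_norm_vsub V a b, dist_eq_norm_vsub V c b, dist_eq_norm_vsub V a c]

lemma ang_dist {V W X Y : Type*} [NormedAddCommGroup V] [InnerProductSpace ℝ V] [MetricSpace X] [NormedAddTorsor V X]
    [NormedAddCommGroup W] [InnerProductSpace ℝ W] [MetricSpace Y] [NormedAddTorsor W Y]
    {a b c : X} {a' b' c' : Y} (h1 : dist a b = dist a' b') (h2 : dist c b = dist c' b') (h3 : dist a c = dist a' c') :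
    ∠ a b c = ∠ a' b' c' := by
  unfold EuclideanGeometry.angle InnerProductGeometry.angle
  rw [inner_dist, inner_dist, ← dist_eq_norm_vsub, ← dist_eq_norm_vsub, ← dist_eq_norm_vsub, ← dist_eq_norm_vsub, h1, h2, h3]

lemma dt_sq (P : Fin 3 → ℂ) : dt P ^ 2 = dist (P 1) (P 0) ^ 2 * dist (P 2) (P 0) ^ 2 -
    ((dist (P 1) (P 0) ^ 2 + dist (P 2) (P 0) ^ 2 - dist (P 1) (P 2) ^ 2) / 2) ^ 2 := by
  simp only [dist_eq_norm, ← Complex.normSq_eq_norm_sq, Complex.normSq_apply, dt, crs, Complex.sub_re, Complex.sub_im]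
  ring

lemma dt_ne_of_aff {P : Fin 3 → ℂ} (h : AffineIndependent ℝ P) : dt P ≠ 0 := by
  intro h0
  have hinj := h.injective
  rw [affineIndependent_iff_not_collinear] at h
  apply h
  have hm : P 0 ∈ Set.range P := ⟨0, rfl⟩
  rw [collinear_iff_of_mem hm]
  have hu : P 1 - P 0 ≠ 0 := by
    rw [sub_ne_zero]; intro e; exact absurd (hinj e) (by decide)
  have hn : Complex.normSq (P 1 - P 0) ≠ 0 := by rwa [Ne, Complex.normSq_eq_zero]
  refine ⟨P 1 - P 0, ?_⟩
  rintro _ ⟨k, rfl⟩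
  fin_cases k
  · exact ⟨0, by simp⟩
  · exact ⟨1, by simp⟩
  · refine ⟨((P 2 - P 0).re * (P 1 - P 0).re + (P 2 - P 0).im * (P 1 - P 0).im) / Complex.normSq (P 1 - P 0), ?_⟩
    simp only [dt, crs] at h0
    show P 2 = _
    generalize hu' : P 1 - P 0 = u at *
    generalize hv' : P 2 - P 0 = v at *
    have : P 2 = v + P 0 := by rw [← hv']; ring
    rw [this, vadd_eq_add]
    congr 1
    have hn' := hn
    rw [Complex.normSq_apply] at hn'
    apply Complex.ext
    · simp only [Complex.real_smul, Complex.re_ofReal_mul, Complex.normSq_apply]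
      rw [div_mul_eq_mul_div, eq_div_iff hn']
      linear_combination (-u.im) * h0
    · simp only [Complex.real_smul, Complex.im_ofReal_mul, Complex.normSq_apply]
      rw [div_mul_eq_mul_div, eq_div_iff hn']
      linear_combination (u.re) * h0

def io : Pt ≃ₗᵢ[ℝ] ℂ := Complex.orthonormalBasisOneI.repr.symm

def ioT (T : Tri) : Fin 3 → ℂ := fun k => io (T k)

lemma ioT_dist (T : Tri) (i j : Fin 3) : dist (ioT T i) (ioT T j) = dist (T i) (T j) := io.dist_map _ _

lemma ioT_ang (T : Tri) (k : Fin 3) : ang (ioT T) k = triAngle T k :=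
  ang_dist (ioT_dist _ _ _) (ioT_dist _ _ _) (ioT_dist _ _ _)

lemma ioT_hull (T : Tri) : convexHull ℝ (Set.range (ioT T)) = io '' triSet T := by
  have : Set.range (ioT T) = io '' Set.range T := by
    rw [← Set.range_comp]; rfl
  rw [this, triSet]
  exact (io.toLinearEquiv.toLinearMap.image_convexHull (Set.range T)).symm

lemma ioT_dt {T : Tri} (h : IsTriangle T) : dt (ioT T) ≠ 0 := by
  apply dt_ne_of_aff
  exact h.map' (io.toLinearEquiv.toLinearMap.toAffineMap) io.injective

lemma hull_perm (T : Tri) (σ : Equiv.Perm (Fin 3)) : triSet (fun k => T (σ k)) = triSet T := by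
  unfold triSet
  congr 1
  exact σ.surjective.range_comp T

lemma mk_til {N : ℕ} {ABC T : Tri} (hABC : IsTriangle ABC) (hT : IsTriangle T) {tiles : Fin N → Tri}
    (ht : IsTiling N ABC T tiles) : ∃ P : Fin N → Fin 3 → ℂ, Til P (ioT ABC) ∧
      ∀ i x y, dist (P i x) (P i y) = dist (T x) (T y) := by
  choose σ hσ using ht.congr
  have hd : ∀ i x y, dist (ioT (fun k => tiles i ((σ i).symm k)) x) (ioT (fun k => tiles i ((σ i).symm k)) y)
      = dist (T x) (T y) := by
    intro i x y
    rw [ioT_dist, hσ]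
    simp
  have hne : ∀ i, dt (ioT (fun k => tiles i ((σ i).symm k))) ≠ 0 := by
    intro i h
    apply ioT_dt hT
    have := dt_sq (ioT (fun k => tiles i ((σ i).symm k)))
    rw [hd, hd, hd, h] at this
    have h2 := dt_sq (ioT T)
    rw [ioT_dist, ioT_dist, ioT_dist, ← this] at h2
    simpa using h2
  have hh : ∀ i, convexHull ℝ (Set.range (ioT (fun k => tiles i ((σ i).symm k)))) = io '' triSet (tiles i) := by
    intro i
    rw [ioT_hull, hull_perm]
  refine ⟨fun i => ioT (fun k => tiles i ((σ i).symm k)), ⟨hne, ioT_dt hABC, ?_, ?_⟩, hd⟩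
  · intro i j hij z h1 h2
    have a1 := mem_int (hne i) z h1
    have a2 := mem_int (hne j) z h2
    rw [hh] at a1 a2
    have hi : ∀ A : Set Pt, interior (io '' A) = io '' interior A := fun A =>
      (io.toHomeomorph.image_interior A).symm
    rw [hi] at a1 a2
    obtain ⟨w, hw, rfl⟩ := a1
    obtain ⟨w', hw', e⟩ := a2
    rw [io.injective e] at hw'
    have : w ∈ interior (triSet (tiles i)) ∩ interior (triSet (tiles j)) := ⟨hw, hw'⟩
    rw [ht.disj i j hij] at this
    exact this
  · intro z
    rw [← mem_hull (ioT_dt hABC), ioT_hull, ← ht.cover, Set.image_iUnion, Set.mem_iUnion]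
    refine exists_congr fun i => ?_
    rw [← mem_hull (hne i), hh]

lemma law_sin {P : Fin 3 → ℂ} (h : dt P ≠ 0) : ∃ c : ℝ, 0 < c ∧ ∀ k, ‖ed P k‖ = c * sin (ang P k) := by
  have hp := norm_ed_pos h
  have hD : 0 < |dt P| := abs_pos.mpr h
  refine ⟨‖ed P 0‖ * ‖ed P 1‖ * ‖ed P 2‖ / |dt P|, by have := hp 0; have := hp 1; have := hp 2; positivity, ?_⟩
  intro k
  have e := dt_sin h k
  have : ‖ed P 0‖ * ‖ed P 1‖ * ‖ed P 2‖ = ‖ed P k‖ * (‖ed P (k + 1)‖ * ‖ed P (k + 2)‖) := by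
    fin_cases k
    · simp; ring
    · show _ = ‖ed P 1‖ * (‖ed P 2‖ * ‖ed P 0‖)
      ring
    · show _ = ‖ed P 2‖ * (‖ed P 0‖ * ‖ed P 1‖)
      ring
  rw [this]
  field_simp
  rw [e]
  ring

lemma dist_ed (P : Fin 3 → ℂ) (i j k : Fin 3) (h1 : i ≠ j) (h2 : i ≠ k) (h3 : j ≠ k) :
    dist (P i) (P j) = ‖ed P k‖ := by
  rw [norm_ed]
  have : (i = k + 1 ∧ j = k + 2) ∨ (i = k + 2 ∧ j = k + 1) := by omega
  rcases this with ⟨rfl, rfl⟩ | ⟨rfl, rfl⟩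
  · rfl
  · rw [dist_comm]

lemma sim_of_perm {T A : Tri} (hT : IsTriangle T) (hA : IsTriangle A) (σ : Equiv.Perm (Fin 3))
    (h : ∀ k, ang (ioT T) k = ang (ioT A) (σ k)) : SimilarTri T A := by
  obtain ⟨c, hc, e⟩ := law_sin (ioT_dt hT)
  obtain ⟨d, hd, e'⟩ := law_sin (ioT_dt hA)
  refine ⟨c / d, by positivity, σ, fun i j => ?_⟩
  by_cases hij : i = j
  · subst hij; simp
  obtain ⟨k, h2, h3⟩ : ∃ k, i ≠ k ∧ j ≠ k := by
    clear h e e'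
    revert i j; decide
  rw [← ioT_dist, ← ioT_dist, dist_ed _ i j k hij h2 h3,
    dist_ed _ (σ i) (σ j) (σ k) (σ.injective.ne hij) (σ.injective.ne h2) (σ.injective.ne h3), e, e', h]
  field_simp

lemma not_rat (N : ℕ) (ABC T : Tri)
    (hABC : IsTriangle ABC) (hT : IsTriangle T)
    (α β γ : ℝ) (hangles : HasAngles T α β γ)
    (hsum : 3 * α + 2 * β = π)
    (tiles : Fin N → Tri) (ht : IsTiling N ABC T tiles)
    (hsim : ¬ SimilarTri T ABC) : ¬ ∃ q : ℚ, α = (q : ℝ) * π := by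
  intro hq
  obtain ⟨h0, h1, h2⟩ := hangles
  rw [← ioT_ang] at h0 h1 h2
  have dT := ioT_dt hT
  have sT := ang_sum dT 0
  rw [show (0 : Fin 3) + 1 = 1 from rfl, show (0 : Fin 3) + 2 = 2 from rfl, h0, h1, h2] at sT
  have hγ : γ = 2 * α + β := by linarith
  rw [hγ] at h2
  obtain ⟨P, H, hP⟩ := mk_til hABC hT ht
  have R := core (l := fun k => ‖ed (ioT T) k‖) (th := fun k => ang (ioT T) k) H
    (fun i k => by rw [norm_ed, norm_ed, hP, ioT_dist])
    (fun i k => ang_dist (by rw [hP, ioT_dist]) (by rw [hP, ioT_dist]) (by rw [hP, ioT_dist]))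
    (α := α) (β := β) (s := _) (F := _)
    ⟨h0 ▸ ang_pos dT 0, h1 ▸ ang_pos dT 1, hsum.symm, rfl, rfl, hq⟩ h0 h1 h2
  have sQ := ang_sum (ioT_dt hABC) 0
  rw [show (0 : Fin 3) + 1 = 1 from rfl, show (0 : Fin 3) + 2 = 2 from rfl] at sQ
  apply hsim
  have key : ∀ σ : Equiv.Perm (Fin 3), ang (ioT ABC) (σ 0) = α → ang (ioT ABC) (σ 1) = β →
      ang (ioT ABC) (σ 2) = 2 * α + β → SimilarTri T ABC := by
    intro σ a b c
    apply sim_of_perm hT hABC σ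
    intro k
    fin_cases k
    · exact h0.trans a.symm
    · exact h1.trans b.symm
    · exact h2.trans c.symm
  rcases R with ⟨x, y⟩ | ⟨x, y⟩ | ⟨x, y⟩ | ⟨x, y⟩ | ⟨x, y⟩ | ⟨x, y⟩
  · have z : ang (ioT ABC) 2 = 2 * α + β := by linarith
    exact key 1 x y z
  · have z : ang (ioT ABC) 2 = 2 * α + β := by linarith
    exact key (Equiv.swap 0 1) y x z
  · have z : ang (ioT ABC) 2 = β := by linarith
    exact key (Equiv.swap 1 2) x z y
  · have z : ang (ioT ABC) 2 = β := by linarith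
    exact key (finRotate 3) y z x
  · have z : ang (ioT ABC) 2 = α := by linarith
    exact key (finRotate 3).symm z x y
  · have z : ang (ioT ABC) 2 = α := by linarith
    exact key (Equiv.swap 0 2) z y x

/-- Let `3α + 2β = π` and suppose there is an `N`-tiling of triangle `ABC` by a
tile with angles `(α, β, γ)` not similar to `ABC`.  Then `α` and `β` are not
rational multiples of `π`, and every integer linear relation among `π`, `α`,
`β` is an integer multiple of the relation `3α + 2β = π`. -/
theorem angles_lemma_3a2b (N : ℕ) (ABC T : Tri)
    (hABC : IsTriangle ABC) (hT : IsTriangle T)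
    (α β γ : ℝ) (hangles : HasAngles T α β γ)
    (hsum : 3 * α + 2 * β = π)
    (tiles : Fin N → Tri) (ht : IsTiling N ABC T tiles)
    (hsim : ¬ SimilarTri T ABC) :
    (¬ ∃ q : ℚ, α = (q : ℝ) * π) ∧ (¬ ∃ q : ℚ, β = (q : ℝ) * π) ∧
      ∀ p q r : ℤ, (p : ℝ) * α + (q : ℝ) * β = (r : ℝ) * π → p = 3 * r ∧ q = 2 * r := by
  have h := not_rat N ABC T hABC hT α β γ hangles hsum tiles ht hsim
  refine ⟨h, ?_, ?_⟩
  · rintro ⟨q, hq⟩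
    exact h ⟨(1 - 2 * q) / 3, by push_cast; linarith⟩
  · intro p q r e
    have hu : ((2 * (p - 3 * r) - 3 * (q - 2 * r) : ℤ) : ℝ) * α = - ((q - 2 * r : ℤ) : ℝ) * π := by
      push_cast
      rw [← hsum] at e ⊢
      linarith
    by_cases h0 : 2 * (p - 3 * r) - 3 * (q - 2 * r) = 0
    · rw [h0] at hu
      have hv : (q - 2 * r : ℤ) = 0 := by
        have : ((q - 2 * r : ℤ) : ℝ) = 0 := by
          have := pi_ne_zero
          simp only [Int.cast_zero, zero_mul] at hu
          rcases mul_eq_zero.mp hu.symm with h | h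
          · linarith
          · contradiction
        exact_mod_cast this
      omega
    · exfalso
      apply h
      have h0' : ((2 * (p - 3 * r) - 3 * (q - 2 * r) : ℤ) : ℝ) ≠ 0 := by exact_mod_cast h0
      refine ⟨- ((q - 2 * r : ℤ) : ℚ) / ((2 * (p - 3 * r) - 3 * (q - 2 * r) : ℤ) : ℚ), ?_⟩
      rw [Rat.cast_div, Rat.cast_neg, Rat.cast_intCast, Rat.cast_intCast, div_mul_eq_mul_div, eq_div_iff h0']
      linarith
end
end

section
/- Let triangle ABC be N-tiled by a tile with angles (α, β, γ) that is not similar to ABC, where α is not a rational multiple of π. Suppose that either 3α + 2β = π and ABC is not isosceles with base angles α, or γ = 2π/3. Then no tile has its γ angle at a vertex of ABC: for every tile of the tiling having a vertex at A, B, or C, the interior angle of that tile at that vertex is not γ. -/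
open EuclideanGeometry Real

noncomputable section

open MeasureTheory Set in
lemma sectorC (θ r : ℝ) (h0 : 0 < θ) (hπ : θ < π) (hr : 0 < r) :
    volume {z : ℂ | 0 ≤ z.im ∧ 0 ≤ z.re * Real.sin θ - z.im * Real.cos θ ∧ ‖z‖ < r}
      = ENNReal.ofReal (θ / 2 * r ^ 2) := by
  set S := {z : ℂ | 0 ≤ z.im ∧ 0 ≤ z.re * Real.sin θ - z.im * Real.cos θ ∧ ‖z‖ < r} with hS
  have hm : MeasurableSet S := by
    have h1 : IsClosed {z : ℂ | 0 ≤ z.im} := isClosed_le continuous_const Complex.continuous_im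
    have h2 : IsClosed {z : ℂ | 0 ≤ z.re * Real.sin θ - z.im * Real.cos θ} :=
      isClosed_le continuous_const (by fun_prop)
    have h3 : IsOpen {z : ℂ | ‖z‖ < r} := isOpen_lt (by fun_prop) continuous_const
    exact h1.measurableSet.inter (h2.measurableSet.inter h3.measurableSet)
  rw [← lintegral_indicator_one hm, ← Complex.lintegral_comp_polarCoord_symm]
  have key : ∀ p ∈ polarCoord.target, ENNReal.ofReal p.1 • S.indicator (1 : ℂ → ENNReal) (Complex.polarCoord.symm p)
      = (Ioo 0 r ×ˢ Icc 0 θ).indicator (fun p : ℝ × ℝ => ENNReal.ofReal p.1) p := by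
    rintro ⟨ρ, φ⟩ hp
    simp only [polarCoord_target, mem_prod, mem_Ioi, mem_Ioo] at hp
    obtain ⟨hρ, hφ1, hφ2⟩ := hp
    have hiff : Complex.polarCoord.symm (ρ, φ) ∈ S ↔ (ρ, φ) ∈ Ioo 0 r ×ˢ Icc 0 θ := by
      have him : (Complex.polarCoord.symm (ρ, φ)).im = ρ * Real.sin φ := by
        rw [Complex.polarCoord_symm_apply]
        simp [-Complex.ofReal_cos, -Complex.ofReal_sin]
      have hre : (Complex.polarCoord.symm (ρ, φ)).re = ρ * Real.cos φ := by
        rw [Complex.polarCoord_symm_apply]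
        simp [-Complex.ofReal_cos, -Complex.ofReal_sin]
      have hn : ‖Complex.polarCoord.symm (ρ, φ)‖ = ρ := by
        rw [Complex.norm_polarCoord_symm, abs_of_pos hρ]
      have e1 : ρ * Real.cos φ * Real.sin θ - ρ * Real.sin φ * Real.cos θ = ρ * Real.sin (θ - φ) := by
        rw [Real.sin_sub]; ring
      simp only [hS, mem_ofPred_eq, him, hre, hn, e1, mem_prod, mem_Ioo, mem_Icc]
      rw [mul_nonneg_iff_of_pos_left hρ, mul_nonneg_iff_of_pos_left hρ]
      constructor
      · rintro ⟨a, b, c⟩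
        have hφ0 : 0 ≤ φ := by
          by_contra h
          push Not at h
          have := Real.sin_neg_of_neg_of_neg_pi_lt h hφ1
          linarith
        refine ⟨⟨hρ, c⟩, hφ0, ?_⟩
        by_contra h
        push Not at h
        have := Real.sin_neg_of_neg_of_neg_pi_lt (x := θ - φ) (by linarith) (by linarith)
        linarith
      · rintro ⟨⟨_, c⟩, a, b⟩
        exact ⟨Real.sin_nonneg_of_nonneg_of_le_pi a hφ2.le,
          Real.sin_nonneg_of_nonneg_of_le_pi (by linarith) (by linarith), c⟩
    by_cases h : (ρ, φ) ∈ Ioo 0 r ×ˢ Icc 0 θ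
    · rw [indicator_of_mem h, indicator_of_mem (hiff.2 h)]; simp
    · rw [indicator_of_notMem h, indicator_of_notMem (fun h' => h (hiff.1 h'))]; simp
  rw [setLIntegral_congr_fun polarCoord.open_target.measurableSet key]
  rw [setLIntegral_indicator (measurableSet_Ioo.prod measurableSet_Icc)]
  have hsub : Ioo 0 r ×ˢ Icc 0 θ ∩ polarCoord.target = Ioo 0 r ×ˢ Icc 0 θ := by
    apply inter_eq_left.2
    rintro ⟨ρ, φ⟩ ⟨h1, h2⟩
    simp only [mem_Ioo, mem_Icc] at h1 h2
    simp only [polarCoord_target, mem_prod, mem_Ioi, mem_Ioo]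
    exact ⟨h1.1, by linarith, by linarith⟩
  rw [hsub, Measure.volume_eq_prod, ← Measure.prod_restrict]
  have := lintegral_prod_mul (μ := volume.restrict (Ioo (0:ℝ) r)) (ν := volume.restrict (Icc (0:ℝ) θ))
    (f := fun x => ENNReal.ofReal x) (g := fun _ => 1) (by fun_prop) (by fun_prop)
  simp only [mul_one] at this
  rw [this]
  have h1 : ∫⁻ x in Ioo (0:ℝ) r, ENNReal.ofReal x = ENNReal.ofReal (r ^ 2 / 2) := by
    rw [restrict_Ioo_eq_restrict_Ioc, ← ofReal_integral_eq_lintegral_ofReal]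
    · rw [← intervalIntegral.integral_of_le hr.le, integral_id]; simp
    · exact (continuous_id.intervalIntegrable 0 r).1
    · exact (ae_restrict_iff' measurableSet_Ioc).2 (Filter.Eventually.of_forall fun x hx => hx.1.le)
  rw [h1]
  simp only [lintegral_one, Measure.restrict_apply MeasurableSet.univ, univ_inter, Real.volume_Icc]
  rw [← ENNReal.ofReal_mul (by positivity)]
  congr 1; ring

lemma exists_isom (u v : Pt) (hu : u ≠ 0) (hv : v ≠ 0) :
    ∃ e : Pt ≃ₗᵢ[ℝ] ℂ, e u = (‖u‖ : ℂ) ∧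
      (e v).re = ‖v‖ * Real.cos (InnerProductGeometry.angle u v) ∧
      (e v).im = ‖v‖ * Real.sin (InnerProductGeometry.angle u v) := by
  let e0 : Pt ≃ₗᵢ[ℝ] ℂ := Complex.orthonormalBasisOneI.repr.symm
  have hz : ‖e0 u‖ = ‖u‖ := e0.norm_map u
  have hz0 : e0 u ≠ 0 := by simpa using hu
  have hn0 : (‖u‖ : ℂ) ≠ 0 := by simpa using hu
  let c : Circle := ⟨(‖u‖ : ℂ) / e0 u, by
    simp [Submonoid.unitSphere, hz, hu]⟩
  let e1 : Pt ≃ₗᵢ[ℝ] ℂ := e0.trans (rotation c)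
  have he1u : e1 u = (‖u‖ : ℂ) := by
    change rotation c (e0 u) = _
    rw [rotation_apply]
    change (‖u‖ : ℂ) / e0 u * e0 u = _
    exact div_mul_cancel₀ _ hz0
  have main : ∀ e : Pt ≃ₗᵢ[ℝ] ℂ, e u = (‖u‖ : ℂ) → 0 ≤ (e v).im →
      (e v).re = ‖v‖ * Real.cos (InnerProductGeometry.angle u v) ∧
      (e v).im = ‖v‖ * Real.sin (InnerProductGeometry.angle u v) := by
    intro e h1 h2
    have hev : e v ≠ 0 := by simpa using hv
    have ha : InnerProductGeometry.angle u v = (e v).arg := by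
      rw [← LinearIsometry.angle_map e.toLinearIsometry u v]
      change InnerProductGeometry.angle (e u) (e v) = _
      rw [InnerProductGeometry.angle_comm, Complex.angle_eq_abs_arg hev (by rw [h1]; exact hn0), h1]
      rw [div_eq_mul_inv, ← Complex.ofReal_inv]
      rw [Complex.arg_mul_real (by positivity), abs_of_nonneg (Complex.arg_nonneg_iff.2 h2)]
    rw [ha, ← e.norm_map v, Complex.norm_mul_cos_arg, Complex.norm_mul_sin_arg]
    exact ⟨rfl, rfl⟩
  by_cases h : 0 ≤ (e1 v).im
  · exact ⟨e1, he1u, main e1 he1u h⟩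
  · let e2 : Pt ≃ₗᵢ[ℝ] ℂ := e1.trans Complex.conjLIE
    have h2 : e2 u = (‖u‖ : ℂ) := by simp [e2, he1u]
    refine ⟨e2, h2, main e2 h2 ?_⟩
    simp only [e2, LinearIsometryEquiv.trans_apply, Complex.conjLIE_apply, Complex.conj_im]
    linarith

def coneSet (u v : Pt) : Set Pt := {x | ∃ s t : ℝ, 0 ≤ s ∧ 0 ≤ t ∧ x = s • u + t • v}

open MeasureTheory Set in
lemma sectorCone (u v : Pt) (hu : u ≠ 0) (hv : v ≠ 0) (r : ℝ) (hr : 0 < r)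
    (h0 : 0 < InnerProductGeometry.angle u v) (hπ : InnerProductGeometry.angle u v < π) :
    volume (coneSet u v ∩ Metric.ball 0 r)
      = ENNReal.ofReal (InnerProductGeometry.angle u v / 2 * r ^ 2) := by
  obtain ⟨e, h1, h2, h3⟩ := exists_isom u v hu hv
  set θ := InnerProductGeometry.angle u v
  rw [← sectorC θ r h0 hπ hr]
  have hs : 0 < Real.sin θ := Real.sin_pos_of_pos_of_lt_pi h0 hπ
  have hnu : 0 < ‖u‖ := norm_pos_iff.2 hu
  have hnv : 0 < ‖v‖ := norm_pos_iff.2 hv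
  have hpre : coneSet u v ∩ Metric.ball 0 r =
      e ⁻¹' {z : ℂ | 0 ≤ z.im ∧ 0 ≤ z.re * Real.sin θ - z.im * Real.cos θ ∧ ‖z‖ < r} := by
    ext x
    simp only [mem_inter_iff, coneSet, mem_ofPred_eq, mem_preimage, Metric.mem_ball,
      dist_zero_right, e.norm_map]
    rw [← and_assoc]
    refine and_congr_left fun _ => ?_
    constructor
    · rintro ⟨s, t, hs0, ht0, rfl⟩
      have e1 : (e (s • u + t • v)).im = t * (‖v‖ * Real.sin θ) := by
        simp [h1, h3]
      have e2 : (e (s • u + t • v)).re = s * ‖u‖ + t * (‖v‖ * Real.cos θ) := by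
        simp [h1, h2]
      rw [e1, e2]
      refine ⟨by positivity, ?_⟩
      have : (s * ‖u‖ + t * (‖v‖ * Real.cos θ)) * Real.sin θ - t * (‖v‖ * Real.sin θ) * Real.cos θ
        = s * ‖u‖ * Real.sin θ := by ring
      rw [this]; positivity
    · rintro ⟨ha, hb⟩
      refine ⟨((e x).re * Real.sin θ - (e x).im * Real.cos θ) / (Real.sin θ * ‖u‖),
        (e x).im / (‖v‖ * Real.sin θ), by positivity, by positivity, ?_⟩
      apply e.injective
      apply Complex.ext
      · simp only [map_add, map_smul, h1, Complex.add_re, Complex.real_smul, Complex.mul_re, h2,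
          Complex.ofReal_re, Complex.ofReal_im, zero_mul, mul_zero, sub_zero]
        field_simp
        ring
      · simp only [map_add, map_smul, h1, Complex.add_im, Complex.real_smul, Complex.mul_im, h3,
          Complex.ofReal_re, Complex.ofReal_im, zero_mul, mul_zero, add_zero, zero_add]
        field_simp
  rw [hpre]
  exact e.measurePreserving.measure_preimage_emb e.toHomeomorph.measurableEmbedding _

lemma mem_triSet (T : Tri) (k : Fin 3) (x : Pt) :
    x ∈ triSet T ↔ ∃ s t : ℝ, 0 ≤ s ∧ 0 ≤ t ∧ s + t ≤ 1 ∧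
      x - T k = s • (T (k+1) - T k) + t • (T (k+2) - T k) := by
  have hr : Set.range T = {T k, T (k+1), T (k+2)} := by
    ext y
    simp only [Set.mem_range, Set.mem_insert_iff, Set.mem_singleton_iff]
    fin_cases k <;> simp [Fin.exists_fin_succ, eq_comm] <;> tauto
  rw [triSet, hr, convexHull_insert (by simp), convexHull_pair]
  simp only [mem_convexJoin, Set.mem_singleton_iff, exists_eq_left]
  constructor
  · rintro ⟨y, ⟨a, b, ha, hb, hab, rfl⟩, c, d, hc, hd, hcd, rfl⟩
    refine ⟨d * a, d * b, by positivity, by positivity, by nlinarith, ?_⟩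
    obtain rfl : c = 1 - d := by linarith
    obtain rfl : a = 1 - b := by linarith
    module
  · rintro ⟨s, t, hs, ht, hst, hx⟩
    obtain rfl : x = T k + (s • (T (k+1) - T k) + t • (T (k+2) - T k)) := by rw [← hx]; abel
    rcases eq_or_lt_of_le (add_nonneg hs ht) with h | h
    · obtain rfl : s = 0 := by linarith
      obtain rfl : t = 0 := by linarith
      refine ⟨T (k+1), left_mem_segment _ _ _, ?_⟩
      simpa using left_mem_segment ℝ (T k) (T (k+1))
    · refine ⟨(s/(s+t)) • T (k+1) + (t/(s+t)) • T (k+2), ⟨s/(s+t), t/(s+t), by positivity, by positivity, by field_simp, rfl⟩,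
        1 - (s+t), s+t, by linarith, by linarith, by ring, ?_⟩
      rw [smul_add, smul_smul, smul_smul, mul_div_cancel₀ _ h.ne', mul_div_cancel₀ _ h.ne']
      module

lemma tri_not_collinear (T : Tri) (hT : IsTriangle T) (k : Fin 3) :
    ¬ Collinear ℝ {T (k+1), T k, T (k+2)} := by
  have hr : Set.range T = {T (k+1), T k, T (k+2)} := by
    ext y
    simp only [Set.mem_range, Set.mem_insert_iff, Set.mem_singleton_iff]
    fin_cases k <;> simp [Fin.exists_fin_succ, eq_comm] <;> tauto
  rw [← hr]
  exact affineIndependent_iff_not_collinear.1 hT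

lemma triAngle_bounds (T : Tri) (hT : IsTriangle T) (k : Fin 3) :
    T (k+1) - T k ≠ 0 ∧ T (k+2) - T k ≠ 0 ∧ 0 < triAngle T k ∧ triAngle T k < π := by
  have h := tri_not_collinear T hT k
  rw [collinear_iff_eq_or_eq_or_angle_eq_zero_or_angle_eq_pi] at h
  push Not at h
  obtain ⟨a, b, c, d⟩ := h
  exact ⟨sub_ne_zero.2 a, sub_ne_zero.2 b, lt_of_le_of_ne (angle_nonneg _ _ _) (Ne.symm c),
    lt_of_le_of_ne (angle_le_pi _ _ _) d⟩

lemma local_cone (T : Tri) (hT : IsTriangle T) (k : Fin 3) :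
    ∃ r₀ > 0, ∀ r, 0 < r → r ≤ r₀ → triSet T ∩ Metric.ball (T k) r =
      (fun x => x - T k) ⁻¹' (coneSet (T (k+1) - T k) (T (k+2) - T k) ∩ Metric.ball 0 r) := by
  obtain ⟨hu, hv, h0, hπ⟩ := triAngle_bounds T hT k
  have hθ : triAngle T k = InnerProductGeometry.angle (T (k+1) - T k) (T (k+2) - T k) := rfl
  rw [hθ] at h0 hπ
  have hm := mem_triSet T k
  set u := T (k+1) - T k
  set v := T (k+2) - T k
  obtain ⟨e, h1, h2, h3⟩ := exists_isom u v hu hv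
  set θ := InnerProductGeometry.angle u v
  have hs : 0 < Real.sin θ := Real.sin_pos_of_pos_of_lt_pi h0 hπ
  have hnu : 0 < ‖u‖ := norm_pos_iff.2 hu
  have hnv : 0 < ‖v‖ := norm_pos_iff.2 hv
  -- bound
  have bound : ∀ s t : ℝ, 0 ≤ s → 0 ≤ t → s * (‖u‖ * Real.sin θ) ≤ 2 * ‖s • u + t • v‖ ∧
      t * (‖v‖ * Real.sin θ) ≤ ‖s • u + t • v‖ := by
    intro s t hs0 ht0
    have e1 : (e (s • u + t • v)).im = t * (‖v‖ * Real.sin θ) := by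
      simp [h1, h3]
    have e2 : (e (s • u + t • v)).re = s * ‖u‖ + t * (‖v‖ * Real.cos θ) := by
      simp [h1, h2]
    have a1 := Complex.abs_im_le_norm (e (s • u + t • v))
    have a2 := Complex.abs_re_le_norm (e (s • u + t • v))
    rw [e.norm_map] at a1 a2
    have e3 : s * (‖u‖ * Real.sin θ) = (e (s • u + t • v)).re * Real.sin θ - (e (s • u + t • v)).im * Real.cos θ := by
      rw [e1, e2]; ring
    have b1 : (e (s • u + t • v)).re * Real.sin θ ≤ ‖s • u + t • v‖ := by
      refine (le_abs_self _).trans ?_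
      rw [abs_mul]
      have := Real.abs_sin_le_one θ
      nlinarith [abs_nonneg (e (s • u + t • v)).re]
    have b2 : -((e (s • u + t • v)).im * Real.cos θ) ≤ ‖s • u + t • v‖ := by
      refine (neg_le_abs _).trans ?_
      rw [abs_mul]
      have := Real.abs_cos_le_one θ
      nlinarith [abs_nonneg (e (s • u + t • v)).im]
    refine ⟨by linarith, ?_⟩
    rw [← e1]
    exact (le_abs_self _).trans a1
  refine ⟨min (‖u‖ * Real.sin θ / 4) (‖v‖ * Real.sin θ / 2), by positivity, ?_⟩
  intro r hr hr0
  have hr1 := hr0.trans (min_le_left _ _)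
  have hr2 := hr0.trans (min_le_right _ _)
  ext x
  simp only [Set.mem_inter_iff, Set.mem_preimage, hm, coneSet, Set.mem_ofPred_eq, Metric.mem_ball,
    sub_zero, dist_eq_norm]
  refine and_congr_left fun hx => ?_
  constructor
  · rintro ⟨s, t, a, b, _, c⟩; exact ⟨s, t, a, b, c⟩
  · rintro ⟨s, t, a, b, c⟩
    refine ⟨s, t, a, b, ?_, c⟩
    rw [c] at hx
    obtain ⟨b1, b2⟩ := bound s t a b
    have c1 : s ≤ 1 / 2 := by
      have hp : 0 < ‖u‖ * Real.sin θ := by positivity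
      nlinarith
    have c2 : t ≤ 1 / 2 := by
      have hp : 0 < ‖v‖ * Real.sin θ := by positivity
      nlinarith
    linarith

open MeasureTheory in
lemma local_vol (T : Tri) (hT : IsTriangle T) (k : Fin 3) :
    ∃ r₀ > 0, ∀ r, 0 < r → r ≤ r₀ → volume (triSet T ∩ Metric.ball (T k) r) =
      ENNReal.ofReal (triAngle T k / 2 * r ^ 2) := by
  obtain ⟨r₀, h0, h⟩ := local_cone T hT k
  refine ⟨r₀, h0, fun r hr hr0 => ?_⟩
  obtain ⟨hu, hv, h1, h2⟩ := triAngle_bounds T hT k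
  rw [h r hr hr0, show (fun x => x - T k) = (fun x => x + -T k) from funext fun x => sub_eq_add_neg _ _,
    measure_preimage_add_right]
  exact sectorCone _ _ hu hv r hr h1 h2

lemma cone_zero (u v : Pt) (hu : u ≠ 0) (hv : v ≠ 0)
    (h0 : 0 < InnerProductGeometry.angle u v) (hπ : InnerProductGeometry.angle u v < π)
    (s t : ℝ) (h : s • u + t • v = 0) : s = 0 ∧ t = 0 := by
  obtain ⟨e, h1, h2, h3⟩ := exists_isom u v hu hv
  have hs := Real.sin_pos_of_pos_of_lt_pi h0 hπ
  have hnv : 0 < ‖v‖ := norm_pos_iff.2 hv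
  have e1 : (e (s • u + t • v)).im = t * (‖v‖ * Real.sin (InnerProductGeometry.angle u v)) := by
    simp [h1, h3]
  rw [h] at e1
  have ht : t = 0 := by
    simp only [map_zero, Complex.zero_im] at e1
    rcases mul_eq_zero.1 e1.symm with h | h
    · exact h
    · exact absurd h (by positivity)
  subst ht
  simp only [zero_smul, add_zero, smul_eq_zero] at h
  exact ⟨h.resolve_right hu, rfl⟩

lemma vertex_extreme (T : Tri) (hT : IsTriangle T) (k : Fin 3) :
    T k ∈ (triSet T).extremePoints ℝ := by
  obtain ⟨hu, hv, h0, hπ⟩ := triAngle_bounds T hT k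
  refine ⟨subset_convexHull _ _ ⟨k, rfl⟩, ?_⟩
  intro x hx y hy hxy
  obtain ⟨s, t, hs, ht, -, hx⟩ := (mem_triSet T k x).1 hx
  obtain ⟨s', t', hs', ht', -, hy⟩ := (mem_triSet T k y).1 hy
  obtain ⟨a, b, ha, hb, hab, hP⟩ := hxy
  have hz : (a * s + b * s') • (T (k+1) - T k) + (a * t + b * t') • (T (k+2) - T k) = 0 := by
    have : a • (x - T k) + b • (y - T k) = 0 := by
      have : a • (x - T k) + b • (y - T k) = (a • x + b • y) - (a + b) • T k := by module
      rw [this, hP, hab]; simp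
    rw [hx, hy] at this
    rw [← this]; module
  obtain ⟨z1, z2⟩ := cone_zero _ _ hu hv h0 hπ _ _ hz
  have hs0 : s = 0 := by
    have := mul_nonneg ha.le hs
    have := mul_nonneg hb.le hs'
    have : a * s = 0 := by linarith
    exact (mul_eq_zero.1 this).resolve_left ha.ne'
  have ht0 : t = 0 := by
    have := mul_nonneg ha.le ht
    have := mul_nonneg hb.le ht'
    have : a * t = 0 := by linarith
    exact (mul_eq_zero.1 this).resolve_left ha.ne'
  rw [hs0, ht0] at hx
  simpa [sub_eq_zero] using hx

lemma triSet_compact (T : Tri) : IsCompact (triSet T) :=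
  (Set.finite_range T).isCompact_convexHull (𝕜 := ℝ)

open MeasureTheory in
lemma tile_vol (ABC X : Tri) (hABC : IsTriangle ABC) (hX : IsTriangle X)
    (hsub : triSet X ⊆ triSet ABC) (m : Fin 3) :
    ∃ r₀ > 0, ∀ r, 0 < r → r ≤ r₀ → volume (triSet X ∩ Metric.ball (ABC m) r) =
      ENNReal.ofReal ((∑ k, if X k = ABC m then triAngle X k else 0) / 2 * r ^ 2) := by
  classical
  by_cases hP : ABC m ∈ triSet X
  · have hr := extremePoints_convexHull_subset
      (inter_extremePoints_subset_extremePoints_of_subset hsub ⟨hP, vertex_extreme ABC hABC m⟩)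
    obtain ⟨k, hk⟩ := hr
    have hsum : (∑ k, if X k = ABC m then triAngle X k else 0) = triAngle X k := by
      rw [Finset.sum_eq_single k]
      · simp [hk]
      · intro b _ hb
        rw [if_neg]
        intro h
        exact hb (hX.injective (h.trans hk.symm))
      · simp
    rw [hsum, ← hk]
    exact local_vol X hX k
  · have hsum : (∑ k, if X k = ABC m then triAngle X k else 0) = 0 := by
      apply Finset.sum_eq_zero
      intro k _
      rw [if_neg]
      intro h
      exact hP (h ▸ subset_convexHull _ _ ⟨k, rfl⟩)
    obtain ⟨ε, hε, hb⟩ := Metric.isOpen_iff.1 (triSet_compact X).isClosed.isOpen_compl _ hP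
    refine ⟨ε, hε, fun r hr hr0 => ?_⟩
    have : triSet X ∩ Metric.ball (ABC m) r = ∅ := by
      ext x
      simp only [Set.mem_inter_iff, Set.mem_empty_iff_false, iff_false, not_and]
      intro h1 h2
      exact hb (Metric.ball_subset_ball hr0 h2) h1
    rw [this, hsum]; simp

open MeasureTheory in
lemma angle_sum (N : ℕ) (ABC : Tri) (hABC : IsTriangle ABC) (tiles : Fin N → Tri)
    (hnd : ∀ i, IsTriangle (tiles i))
    (disj : ∀ i j, i ≠ j → interior (triSet (tiles i)) ∩ interior (triSet (tiles j)) = ∅)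
    (cover : (⋃ i, triSet (tiles i)) = triSet ABC) (m : Fin 3) :
    triAngle ABC m = ∑ i, ∑ k, if tiles i k = ABC m then triAngle (tiles i) k else 0 := by
  classical
  have hsub : ∀ i, triSet (tiles i) ⊆ triSet ABC := fun i => cover ▸ Set.subset_iUnion (fun i => triSet (tiles i)) i
  choose ρ hρ hvol using fun i => tile_vol ABC (tiles i) hABC (hnd i) (hsub i) m
  obtain ⟨r₀, hr₀, hv⟩ := local_vol ABC hABC m
  obtain ⟨r, hr, hr1, hr2⟩ : ∃ r > 0, r ≤ r₀ ∧ ∀ i, r ≤ ρ i := by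
    by_cases hN : Nonempty (Fin N)
    · refine ⟨min r₀ (Finset.univ.inf' Finset.univ_nonempty ρ), ?_, min_le_left _ _, fun i => (min_le_right _ _).trans (Finset.inf'_le _ (Finset.mem_univ i))⟩
      refine lt_min hr₀ ?_
      rw [Finset.lt_inf'_iff]
      exact fun i _ => hρ i
    · exact ⟨r₀, hr₀, le_rfl, fun i => absurd ⟨i⟩ hN⟩
  have hconv : ∀ i, Convex ℝ (triSet (tiles i)) := fun i => convex_convexHull ℝ _
  have hae : Pairwise (Function.onFun (AEDisjoint volume) fun i => triSet (tiles i) ∩ Metric.ball (ABC m) r) := by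
    intro i j hij
    refine measure_mono_null (t := frontier (triSet (tiles i)) ∪ frontier (triSet (tiles j))) ?_ ?_
    · rintro x ⟨⟨h1, -⟩, ⟨h2, -⟩⟩
      by_contra h
      rw [Set.mem_union, not_or] at h
      have a1 : x ∈ interior (triSet (tiles i)) := by
        by_contra h'
        exact h.1 ⟨subset_closure h1, h'⟩
      have a2 : x ∈ interior (triSet (tiles j)) := by
        by_contra h'
        exact h.2 ⟨subset_closure h2, h'⟩
      have : x ∈ (∅ : Set Pt) := disj i j hij ▸ ⟨a1, a2⟩
      exact this
    · exact measure_union_null ((hconv i).addHaar_frontier _) ((hconv j).addHaar_frontier _)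
  have hmeas : ∀ i, NullMeasurableSet (triSet (tiles i) ∩ Metric.ball (ABC m) r) volume := fun i =>
    ((triSet_compact _).isClosed.measurableSet.inter Metric.isOpen_ball.measurableSet).nullMeasurableSet
  have hU := measure_iUnion₀ hae hmeas
  rw [← Set.iUnion_inter, cover, hv r hr hr1, tsum_fintype] at hU
  have hnn : ∀ i, 0 ≤ ∑ k, if tiles i k = ABC m then triAngle (tiles i) k else 0 := fun i =>
    Finset.sum_nonneg fun k _ => by split_ifs; exacts [angle_nonneg _ _ _, le_rfl]
  have h00 : 0 ≤ triAngle ABC m / 2 * r ^ 2 :=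
    mul_nonneg (div_nonneg (angle_nonneg _ _ _) (by norm_num)) (by positivity)
  rw [Finset.sum_congr rfl (fun i _ => hvol i r hr (hr2 i)),
    ← ENNReal.ofReal_sum_of_nonneg (fun i _ => mul_nonneg (div_nonneg (hnn i) (by norm_num)) (by positivity)),
    ENNReal.ofReal_eq_ofReal_iff h00
      (Finset.sum_nonneg fun i _ => mul_nonneg (div_nonneg (hnn i) (by norm_num)) (by positivity)),
    ← Finset.sum_mul, ← Finset.sum_div] at hU
  have := mul_right_cancel₀ (by positivity) hU
  linarith

lemma angle_of_dist (a b c a' b' c' : Pt) (h1 : dist a b = dist a' b') (h2 : dist c b = dist c' b')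
    (h3 : dist a c = dist a' c') : ∠ a b c = ∠ a' b' c' := by
  simp only [EuclideanGeometry.angle, InnerProductGeometry.angle,
    real_inner_eq_norm_mul_self_add_norm_mul_self_sub_norm_sub_mul_self_div_two, vsub_eq_sub,
    sub_sub_sub_cancel_right, ← dist_eq_norm, h1, h2, h3]

lemma angle_tri (X : Tri) (i j k : Fin 3) (hij : i ≠ j) (hik : i ≠ k) (hjk : j ≠ k) :
    ∠ (X i) (X k) (X j) = triAngle X k := by
  have : (i = k + 1 ∧ j = k + 2) ∨ (i = k + 2 ∧ j = k + 1) := by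
    revert i j k; decide
  rcases this with ⟨rfl, rfl⟩ | ⟨rfl, rfl⟩
  · rfl
  · exact angle_comm _ _ _

lemma congr_angle (X T : Tri) (σ : Equiv.Perm (Fin 3))
    (h : ∀ i j : Fin 3, dist (X i) (X j) = dist (T (σ i)) (T (σ j))) (k : Fin 3) :
    triAngle X k = triAngle T (σ k) := by
  have n1 : k + 1 ≠ k + 2 := by revert k; decide
  have n2 : k + 1 ≠ k := by revert k; decide
  have n3 : k + 2 ≠ k := by revert k; decide
  rw [← angle_tri T (σ (k+1)) (σ (k+2)) (σ k) (σ.injective.ne n1) (σ.injective.ne n2) (σ.injective.ne n3)]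
  exact angle_of_dist _ _ _ _ _ _ (h _ _) (h _ _) (h _ _)

lemma congr_nondeg (X T : Tri) (hT : IsTriangle T) (h : CongruentTri X T) : IsTriangle X := by
  obtain ⟨σ, h⟩ := h
  have ha := congr_angle X T σ h 0
  obtain ⟨-, -, h0, hπ⟩ := triAngle_bounds T hT (σ 0)
  have hne : ∀ i j, i ≠ j → X i ≠ X j := by
    intro i j hij
    rw [← dist_pos, h i j, dist_pos]
    exact fun h' => hij (σ.injective (hT.injective h'))
  refine affineIndependent_iff_not_collinear.2 ?_
  have hr : Set.range X = {X 1, X 0, X 2} := by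
    ext y
    simp only [Set.mem_range, Set.mem_insert_iff, Set.mem_singleton_iff]
    simp [Fin.exists_fin_succ, eq_comm]; tauto
  rw [hr, collinear_iff_eq_or_eq_or_angle_eq_zero_or_angle_eq_pi]
  have e : ∠ (X 1) (X 0) (X 2) = triAngle T (σ 0) := ha
  rw [e]
  rintro (h | h | h | h)
  · exact hne 1 0 (by decide) h
  · exact hne 2 0 (by decide) h
  · linarith
  · linarith

lemma tri_sum (X : Tri) (hX : IsTriangle X) : triAngle X 0 + triAngle X 1 + triAngle X 2 = π := by
  have := angle_add_angle_add_angle_eq_pi (X 2) (hX.injective.ne (show (1 : Fin 3) ≠ 0 by decide))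
  rw [← this, ← angle_tri X 2 1 0 (by decide) (by decide) (by decide),
    ← angle_tri X 0 2 1 (by decide) (by decide) (by decide),
    ← angle_tri X 1 0 2 (by decide) (by decide) (by decide), angle_comm (X 2) (X 0) (X 1)]
  simp only [angle_comm]
  ring

lemma tri_sines (X : Tri) (hX : IsTriangle X) : ∃ d > 0, ∀ i j k : Fin 3, i ≠ j → i ≠ k → j ≠ k →
    dist (X i) (X j) = d * Real.sin (triAngle X k) := by
  have hs : ∀ k, 0 < Real.sin (triAngle X k) := fun k => by
    obtain ⟨-, -, h0, hπ⟩ := triAngle_bounds X hX k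
    exact Real.sin_pos_of_pos_of_lt_pi h0 hπ
  have law : ∀ i j k : Fin 3, i ≠ j → i ≠ k → j ≠ k →
      Real.sin (triAngle X j) * dist (X j) (X k) = Real.sin (triAngle X i) * dist (X k) (X i) := by
    intro i j k h1 h2 h3
    have := law_sin (X i) (X j) (X k)
    rwa [angle_tri X i k j h2 h1 h3.symm, angle_tri X k j i h3.symm h2.symm h1.symm] at this
  have l1 := law 0 1 2 (by decide) (by decide) (by decide)
  have l2 := law 0 2 1 (by decide) (by decide) (by decide)
  have hd : 0 < dist (X 1) (X 2) := dist_pos.2 (hX.injective.ne (by decide))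
  have hs0 := hs 0
  refine ⟨dist (X 1) (X 2) / Real.sin (triAngle X 0), by positivity, ?_⟩
  have d0 : dist (X 1) (X 2) = dist (X 1) (X 2) / Real.sin (triAngle X 0) * Real.sin (triAngle X 0) := by
    field_simp
  have d1 : dist (X 2) (X 0) = dist (X 1) (X 2) / Real.sin (triAngle X 0) * Real.sin (triAngle X 1) := by
    field_simp; linarith
  have d2 : dist (X 0) (X 1) = dist (X 1) (X 2) / Real.sin (triAngle X 0) * Real.sin (triAngle X 2) := by
    rw [dist_comm (X 2) (X 1), dist_comm (X 1) (X 0)] at l2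
    field_simp; linarith
  have d0' := (dist_comm (X 2) (X 1)).trans d0
  have d1' := (dist_comm (X 0) (X 2)).trans d1
  have d2' := (dist_comm (X 1) (X 0)).trans d2
  intro i j k h1 h2 h3
  fin_cases i <;> fin_cases j <;> fin_cases k <;>
    first | exact absurd rfl h1 | exact absurd rfl h2 | exact absurd rfl h3 | assumption

lemma similar_of_angles (T X : Tri) (hT : IsTriangle T) (hX : IsTriangle X) (σ : Equiv.Perm (Fin 3))
    (h : ∀ k, triAngle T k = triAngle X (σ k)) : SimilarTri T X := by
  obtain ⟨d, hd, h1⟩ := tri_sines T hT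
  obtain ⟨d', hd', h2⟩ := tri_sines X hX
  refine ⟨d / d', by positivity, σ, fun i j => ?_⟩
  by_cases hij : i = j
  · subst hij; simp
  obtain ⟨k, hik, hjk⟩ : ∃ k, i ≠ k ∧ j ≠ k := by revert i j; decide
  rw [h1 i j k hij hik hjk, h2 (σ i) (σ j) (σ k) (σ.injective.ne hij) (σ.injective.ne hik) (σ.injective.ne hjk), h k]
  field_simp

lemma irr_zero (α : ℝ) (hirr : ¬ ∃ q : ℚ, α = (q : ℝ) * π) (x y : ℤ)
    (h : (x : ℝ) * α = y * π) : x = 0 ∧ y = 0 := by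
  have hx : x = 0 := by
    by_contra hx
    refine hirr ⟨(y : ℚ) / x, ?_⟩
    have : (x : ℝ) ≠ 0 := by exact_mod_cast hx
    push_cast
    field_simp
    linarith
  subst hx
  refine ⟨rfl, ?_⟩
  have : (y : ℝ) * π = 0 := by rw [← h]; simp
  exact_mod_cast (mul_eq_zero.1 this).resolve_right Real.pi_ne_zero

lemma perm_of_counts (n : Fin 3 → Fin 3 → ℕ) (hrow : ∀ m, 1 ≤ n m 0 + n m 1 + n m 2)
    (hcol : ∀ c, n 0 c + n 1 c + n 2 c = 1) :
    ∃ τ : Equiv.Perm (Fin 3), ∀ m c, n m c = if c = τ m then 1 else 0 := by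
  have hex : ∀ m, ∃ c, 1 ≤ n m c := by
    intro m
    by_contra! h
    have := hrow m; have := h 0; have := h 1; have := h 2
    omega
  choose f hf using hex
  have hinj : Function.Injective f := by
    intro a b hab
    by_contra hne
    have h1 := hf a; have h2 := hf b
    rw [← hab] at h2
    have h3 := hcol (f a)
    fin_cases a <;> fin_cases b <;> first | exact hne rfl | (simp only [Fin.zero_eta, Fin.mk_one, Fin.reduceFinMk] at *; omega)
  let τ : Equiv.Perm (Fin 3) := Equiv.ofBijective f (Finite.injective_iff_bijective.1 hinj)
  refine ⟨τ, fun m c => ?_⟩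
  obtain ⟨m', rfl⟩ := τ.surjective c
  have h1 : 1 ≤ n m' (τ m') := hf m'
  have h3 := hcol (τ m')
  by_cases h : m' = m
  · subst h
    simp only [if_true]
    fin_cases m' <;> simp only [Fin.zero_eta, Fin.mk_one, Fin.reduceFinMk] at * <;> omega
  · rw [if_neg (fun h' => h (τ.injective h'))]
    fin_cases m' <;> fin_cases m <;> first | exact absurd rfl h | (simp only [Fin.zero_eta, Fin.mk_one, Fin.reduceFinMk] at *; omega)

/-- Let triangle `ABC` be `N`-tiled by a tile with angles `(α, β, γ)` not
similar to `ABC`, with `α` not a rational multiple of `π`.  If either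
`3α + 2β = π` and `ABC` is not isosceles with base angles `α`, or
`γ = 2π/3`, then no tile has its `γ` angle at a vertex of `ABC`. -/
theorem no_gamma_at_vertex (N : ℕ) (ABC T : Tri)
    (hABC : IsTriangle ABC) (hT : IsTriangle T)
    (α β γ : ℝ) (hangles : HasAngles T α β γ)
    (tiles : Fin N → Tri) (ht : IsTiling N ABC T tiles)
    (hsim : ¬ SimilarTri T ABC)
    (hirr : ¬ ∃ q : ℚ, α = (q : ℝ) * π)
    (hcase : (3 * α + 2 * β = π ∧
        ¬ ∃ k l : Fin 3, k ≠ l ∧ triAngle ABC k = α ∧ triAngle ABC l = α) ∨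
      γ = 2 * π / 3) :
    ∀ (i : Fin N) (k : Fin 3) (m : Fin 3), tiles i k = ABC m →
      triAngle (tiles i) k ≠ γ := by
  classical
  intro i₀ k₀ m₀ hv hγ
  obtain ⟨hα, hβ, hγ'⟩ := hangles
  have hnd : ∀ i, IsTriangle (tiles i) := fun i => congr_nondeg _ T hT (ht.congr i)
  have hcls : ∀ i k, ∃ c, triAngle (tiles i) k = triAngle T c ∧
      (triAngle (tiles i) k = γ → c = 2) := by
    intro i k
    by_cases h : triAngle (tiles i) k = γ
    · exact ⟨2, h.trans hγ'.symm, fun _ => rfl⟩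
    · obtain ⟨σ, hσ⟩ := ht.congr i
      exact ⟨σ k, congr_angle _ _ σ hσ k, fun h' => absurd h' h⟩
  choose cls hcls1 hcls2 using hcls
  let n : Fin 3 → Fin 3 → ℕ := fun m c =>
    (Finset.univ.filter fun p : Fin N × Fin 3 => tiles p.1 p.2 = ABC m ∧ cls p.1 p.2 = c).card
  have hsum : ∀ m, triAngle ABC m = n m 0 * α + n m 1 * β + n m 2 * γ := by
    intro m
    rw [angle_sum N ABC hABC tiles hnd ht.disj ht.cover m, ← Finset.sum_product',
      Finset.univ_product_univ]
    simp only [n, Finset.card_filter, Nat.cast_sum, Finset.sum_mul]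
    rw [← Finset.sum_add_distrib, ← Finset.sum_add_distrib]
    refine Finset.sum_congr rfl fun p _ => ?_
    by_cases h : tiles p.1 p.2 = ABC m
    · rw [if_pos h, hcls1]
      generalize cls p.1 p.2 = c
      fin_cases c <;> simp [h, hα, hβ, hγ']
    · simp [h]
  have hrow : ∀ m, 1 ≤ n m 0 + n m 1 + n m 2 := by
    intro m
    by_contra h
    have h0 : n m 0 = 0 := by omega
    have h1 : n m 1 = 0 := by omega
    have h2 : n m 2 = 0 := by omega
    have := hsum m
    rw [h0, h1, h2] at this
    have := (triAngle_bounds ABC hABC m).2.2.1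
    simp at *
    linarith
  have hn0 : 1 ≤ n m₀ 2 := by
    refine Finset.card_pos.2 ⟨(i₀, k₀), ?_⟩
    simp only [Finset.mem_filter, Finset.mem_univ, true_and]
    exact ⟨hv, hcls2 _ _ hγ⟩
  have hR : 1 ≤ n 0 2 + n 1 2 + n 2 2 := by
    fin_cases m₀ <;> simp only [Fin.zero_eta, Fin.mk_one, Fin.reduceFinMk] at hn0 <;> omega
  have hA := tri_sum ABC hABC
  have hT' := tri_sum T hT
  rw [hα, hβ, hγ'] at hT'
  rw [hsum 0, hsum 1, hsum 2] at hA
  obtain ⟨P, hP⟩ : ∃ P, P = n 0 0 + n 1 0 + n 2 0 := ⟨_, rfl⟩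
  obtain ⟨Q, hQ⟩ : ∃ Q, Q = n 0 1 + n 1 1 + n 2 1 := ⟨_, rfl⟩
  obtain ⟨R, hRR⟩ : ∃ R, R = n 0 2 + n 1 2 + n 2 2 := ⟨_, rfl⟩
  have hA' : (P : ℝ) * α + Q * β + R * γ = π := by
    rw [hP, hQ, hRR]; push_cast; linarith
  have hPQR : P = 1 ∧ Q = 1 ∧ R = 1 := by
    rcases hcase with ⟨h32, -⟩ | h23
    · obtain ⟨a, b⟩ := irr_zero α hirr (2 * (P + 2 * R) - 3 * (Q + R)) (2 - (Q + R)) (by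
        push_cast
        have hb : β = (π - 3 * α) / 2 := by linarith
        have hc : γ = (π + α) / 2 := by linarith
        rw [hb, hc] at hA'
        linarith)
      omega
    · obtain ⟨a, b⟩ := irr_zero α hirr (3 * (P - Q)) (3 - Q - 2 * R) (by
        push_cast
        have hb : β = π / 3 - α := by linarith
        rw [hb, h23] at hA'
        linarith)
      omega
  obtain ⟨τ, hτ⟩ := perm_of_counts n hrow (by
    intro c
    fin_cases c <;> simp only [Fin.zero_eta, Fin.mk_one, Fin.reduceFinMk] <;> omega)
  apply hsim
  have hang : ∀ m, triAngle ABC m = triAngle T (τ m) := by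
    intro m
    rw [hsum m, hτ m 0, hτ m 1, hτ m 2, ← hα, ← hβ, ← hγ']
    generalize τ m = c
    fin_cases c <;> simp
  refine similar_of_angles T ABC hT hABC τ.symm fun k => ?_
  rw [hang, Equiv.apply_symm_apply]
end
end
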